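/- Under Assumptions (A1)–(A3), for every r > 0 and every finite rooted graph (H,h), the empirical frequency C_{r,n}(H,h) := (1/n) Σ_{i=1}^n 1{ F^{𝔾_n}_i(r) is rooted-isomorphic to (H,h) } converges in probability, as n → ∞, to the deterministic limit P( F_r is rooted-isomorphic to (H,h) ). -/

import Mathlib

open MeasureTheory ProbabilityTheory Filter Topology
open scoped ENNReal NNReal

noncomputable section

/-- Euclidean space `ℝ^d`. -/
abbrev Euc (d : ℕ) : Type := EuclideanSpace ℝ (Fin d)

open Classical in
/-- Real-valued indicator of a proposition. -/
noncomputable def indic (p : Prop) : ℝ := if p then 1 else 0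

/-- The box `I_n = [-n^{1/d}/2, n^{1/d}/2]^d`. -/
def boxIn (d n : ℕ) : Set (Euc d) :=
  {x | ∀ i, |x i| ≤ ((n : ℝ) ^ ((1 : ℝ) / d)) / 2}

/-- Uniform probability measure on the box `I_n` (which has Lebesgue measure `n`). -/
noncomputable def unifBox (d n : ℕ) : Measure (Euc d) :=
  (n : ℝ≥0∞)⁻¹ • (volume.restrict (boxIn d n))

/-- Uniform probability measure on `[0,1]`. -/
noncomputable def unif01 : Measure ℝ := volume.restrict (Set.Icc 0 1)

/-- Uniform probability measure on the open Euclidean ball of radius `r` about the origin. -/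
noncomputable def unifBall (d : ℕ) (r : ℝ) : Measure (Euc d) :=
  (volume (Metric.ball (0 : Euc d) r))⁻¹ • (volume.restrict (Metric.ball (0 : Euc d) r))

/-- The sequence of finite spatial inhomogeneous random graphs (SIRGs), on a probability
space `(Ω, P)`: for each `n`, vertex locations `Y n` are i.i.d. uniform on the box `I_n`
(these are the blown-up locations `Y_i = n^{1/d} X_i` with `X_i` i.i.d. uniform on the unit
cube), `Wt n` is a random weight vector, `U n` is an array whose entries for `i < j` are
i.i.d. Uniform[0,1] variables, the three being mutually independent; `κn n` is a connection
function with values in `[0,1]` (for positive first argument), measurable and symmetric in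
its last two arguments; `R n` is a pair of independent uniformly chosen vertices,
independent of everything else. -/
structure SIRGModel (d : ℕ) (Ω : Type) [MeasurableSpace Ω] where
  P : Measure Ω
  probP : IsProbabilityMeasure P
  Y : (n : ℕ) → Fin n → Ω → Euc d
  Wt : (n : ℕ) → Fin n → Ω → ℝ
  U : (n : ℕ) → Fin n → Fin n → Ω → ℝ
  R : (n : ℕ) → 0 < n → Fin 2 → Ω → Fin n
  κn : ℕ → ℝ → ℝ → ℝ → ℝ
  Y_meas : ∀ n i, Measurable (Y n i)
  Wt_meas : ∀ n i, Measurable (Wt n i)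
  U_meas : ∀ n i j, Measurable (U n i j)
  R_meas : ∀ n hn k, Measurable (R n hn k)
  κn_meas : ∀ n, Measurable (fun p : ℝ × ℝ × ℝ => κn n p.1 p.2.1 p.2.2)
  κn_nonneg : ∀ n t x y, 0 < t → 0 ≤ κn n t x y
  κn_le_one : ∀ n t x y, 0 < t → κn n t x y ≤ 1
  κn_symm : ∀ n t x y, κn n t x y = κn n t y x
  joint_law : ∀ n : ℕ,
      Measure.map (fun ω =>
        ((fun i => Y n i ω), (fun i => Wt n i ω),
          (fun p : {p : Fin n × Fin n // p.1 < p.2} => U n p.1.1 p.1.2 ω))) P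
        = (Measure.pi fun _ : Fin n => unifBox d n).prod
            ((Measure.map (fun ω i => Wt n i ω) P).prod
              (Measure.pi fun _ : {p : Fin n × Fin n // p.1 < p.2} => unif01))
  R_unif : ∀ n hn (i j : Fin n),
      P {ω | R n hn 0 ω = i ∧ R n hn 1 ω = j} = ((n : ℝ≥0∞) * n)⁻¹
  R_indep : ∀ n hn,
      IndepFun (fun ω => (R n hn 0 ω, R n hn 1 ω))
        (fun ω => ((fun i => Y n i ω), (fun i => Wt n i ω), (fun i j => U n i j ω))) P

variable {d : ℕ} {Ω : Type} [MeasurableSpace Ω]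

instance (M : SIRGModel d Ω) : IsProbabilityMeasure M.P := M.probP

/-- The random graph `𝔾_n`: for `i < j`, the edge `{i,j}` is present iff
`U_{ij} ≤ κ_n(‖Y_i - Y_j‖, W_i, W_j)`. -/
def SIRGModel.graph (M : SIRGModel d Ω) (n : ℕ) (ω : Ω) : SimpleGraph (Fin n) :=
  SimpleGraph.fromRel (fun i j =>
    i < j ∧ M.U n i j ω ≤
      M.κn n (dist (M.Y n i ω) (M.Y n j ω)) (M.Wt n i ω) (M.Wt n j ω))

open Classical in
/-- Degree of a vertex in a finite simple graph. -/
noncomputable def degOf {V : Type*} [Fintype V] (G : SimpleGraph V) (v : V) : ℕ :=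
  (Finset.univ.filter fun u => G.Adj v u).card

/-- Rooted isomorphism of rooted graphs. -/
def RootedIso {V₁ : Type*} {V₂ : Type*} (G₁ : SimpleGraph V₁) (r₁ : V₁)
    (G₂ : SimpleGraph V₂) (r₂ : V₂) : Prop :=
  ∃ φ : G₁ ≃g G₂, φ r₁ = r₂

/-- The (vertex set of the) ball of radius `K` around `o` in the graph `G`:
all vertices reachable from `o` within graph distance `K`. -/
def graphBall {V : Type*} (G : SimpleGraph V) (o : V) (K : ℕ) : Set V :=
  {v | G.Reachable o v ∧ G.dist o v ≤ K}

/-- `ballIso G o K H h`: the subgraph of `G` induced by the `K`-ball around `o`, rooted at `o`,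
is rooted-isomorphic to `(H, h)`. -/
def ballIso {V : Type*} (G : SimpleGraph V) (o : V) (K : ℕ)
    {V' : Type*} (H : SimpleGraph V') (h : V') : Prop :=
  ∃ ho : o ∈ graphBall G o K, RootedIso (G.induce (graphBall G o K)) ⟨o, ho⟩ H h

/-- The set of vertices whose location lies within Euclidean distance `r` of the location
of vertex `i`. -/
def SIRGModel.euclSet (M : SIRGModel d Ω) (n : ℕ) (ω : Ω) (i : Fin n) (r : ℝ) :
    Set (Fin n) :=
  {j | dist (M.Y n j ω) (M.Y n i ω) < r}

/-- The Euclidean graph neighbourhood `F^{𝔾_n}_i(r)`: the subgraph of `𝔾_n` induced by the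
vertices whose location is within distance `r` of the location of `i`. -/
def SIRGModel.euclNbhd (M : SIRGModel d Ω) (n : ℕ) (ω : Ω) (i : Fin n) (r : ℝ) :=
  (M.graph n ω).induce (M.euclSet n ω i r)

/-- `F^{𝔾_n}_i(r)`, rooted at `i`, is rooted-isomorphic to `(H, h)`. -/
def SIRGModel.euclNbhdIso (M : SIRGModel d Ω) (n : ℕ) (ω : Ω) (i : Fin n) (r : ℝ)
    {V : Type*} (H : SimpleGraph V) (h : V) : Prop :=
  ∃ hi : i ∈ M.euclSet n ω i r, RootedIso (M.euclNbhd n ω i r) ⟨i, hi⟩ H h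

/-- The set of vertices in the `K`-ball around `i` of the Euclidean neighbourhood graph
`F^{𝔾_n}_i(r)`, viewed as a subset of the vertex set of `𝔾_n`. -/
def SIRGModel.spatialBall (M : SIRGModel d Ω) (n : ℕ) (ω : Ω) (i : Fin n) (r : ℝ)
    (K : ℕ) : Set (Fin n) :=
  {v | ∃ (hi : i ∈ M.euclSet n ω i r) (hv : v ∈ M.euclSet n ω i r),
      (⟨v, hv⟩ : M.euclSet n ω i r) ∈ graphBall (M.euclNbhd n ω i r) ⟨i, hi⟩ K}

/-- Empirical frequency of the rooted graph `(H,h)` among the Euclidean `r`-neighbourhoods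
`F^{𝔾_n}_i(r)`, `i ∈ [n]`. -/
noncomputable def SIRGModel.empNbhdFreq (M : SIRGModel d Ω) (n : ℕ) (r : ℝ)
    {V : Type*} (H : SimpleGraph V) (h : V) (ω : Ω) : ℝ :=
  (∑ i : Fin n, indic (M.euclNbhdIso n ω i r H h)) / n

/-- Empirical frequency of the rooted graph `(H,h)` among the rooted `K`-balls of `𝔾_n`. -/
noncomputable def SIRGModel.empBallFreq (M : SIRGModel d Ω) (n K : ℕ)
    {V : Type*} (H : SimpleGraph V) (h : V) (ω : Ω) : ℝ :=
  (∑ i : Fin n, indic (ballIso (M.graph n ω) i K H h)) / n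

/-- Prepend the origin to a tuple of points. -/
def withZero {d l : ℕ} (z : Fin l → Euc d) : Fin (l + 1) → Euc d :=
  Fin.cases 0 z

/-- The limiting graph on `l+1` vertices built from locations `0, z 0, …, z (l-1)`, weights `w`
and uniform variables `u`, with connection function `κ`. -/
def limitGraph (d : ℕ) (κ : ℝ → ℝ → ℝ → ℝ) (l : ℕ) (z : Fin l → Euc d)
    (w : Fin (l + 1) → ℝ) (u : Fin (l + 1) → Fin (l + 1) → ℝ) : SimpleGraph (Fin (l + 1)) :=
  SimpleGraph.fromRel (fun i j =>
    i < j ∧ u i j ≤ κ (dist (withZero z i) (withZero z j)) (w i) (w j))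

/-- Poisson probability mass function with mean `lam`. -/
noncomputable def poissonWeight (lam : ℝ≥0∞) (k : ℕ) : ℝ≥0∞ :=
  ENNReal.ofReal (Real.exp (-(lam.toReal)) * lam.toReal ^ k / (Nat.factorial k))

/-- The probability that the Poissonized limiting Euclidean `r`-neighbourhood `F_r`
(rooted at the vertex `0` located at the origin) is rooted-isomorphic to `(H,h)`:
the number `N` of non-root vertices is Poisson with mean `λ_d(B_r)`; given `N = l`, the
non-root locations are i.i.d. uniform on `B_r`, the `l+1` weights are i.i.d. with law `μW`,
and, given everything, edges are present independently with probabilities given by `κ`. -/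
noncomputable def limitNbhdProb (d : ℕ) (κ : ℝ → ℝ → ℝ → ℝ) (μW : Measure ℝ) (r : ℝ)
    {V : Type*} (H : SimpleGraph V) (h : V) : ℝ≥0∞ :=
  ∑' l : ℕ,
    poissonWeight (volume (Metric.ball (0 : Euc d) r)) l *
      ((Measure.pi fun _ : Fin l => unifBall d r).prod
          ((Measure.pi fun _ : Fin (l + 1) => μW).prod
            (Measure.pi fun _ : Fin (l + 1) => Measure.pi fun _ : Fin (l + 1) => unif01)))
        {zwu : (Fin l → Euc d) × (Fin (l + 1) → ℝ) × (Fin (l + 1) → Fin (l + 1) → ℝ) |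
          RootedIso (limitGraph d κ l zwu.1 zwu.2.1 zwu.2.2) 0 H h}

/-- The path expectation
`E[∏_{i=1}^{j} κ_n(‖x_i − x_{i-1}‖, W^{(n)}_{V_{i-1}}, W^{(n)}_{V_i})]`, where
`V_0, …, V_j` are i.i.d. uniform indices on `[n]`, independent of the weights `W^{(n)}`. -/
noncomputable def SIRGModel.pathExp (M : SIRGModel d Ω) (n j : ℕ)
    (x : Fin (j + 1) → Euc d) : ℝ :=
  ∫ ω, (∑ v : Fin (j + 1) → Fin n,
      ∏ i : Fin j,
        M.κn n (dist (x i.succ) (x i.castSucc)) (M.Wt n (v i.castSucc) ω)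
          (M.Wt n (v i.succ) ω)) / (n : ℝ) ^ (j + 1) ∂M.P

/-- `𝕎_j(x_0, …, x_j) = E[∏_{i=1}^{j} κ(‖x_i − x_{i-1}‖, W^{(i-1)}, W^{(i)})]` with
`W^{(0)}, …, W^{(j)}` i.i.d. with law `μW`. -/
noncomputable def Wfun (d : ℕ) (κ : ℝ → ℝ → ℝ → ℝ) (μW : Measure ℝ) (j : ℕ)
    (x : Fin (j + 1) → Euc d) : ℝ :=
  ∫ w : Fin (j + 1) → ℝ,
    ∏ i : Fin j, κ (dist (x i.succ) (x i.castSucc)) (w i.castSucc) (w i.succ)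
    ∂(Measure.pi fun _ : Fin (j + 1) => μW)

/-- The product of indicators
`∏_{i=1}^{j-1} 1{‖x_i − x_{i-1}‖ < a^{m^i}} · 1{‖x_j − x_{j-1}‖ > a^{m^j}}`. -/
noncomputable def pathIndic {d : ℕ} (j : ℕ) (a m : ℝ) (x : Fin (j + 1) → Euc d) : ℝ≥0∞ :=
  ∏ i : Fin j,
    if i.val + 1 < j then
      (if dist (x i.succ) (x i.castSucc) < a ^ (m ^ (i.val + 1)) then 1 else 0)
    else
      (if a ^ (m ^ j) < dist (x i.succ) (x i.castSucc) then 1 else 0)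

/-- The indicator of `z_k ∈ B(a^{m^k})` for `1 ≤ k ≤ j-1` and `z_j ∉ B(a^{m^j})`
(with `z` indexed by `Fin j`, so `z i` stands for `z_{i+1}`). -/
noncomputable def shellIndic {d : ℕ} (j : ℕ) (a m : ℝ) (z : Fin j → Euc d) : ℝ≥0∞ :=
  ∏ i : Fin j,
    if i.val + 1 < j then
      (if ‖z i‖ < a ^ (m ^ (i.val + 1)) then 1 else 0)
    else
      (if a ^ (m ^ j) ≤ ‖z i‖ then 1 else 0)

/-- The expectation `E[κ_n(t, W^{(n)}_{V_1}, W^{(n)}_{V_2})]`, where `V_1, V_2` are i.i.d.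
uniform indices on `[n]`, independent of the weights. -/
noncomputable def SIRGModel.expKn (M : SIRGModel d Ω) (n : ℕ) (t : ℝ) : ℝ :=
  ∫ ω, (∑ v : Fin n × Fin n, M.κn n t (M.Wt n v.1 ω) (M.Wt n v.2 ω)) / (n : ℝ) ^ 2 ∂M.P

/-- The radius `r(a, m, K) = a^m + a^{m^2} + ⋯ + a^{m^K}`. -/
noncomputable def rr (a m : ℝ) (K : ℕ) : ℝ :=
  ∑ k ∈ Finset.range K, a ^ (m ^ (k + 1))

/-- Assumptions (A1)–(A2): convergence in probability of the empirical weight distribution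
to the law `μW` of the limiting weight (at every continuity point of its cdf), and
convergence of the connection functions `κn` to a limiting connection function `κ`. -/
structure SIRGWeakAssumptions {d : ℕ} {Ω : Type} [MeasurableSpace Ω] (M : SIRGModel d Ω) where
  μW : Measure ℝ
  probμW : IsProbabilityMeasure μW
  weights_conv : ∀ x : ℝ, μW {x} = 0 →
    TendstoInMeasure M.P
      (fun n ω => (∑ i : Fin n, indic (M.Wt n i ω ≤ x)) / n) atTop
      (fun _ => (μW (Set.Iic x)).toReal)
  κ : ℝ → ℝ → ℝ → ℝ
  κ_meas : Measurable fun p : ℝ × ℝ × ℝ => κ p.1 p.2.1 p.2.2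
  κ_nonneg : ∀ t x y, 0 < t → 0 ≤ κ t x y
  κ_le_one : ∀ t x y, 0 < t → κ t x y ≤ 1
  κ_symm : ∀ t x y, κ t x y = κ t y x
  κ_conv : ∀ (x y : ℝ) (xs ys : ℕ → ℝ),
      Tendsto xs atTop (𝓝 x) → Tendsto ys atTop (𝓝 y) →
      ∀ᵐ t ∂(volume : Measure ℝ), 0 < t →
        Tendsto (fun n => M.κn n t (xs n) (ys n)) atTop (𝓝 (κ t x y))

/-- Assumptions (A1)–(A3): additionally, the polynomial tail bound
`E[κ(t, W^{(1)}, W^{(2)})] ≤ t^{-α}` with `α > d`, for all `t > t₀`. -/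
structure SIRGAssumptions {d : ℕ} {Ω : Type} [MeasurableSpace Ω] (M : SIRGModel d Ω)
    extends SIRGWeakAssumptions M where
  t₀ : ℝ
  α : ℝ
  t₀_pos : 0 < t₀
  α_gt_dim : (d : ℝ) < α
  κ_tail : ∀ t : ℝ, t₀ < t →
      ∫ p : ℝ × ℝ, κ t p.1 p.2 ∂(μW.prod μW) ≤ t ^ (-α)


/-- Product measures over a sum of index types. -/
theorem mp_sum {ι κ J α : Type*} [Fintype ι] [Fintype κ] [Fintype J] [MeasurableSpace α]
    (ν : Measure α) [SigmaFinite ν] (e : ι ⊕ κ ≃ J) :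
    MeasurePreserving (fun p : (ι → α) × (κ → α) => fun j => Sum.elim p.1 p.2 (e.symm j))
      ((Measure.pi fun _ => ν).prod (Measure.pi fun _ => ν)) (Measure.pi fun _ => ν) := by
  have hm : Measurable (fun p : (ι → α) × (κ → α) => fun j => Sum.elim p.1 p.2 (e.symm j)) := by
    refine measurable_pi_lambda _ fun j => ?_
    rcases e.symm j with a | b
    · exact (measurable_pi_apply a).comp measurable_fst
    · exact (measurable_pi_apply b).comp measurable_snd
  refine ⟨hm, (Measure.pi_eq fun s hs => ?_).symm⟩
  rw [Measure.map_apply hm (MeasurableSet.univ_pi hs)]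
  have : (fun p : (ι → α) × (κ → α) => fun j => Sum.elim p.1 p.2 (e.symm j)) ⁻¹'
      (Set.univ.pi s) = (Set.univ.pi fun a => s (e (Sum.inl a))) ×ˢ
        (Set.univ.pi fun b => s (e (Sum.inr b))) := by
    ext p
    simp only [Set.mem_preimage, Set.mem_pi, Set.mem_univ, true_implies, Set.mem_prod]
    constructor
    · intro h
      exact ⟨fun a => by simpa using h (e (Sum.inl a)), fun b => by simpa using h (e (Sum.inr b))⟩
    · rintro ⟨h1, h2⟩ j
      obtain ⟨x, rfl⟩ := e.surjective j
      rcases x with a | b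
      · simpa using h1 a
      · simpa using h2 b
  rw [this, Measure.prod_prod, Measure.pi_pi, Measure.pi_pi, ← e.prod_comp, Fintype.prod_sum_type]

theorem mp_curry {A B α : Type*} [Fintype A] [Fintype B] [MeasurableSpace α]
    (ν : Measure α) [SigmaFinite ν] :
    MeasurePreserving (fun y : A → B → α => fun p : A × B => y p.1 p.2)
      (Measure.pi fun _ => Measure.pi fun _ => ν) (Measure.pi fun _ => ν) := by
  have hm : Measurable (fun y : A → B → α => fun p : A × B => y p.1 p.2) := by fun_prop
  refine ⟨hm, (Measure.pi_eq fun s hs => ?_).symm⟩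
  rw [Measure.map_apply hm (MeasurableSet.univ_pi hs)]
  have : (fun y : A → B → α => fun p : A × B => y p.1 p.2) ⁻¹' (Set.univ.pi s)
      = Set.univ.pi fun a => Set.univ.pi fun b => s (a, b) := by
    ext y
    simp [Set.mem_pi]
  rw [this, Measure.pi_pi, Fintype.prod_prod_type]
  simp [Measure.pi_pi]

/-- splitting equivalence for an injective map -/
def splitEquiv {ι J : Type*} (v : ι → J) (hv : Function.Injective v) :
    ι ⊕ {j // j ∉ Set.range v} ≃ J := by
  classical
  exact (Equiv.sumCongr (Equiv.ofInjective v hv) (Equiv.refl _)).trans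
    (Equiv.Set.sumCompl (Set.range v))

theorem splitEquiv_inl {ι J : Type*} (v : ι → J) (hv : Function.Injective v) (a : ι) :
    splitEquiv v hv (Sum.inl a) = v a := by
  simp [splitEquiv]
  rfl

theorem splitEquiv_inr {ι J : Type*} (v : ι → J) (hv : Function.Injective v)
    (a : {j // j ∉ Set.range v}) :
    splitEquiv v hv (Sum.inr a) = a := by
  simp [splitEquiv]
  rfl

theorem splitEquiv_symm_v {ι J : Type*} (v : ι → J) (hv : Function.Injective v) (a : ι) :
    (splitEquiv v hv).symm (v a) = Sum.inl a := by
  rw [Equiv.symm_apply_eq, splitEquiv_inl]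

theorem splitEquiv_symm_r {ι J : Type*} (v : ι → J) (hv : Function.Injective v)
    (a : {j // j ∉ Set.range v}) :
    (splitEquiv v hv).symm a = Sum.inr a := by
  rw [Equiv.symm_apply_eq, splitEquiv_inr]

open Classical in
theorem mp_reindex {ι J α : Type*} [Fintype ι] [Fintype J] [MeasurableSpace α]
    (ν : Measure α) [IsProbabilityMeasure ν] (v : ι → J) (hv : Function.Injective v) :
    MeasurePreserving (fun y : J → α => fun a => y (v a))
      (Measure.pi fun _ => ν) (Measure.pi fun _ => ν) := by
  have h := mp_sum ν (splitEquiv v hv)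
  have hm : Measurable (fun y : J → α => fun a => y (v a)) := by fun_prop
  refine ⟨hm, ?_⟩
  rw [← h.map_eq, Measure.map_map hm h.measurable]
  have : ((fun y : J → α => fun a => y (v a)) ∘ (fun p : (ι → α) × ({j // j ∉ Set.range v} → α) =>
      fun j => Sum.elim p.1 p.2 ((splitEquiv v hv).symm j))) = Prod.fst := by
    funext p a
    simp [splitEquiv_symm_v]
  rw [this]
  exact measurePreserving_fst.map_eq

open Classical in
theorem lint_split {ι J α : Type*} [Fintype ι] [Fintype J] [MeasurableSpace α]
    (ν : Measure α) [IsProbabilityMeasure ν] (v : ι → J) (hv : Function.Injective v)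
    (Φ : (ι → α) → ℝ≥0∞) (hΦ : Measurable Φ) (B : Set ((ι → α) × α)) (hB : MeasurableSet B) :
    ∫⁻ y : J → α, Φ (fun a => y (v a)) *
        ∏ j : {j // j ∉ Set.range v}, B.indicator 1 ((fun a => y (v a)), y j)
      ∂(Measure.pi fun _ => ν)
    = ∫⁻ y : ι → α, Φ y * ν {x | (y, x) ∈ B} ^ (Fintype.card J - Fintype.card ι)
      ∂(Measure.pi fun _ => ν) := by
  have hB1 : Measurable (B.indicator (1 : (ι → α) × α → ℝ≥0∞)) := measurable_one.indicator hB
  have h := mp_sum ν (splitEquiv v hv)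
  have hcard : Fintype.card {j // j ∉ Set.range v} = Fintype.card J - Fintype.card ι := by
    have := Fintype.card_congr (splitEquiv v hv)
    rw [Fintype.card_sum] at this
    omega
  rw [← h.map_eq, lintegral_map _ h.measurable]
  rotate_left
  · refine (hΦ.comp (by fun_prop)).mul ?_
    refine Finset.measurable_prod _ fun j _ => ?_
    exact hB1.comp (by fun_prop)
  simp only [splitEquiv_symm_v, splitEquiv_symm_r, Sum.elim_inl, Sum.elim_inr]
  rw [lintegral_prod]
  rotate_left
  · refine ((hΦ.comp (by fun_prop)).mul ?_).aemeasurable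
    refine Finset.measurable_prod _ fun j _ => ?_
    exact hB1.comp (by fun_prop)
  refine lintegral_congr fun y => ?_
  dsimp only
  rw [lintegral_const_mul]
  rotate_left
  · refine Finset.measurable_prod _ fun j _ => ?_
    exact hB1.comp (by fun_prop)
  congr 1
  have hBy : MeasurableSet {x | (y, x) ∈ B} := measurable_prodMk_left hB
  have : ∀ z : {j // j ∉ Set.range v} → α, ∏ j, B.indicator (1 : (ι → α) × α → ℝ≥0∞) (y, z j)
      = (Set.univ.pi fun _ => {x | (y, x) ∈ B}).indicator 1 z := by
    intro z
    by_cases hz : ∀ j, (y, z j) ∈ B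
    · rw [Set.indicator_of_mem (by simpa [Set.mem_pi] using hz)]
      exact Finset.prod_eq_one fun j _ => by simp [hz j]
    · rw [Set.indicator_of_notMem (by simpa [Set.mem_pi] using hz)]
      push Not at hz
      obtain ⟨j, hj⟩ := hz
      exact Finset.prod_eq_zero (Finset.mem_univ j) (by simp [hj])
  simp_rw [this]
  rw [lintegral_indicator_one (MeasurableSet.univ_pi fun _ => hBy), Measure.pi_pi]
  simp only [Finset.prod_const, Finset.card_univ]
  rw [hcard]

theorem pi_smul_meas {ι α : Type*} [Fintype ι] [MeasurableSpace α]
    (ν : Measure α) [SigmaFinite ν] (c : ℝ≥0∞) (hc : c ≠ ∞) :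
    (Measure.pi fun _ : ι => c • ν) = c ^ (Fintype.card ι) • (Measure.pi fun _ : ι => ν) := by
  lift c to ℝ≥0 using hc
  have : SigmaFinite ((c : ℝ≥0∞) • ν) := by
    change SigmaFinite (c • ν)
    infer_instance
  refine Measure.pi_eq fun s hs => ?_
  simp [Measure.pi_pi, Finset.prod_mul_distrib]

theorem lint_pi_prod {α : Type*} [MeasurableSpace α] (ν : Measure α) [SigmaFinite ν] :
    ∀ (m : ℕ) (f : Fin m → α → ℝ≥0∞), (∀ c, Measurable (f c)) →
    ∫⁻ x : Fin m → α, ∏ c, f c (x c) ∂(Measure.pi fun _ => ν) = ∏ c, ∫⁻ x, f c x ∂ν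
  | 0, f, _ => by simp
  | m + 1, f, hf => by
    have h := (measurePreserving_piFinSuccAbove (fun _ : Fin (m + 1) => ν) 0).symm
    rw [← h.map_eq, lintegral_map _ h.measurable]
    rotate_left
    · exact Finset.measurable_prod _ fun c _ => (hf c).comp (measurable_pi_apply c)
    have h2 : ∀ p : α × (Fin m → α),
        ∏ c, f c ((MeasurableEquiv.piFinSuccAbove (fun _ => α) 0).symm p c)
          = f 0 p.1 * ∏ c : Fin m, f c.succ (p.2 c) := by
      intro p
      rw [Fin.prod_univ_succ]
      simp [MeasurableEquiv.piFinSuccAbove]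
    simp_rw [h2]
    rw [lintegral_prod]
    rotate_left
    · refine (((hf 0).comp measurable_fst).mul ?_).aemeasurable
      exact Finset.measurable_prod _ fun c _ => (hf c.succ).comp (by fun_prop)
    have h3 : ∀ x : α, ∫⁻ y : Fin m → α, f 0 x * ∏ c : Fin m, f c.succ (y c)
        ∂(Measure.pi fun _ => ν) = f 0 x * ∏ c : Fin m, ∫⁻ x, f c.succ x ∂ν := by
      intro x
      rw [lintegral_const_mul, lint_pi_prod ν m _ fun c => hf c.succ]
      exact Finset.measurable_prod _ fun c _ => (hf c.succ).comp (by fun_prop)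
    dsimp only
    simp_rw [h3]
    rw [lintegral_mul_const _ (hf 0), Fin.prod_univ_succ]

theorem joint_of_seq {E : Type*} [PseudoMetricSpace E] (g : ℕ → E → ℝ) (g0 : E → ℝ)
    (hconv : ∀ x (xs : ℕ → E), Tendsto xs atTop (𝓝 x) →
      Tendsto (fun n => g n (xs n)) atTop (𝓝 (g0 x))) (x : E) :
    Tendsto (fun p : ℕ × E => g p.1 p.2) (atTop ×ˢ 𝓝 x) (𝓝 (g0 x)) := by
  rw [Metric.tendsto_nhds]
  intro ε hε
  by_contra hcon
  have hcon' : ∃ᶠ p in (atTop ×ˢ 𝓝 x : Filter (ℕ × E)), ¬ dist (g p.1 p.2) (g0 x) < ε :=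
    Filter.not_eventually.1 hcon
  obtain ⟨ns, hns, hbad⟩ := Filter.exists_seq_forall_of_frequently hcon'
  rw [Filter.tendsto_prod_iff'] at hns
  obtain ⟨φ, hφ, hmono⟩ := Filter.strictMono_subseq_of_tendsto_atTop hns.1
  set a : ℕ → ℕ := (fun n => (ns n).1) ∘ φ with ha
  set xs : ℕ → E := Function.extend a (fun j => (ns (φ j)).2) (fun _ => x) with hxs
  have hxa : ∀ j, xs (a j) = (ns (φ j)).2 := fun j => hmono.injective.extend_apply _ _ j
  have hxt : Tendsto xs atTop (𝓝 x) := by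
    rw [Metric.tendsto_atTop]
    intro δ hδ
    have h2 := hns.2.comp hφ.tendsto_atTop
    rw [Metric.tendsto_atTop] at h2
    obtain ⟨J, hJ⟩ := h2 δ hδ
    refine ⟨a J, fun m hm => ?_⟩
    by_cases hex : ∃ j, a j = m
    · obtain ⟨j, rfl⟩ := hex
      rw [hxa]
      exact hJ j (hmono.le_iff_le.1 hm)
    · rw [hxs, Function.extend_apply' _ _ _ hex]
      simpa using hδ
  have h3 := (hconv x xs hxt).comp hmono.tendsto_atTop
  rw [Metric.tendsto_atTop] at h3
  obtain ⟨J, hJ⟩ := h3 ε hε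
  have h4 := hJ J le_rfl
  simp only [Function.comp_apply] at h4
  have h5 := hxa J
  simp only [ha, Function.comp_apply] at h4 h5
  rw [h5] at h4
  exact hbad (φ J) h4

theorem cont_of_joint {E : Type*} [PseudoMetricSpace E] (g : ℕ → E → ℝ) (g0 : E → ℝ)
    (hJ : ∀ x, Tendsto (fun p : ℕ × E => g p.1 p.2) (atTop ×ˢ 𝓝 x) (𝓝 (g0 x))) :
    Continuous g0 := by
  rw [continuous_iff_continuousAt]
  intro x
  rw [ContinuousAt, Metric.tendsto_nhds]
  intro ε hε
  have h1 := (Metric.tendsto_nhds.1 (hJ x)) (ε / 2) (half_pos hε)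
  obtain ⟨pa, hpa, pb, hpb, hp⟩ := Filter.eventually_prod_iff.1 h1
  filter_upwards [hpb] with y hy
  have hgy : Tendsto (fun n => g n y) atTop (𝓝 (g0 y)) := by
    have : Tendsto (fun n : ℕ => (n, y)) atTop (atTop ×ˢ 𝓝 y) :=
      tendsto_id.prodMk tendsto_const_nhds
    exact (hJ y).comp this
  have : dist (g0 y) (g0 x) ≤ ε / 2 := by
    refine le_of_tendsto (hgy.dist tendsto_const_nhds) ?_
    filter_upwards [hpa] with n hn using (hp hn hy).le
  linarith

theorem locunif_of_joint {E : Type*} [PseudoMetricSpace E] (g : ℕ → E → ℝ) (g0 : E → ℝ)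
    (hJ : ∀ x, Tendsto (fun p : ℕ × E => g p.1 p.2) (atTop ×ˢ 𝓝 x) (𝓝 (g0 x))) :
    TendstoLocallyUniformly g g0 atTop := by
  rw [Metric.tendstoLocallyUniformly_iff]
  intro ε hε x
  have h1 := (Metric.tendsto_nhds.1 (hJ x)) (ε / 2) (half_pos hε)
  obtain ⟨pa, hpa, pb, hpb, hp⟩ := Filter.eventually_prod_iff.1 h1
  have h2 := Metric.tendsto_nhds.1 ((cont_of_joint g g0 hJ).tendsto x) (ε / 2) (half_pos hε)
  refine ⟨{y | pb y ∧ dist (g0 y) (g0 x) < ε / 2}, hpb.and h2, ?_⟩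
  filter_upwards [hpa] with n hn y hy
  have := hp hn hy.1
  have h3 := hy.2
  have h4 := dist_triangle_right (g0 y) (g n y) (g0 x)
  simp only at this
  linarith

theorem ext_cmt {E : Type*} [PseudoMetricSpace E] [ProperSpace E] [MeasurableSpace E]
    [BorelSpace E] [Nonempty E]
    (ν : ℕ → ProbabilityMeasure E) (ν0 : ProbabilityMeasure E) (hν : Tendsto ν atTop (𝓝 ν0))
    (g : ℕ → E → ℝ) (g0 : E → ℝ) (C : ℝ) (hg : ∀ n, Measurable (g n))
    (hC : ∀ n x, |g n x| ≤ C)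
    (hconv : ∀ x (xs : ℕ → E), Tendsto xs atTop (𝓝 x) →
      Tendsto (fun n => g n (xs n)) atTop (𝓝 (g0 x))) :
    Tendsto (fun n => ∫ x, g n x ∂(ν n : Measure E)) atTop (𝓝 (∫ x, g0 x ∂(ν0 : Measure E))) := by
  have hJ := joint_of_seq g g0 hconv
  have hcont := cont_of_joint g g0 hJ
  have hLU := locunif_of_joint g g0 hJ
  have hC0 : ∀ x, |g0 x| ≤ C := by
    intro x
    exact le_of_tendsto ((hconv x (fun _ => x) tendsto_const_nhds).abs)
      (Eventually.of_forall fun n => hC n x)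
  obtain ⟨x0⟩ := ‹Nonempty E›
  have hCnn : 0 ≤ C := (abs_nonneg _).trans (hC0 x0)
  let G : BoundedContinuousFunction E ℝ := BoundedContinuousFunction.ofNormedAddCommGroup g0 hcont C
    (fun x => by simpa using hC0 x)
  have h2 : Tendsto (fun n => ∫ x, g0 x ∂(ν n : Measure E)) atTop
      (𝓝 (∫ x, g0 x ∂(ν0 : Measure E))) :=
    (ProbabilityMeasure.tendsto_iff_forall_integral_tendsto.1 hν) G
  have hinteg : ∀ n, Integrable (g n) (ν n : Measure E) := fun n =>
    Integrable.of_bound (hg n).aestronglyMeasurable C (Eventually.of_forall fun x => hC n x)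
  have hinteg0 : ∀ n, Integrable g0 (ν n : Measure E) := fun n =>
    Integrable.of_bound hcont.aestronglyMeasurable C (Eventually.of_forall fun x => hC0 x)
  suffices h1 : Tendsto (fun n => ∫ x, (g n x - g0 x) ∂(ν n : Measure E)) atTop (𝓝 0) by
    have := h1.add h2
    simp only [zero_add] at this
    refine this.congr fun n => ?_
    rw [integral_sub (hinteg n) (hinteg0 n)]
    ring
  rw [Metric.tendsto_nhds]
  intro ε hε
  -- choose a large ball
  set η : ℝ := ε / (2 * (2 * C + 1)) with hη
  have hηpos : 0 < η := by positivity
  have hball : Tendsto (fun R : ℕ => (ν0 : Measure E) (Metric.ball x0 R)ᶜ) atTop (𝓝 0) := by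
    have h0 := tendsto_measure_iInter_atTop (μ := (ν0 : Measure E))
      (s := fun R : ℕ => (Metric.ball x0 (R : ℝ))ᶜ)
      (fun R => Metric.isOpen_ball.measurableSet.compl.nullMeasurableSet)
      (fun a b hab => Set.compl_subset_compl.2 (Metric.ball_subset_ball (by exact_mod_cast hab)))
      ⟨0, measure_ne_top _ _⟩
    have h00 : (⋂ R : ℕ, (Metric.ball x0 (R : ℝ))ᶜ) = ∅ := by
      rw [← Set.compl_iUnion, Metric.iUnion_ball_nat, Set.compl_univ]
    rw [h00, measure_empty] at h0
    exact h0
  have hη' : (0 : ℝ≥0∞) < ENNReal.ofReal η := by simpa using hηpos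
  obtain ⟨R, hR⟩ := ((tendsto_order.1 hball).2 _ hη').exists
  have hclosed : IsClosed (Metric.ball x0 (R : ℝ))ᶜ := Metric.isOpen_ball.isClosed_compl
  have hls := ProbabilityMeasure.limsup_measure_closed_le_of_tendsto hν hclosed
  have hev : ∀ᶠ n in atTop, (ν n : Measure E) (Metric.ball x0 (R : ℝ))ᶜ < ENNReal.ofReal η :=
    Filter.eventually_lt_of_limsup_lt (lt_of_le_of_lt hls hR)
  have hK : IsCompact (Metric.closedBall x0 (R : ℝ)) := isCompact_closedBall _ _
  have hU := (tendstoLocallyUniformlyOn_iff_tendstoUniformlyOn_of_compact hK).1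
    (hLU.tendstoLocallyUniformlyOn)
  rw [Metric.tendstoUniformlyOn_iff] at hU
  filter_upwards [hev, hU (ε / 2) (half_pos hε)] with n hn1 hn2
  rw [Real.dist_eq, sub_zero]
  set A := (Metric.ball x0 (R : ℝ))ᶜ with hA
  have hAm : MeasurableSet A := hclosed.measurableSet
  have hbound : ∀ x, |g n x - g0 x| ≤ ε / 2 + A.indicator (fun _ => 2 * C) x := by
    intro x
    by_cases hx : x ∈ A
    · rw [Set.indicator_of_mem hx]
      have := abs_sub (g n x) (g0 x)
      have h3 := hC n x
      have h4 := hC0 x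
      linarith
    · rw [Set.indicator_of_notMem hx, add_zero]
      have hx' : x ∈ Metric.closedBall x0 (R : ℝ) := by
        simp only [hA, Set.mem_compl_iff, not_not] at hx
        exact Metric.ball_subset_closedBall hx
      have := hn2 x hx'
      rw [Real.dist_eq, abs_sub_comm] at this
      exact this.le
  calc |∫ x, (g n x - g0 x) ∂(ν n : Measure E)|
      ≤ ∫ x, |g n x - g0 x| ∂(ν n : Measure E) := abs_integral_le_integral_abs
    _ ≤ ∫ x, (ε / 2 + A.indicator (fun _ => 2 * C) x) ∂(ν n : Measure E) := by
        refine integral_mono ((hinteg n).sub (hinteg0 n)).abs ?_ hbound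
        exact (integrable_const _).add ((integrable_const _).indicator hAm)
    _ = ε / 2 + (ν n : Measure E).real A * (2 * C) := by
        rw [integral_add (integrable_const _) ((integrable_const _).indicator hAm),
          integral_indicator_const _ hAm]
        simp
    _ < ε := by
        have h5 : (ν n : Measure E).real A < η := by
          rw [measureReal_def]
          exact (ENNReal.lt_ofReal_iff_toReal_lt (measure_ne_top _ _)).1 hn1
        have h6 : η * (2 * C + 1) = ε / 2 := by rw [hη]; field_simp
        nlinarith [measureReal_nonneg (μ := (ν n : Measure E)) (s := A)]

theorem l1_of_tim {Ω : Type*} [MeasurableSpace Ω] (P : Measure Ω) [IsProbabilityMeasure P]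
    (X : ℕ → Ω → ℝ) (c : ℝ) (hX : ∀ n, Measurable (X n)) (hb : ∀ n ω, |X n ω - c| ≤ 1)
    (h : TendstoInMeasure P X atTop (fun _ => c)) :
    Tendsto (fun n => ∫ ω, |X n ω - c| ∂P) atTop (𝓝 0) := by
  rw [Metric.tendsto_nhds]
  intro ε hε
  have h1 := h (ENNReal.ofReal (ε / 2)) (by simpa using hε)
  have h2 : Tendsto (fun n => P.real {x | ENNReal.ofReal (ε / 2) ≤ edist (X n x) c})
      atTop (𝓝 0) := by
    have := (ENNReal.tendsto_toReal ENNReal.zero_ne_top).comp h1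
    simpa [Measure.real, Function.comp_def] using this
  filter_upwards [(tendsto_order.1 h2).2 (ε / 2) (half_pos hε)] with n hn
  rw [Real.dist_eq, sub_zero, abs_of_nonneg (integral_nonneg fun _ => abs_nonneg _)]
  set S := {x | ENNReal.ofReal (ε / 2) ≤ edist (X n x) c} with hS
  have hSm : MeasurableSet S := by
    refine measurableSet_le measurable_const ?_
    exact (hX n).edist measurable_const
  have hinteg : Integrable (fun ω => |X n ω - c|) P := by
    refine Integrable.of_bound (((hX n).sub measurable_const).abs).aestronglyMeasurable 1
      (Eventually.of_forall fun ω => ?_)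
    simpa using hb n ω
  calc ∫ ω, |X n ω - c| ∂P ≤ ∫ ω, (ε / 2 + S.indicator (fun _ => 1) ω) ∂P := by
        refine integral_mono hinteg ((integrable_const _).add
          ((integrable_const _).indicator hSm)) fun ω => ?_
        by_cases hω : ω ∈ S
        · simp only [Set.indicator_of_mem hω]
          have := hb n ω
          linarith
        · simp only [Set.indicator_of_notMem hω]
          simp only [hS, Set.mem_ofPred_eq, not_le, edist_dist] at hω
          have := (ENNReal.ofReal_lt_ofReal_iff (half_pos hε)).1 hω
          rw [Real.dist_eq] at this
          linarith
    _ = ε / 2 + P.real S := by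
        rw [integral_add (integrable_const _) ((integrable_const _).indicator hSm),
          integral_indicator_const _ hSm]
        simp
    _ < ε := by linarith

theorem abs_prod_sub_le {ι : Type*} (s : Finset ι) (a b : ι → ℝ)
    (ha : ∀ i, 0 ≤ a i ∧ a i ≤ 1) (hb : ∀ i, 0 ≤ b i ∧ b i ≤ 1) :
    |∏ i ∈ s, a i - ∏ i ∈ s, b i| ≤ ∑ i ∈ s, |a i - b i| := by
  classical
  induction s using Finset.induction_on with
  | empty => simp
  | insert i s hi ih =>
    rw [Finset.prod_insert hi, Finset.prod_insert hi, Finset.sum_insert hi]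
    have h1 : |∏ i ∈ s, a i| ≤ 1 := by
      rw [abs_of_nonneg (Finset.prod_nonneg fun i _ => (ha i).1)]
      exact Finset.prod_le_one (fun i _ => (ha i).1) fun i _ => (ha i).2
    have h2 : |b i| ≤ 1 := by rw [abs_of_nonneg (hb i).1]; exact (hb i).2
    calc |a i * ∏ i ∈ s, a i - b i * ∏ i ∈ s, b i|
        = |(a i - b i) * ∏ i ∈ s, a i + b i * (∏ i ∈ s, a i - ∏ i ∈ s, b i)| := by ring_nf
      _ ≤ |(a i - b i) * ∏ i ∈ s, a i| + |b i * (∏ i ∈ s, a i - ∏ i ∈ s, b i)| := abs_add_le _ _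
      _ ≤ |a i - b i| * 1 + 1 * |∏ i ∈ s, a i - ∏ i ∈ s, b i| := by
          rw [abs_mul, abs_mul]; gcongr
      _ ≤ _ := by linarith


/-- Annealed law of weights of uniformly chosen indices. -/
def nuM (M : SIRGModel d Ω) (ι : Type) [Fintype ι] [DecidableEq ι] (n : ℕ) : Measure (ι → ℝ) :=
  ((n : ℝ≥0∞) ^ Fintype.card ι)⁻¹ •
    ∑ v : ι → Fin n, M.P.map (fun ω a => M.Wt n (v a) ω)

theorem nuM_meas (M : SIRGModel d Ω) {ι : Type} [Fintype ι] {n : ℕ} (v : ι → Fin n) :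
    Measurable (fun ω a => M.Wt n (v a) ω) := measurable_pi_lambda _ fun a => M.Wt_meas n (v a)

theorem nuM_prob (M : SIRGModel d Ω) (ι : Type) [Fintype ι] [DecidableEq ι] (n : ℕ) (hn : n ≠ 0) :
    IsProbabilityMeasure (nuM M ι n) := by
  constructor
  have : ∀ v : ι → Fin n, (M.P.map (fun ω a => M.Wt n (v a) ω)) Set.univ = 1 := by
    intro v
    rw [Measure.map_apply (nuM_meas M v) MeasurableSet.univ]
    simp
  simp only [nuM, Measure.smul_apply, Measure.coe_finsetSum, Finset.sum_apply, this, smul_eq_mul]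
  simp only [Finset.sum_const, Finset.card_univ, Fintype.card_fun, Fintype.card_fin, nsmul_eq_mul,
    mul_one, Nat.cast_pow]
  exact ENNReal.inv_mul_cancel (by simp [hn]) (by simp)

theorem indic_of {p : Prop} (h : p) : indic p = 1 := by simp [indic, h]
theorem indic_not {p : Prop} (h : ¬ p) : indic p = 0 := by simp [indic, h]
theorem indic_nonneg (p : Prop) : 0 ≤ indic p := by
  by_cases h : p <;> simp [indic, h]
theorem indic_le_one (p : Prop) : indic p ≤ 1 := by
  by_cases h : p <;> simp [indic, h]
theorem indic_meas {α : Type*} [MeasurableSpace α] {p : α → Prop} (h : MeasurableSet {a | p a}) :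
    Measurable fun a => indic (p a) := by
  classical
  unfold indic
  exact Measurable.ite h measurable_const measurable_const
theorem indic_integral {α : Type*} [MeasurableSpace α] (P : Measure α) {p : α → Prop}
    (h : MeasurableSet {a | p a}) : ∫ a, indic (p a) ∂P = P.real {a | p a} := by
  have : (fun a => indic (p a)) = {a | p a}.indicator 1 := by
    funext a
    by_cases ha : p a <;> simp [indic, Set.indicator, ha]
  rw [this, integral_indicator_one h]
theorem indic_prod {ι : Type*} [Fintype ι] (p : ι → Prop) : ∏ a, indic (p a) = indic (∀ a, p a) := by
  by_cases h : ∀ a, p a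
  · simp [indic_of, h]
  · rw [indic_not h]
    push Not at h
    obtain ⟨a, ha⟩ := h
    exact Finset.prod_eq_zero (Finset.mem_univ a) (indic_not ha)

theorem nuM_rect (M : SIRGModel d Ω) (ι : Type) [Fintype ι] [DecidableEq ι] (n : ℕ)
    (s t : ι → ℝ) (hst : ∀ a, s a ≤ t a) :
    (nuM M ι n).real (Set.univ.pi fun a => Set.Ioc (s a) (t a)) =
      ∫ ω, ∏ a, ((∑ i : Fin n, indic (M.Wt n i ω ≤ t a)) / n
        - (∑ i : Fin n, indic (M.Wt n i ω ≤ s a)) / n) ∂M.P := by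
  have hm : MeasurableSet (Set.univ.pi fun a => Set.Ioc (s a) (t a)) :=
    MeasurableSet.univ_pi fun a => measurableSet_Ioc
  have hset : ∀ v : ι → Fin n, MeasurableSet {ω | ∀ a, M.Wt n (v a) ω ∈ Set.Ioc (s a) (t a)} := by
    intro v
    have := nuM_meas M v hm
    convert this using 1
    ext ω
    simp [Set.mem_pi]
  have h1 : (nuM M ι n).real (Set.univ.pi fun a => Set.Ioc (s a) (t a)) =
      ((n : ℝ) ^ Fintype.card ι)⁻¹ * ∑ v : ι → Fin n,
        M.P.real {ω | ∀ a, M.Wt n (v a) ω ∈ Set.Ioc (s a) (t a)} := by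
    simp only [nuM, measureReal_def, Measure.smul_apply, Measure.coe_finsetSum, Finset.sum_apply,
      smul_eq_mul, ENNReal.toReal_mul, ENNReal.toReal_inv, ENNReal.toReal_pow, ENNReal.toReal_natCast]
    congr 1
    rw [ENNReal.toReal_sum]
    · refine Finset.sum_congr rfl fun v _ => ?_
      rw [Measure.map_apply (nuM_meas M v) hm]
      congr 2
      ext ω
      simp [Set.mem_pi]
    · intro v _
      rw [Measure.map_apply (nuM_meas M v) hm]
      exact measure_ne_top _ _
  rw [h1]
  have h2 : ∀ ω a, (∑ i : Fin n, indic (M.Wt n i ω ≤ t a)) / n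
        - (∑ i : Fin n, indic (M.Wt n i ω ≤ s a)) / (n : ℝ) =
      (∑ i : Fin n, indic (M.Wt n i ω ∈ Set.Ioc (s a) (t a))) / n := by
    intro ω a
    rw [← sub_div, ← Finset.sum_sub_distrib]
    congr 1
    refine Finset.sum_congr rfl fun i _ => ?_
    have := hst a
    by_cases h3 : M.Wt n i ω ≤ s a
    · rw [indic_of h3, indic_of (h3.trans this), indic_not (fun h => absurd h.1 (not_lt.2 h3))]
      simp
    · rw [indic_not h3, sub_zero]
      congr 1
      simp only [Set.mem_Ioc, eq_iff_iff]
      exact ⟨fun h => ⟨not_le.1 h3, h⟩, fun h => h.2⟩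
  simp_rw [h2]
  have h3 : ∀ ω, ∏ a : ι, ((∑ i : Fin n, indic (M.Wt n i ω ∈ Set.Ioc (s a) (t a))) / (n : ℝ))
      = ((n : ℝ) ^ Fintype.card ι)⁻¹ * ∑ v : ι → Fin n,
        indic (∀ a, M.Wt n (v a) ω ∈ Set.Ioc (s a) (t a)) := by
    intro ω
    rw [Finset.prod_div_distrib, Finset.prod_univ_sum, Fintype.piFinset_univ]
    simp only [indic_prod, Finset.prod_const, Finset.card_univ]
    rw [div_eq_mul_inv, mul_comm]
  simp_rw [h3]
  rw [integral_const_mul, integral_finsetSum]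
  · congr 1
    refine Finset.sum_congr rfl fun v _ => ?_
    rw [indic_integral _ (hset v)]
  · intro v _
    refine Integrable.of_bound (indic_meas (hset v)).aestronglyMeasurable 1
      (Eventually.of_forall fun ω => ?_)
    rw [Real.norm_eq_abs, abs_of_nonneg (indic_nonneg _)]
    exact indic_le_one _

theorem emp_meas (M : SIRGModel d Ω) (n : ℕ) (x : ℝ) :
    Measurable fun ω => (∑ i : Fin n, indic (M.Wt n i ω ≤ x)) / (n : ℝ) := by
  refine Measurable.div_const ?_ _
  refine Finset.measurable_sum _ fun i _ => indic_meas ?_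
  exact measurableSet_le (M.Wt_meas n i) measurable_const

theorem emp_bd (M : SIRGModel d Ω) (n : ℕ) (x : ℝ) (ω : Ω) :
    0 ≤ (∑ i : Fin n, indic (M.Wt n i ω ≤ x)) / (n : ℝ) ∧
    (∑ i : Fin n, indic (M.Wt n i ω ≤ x)) / (n : ℝ) ≤ 1 := by
  constructor
  · exact div_nonneg (Finset.sum_nonneg fun i _ => indic_nonneg _) (by positivity)
  · refine div_le_one_of_le₀ ?_ (by positivity)
    calc _ ≤ ∑ i : Fin n, (1 : ℝ) := Finset.sum_le_sum fun i _ => indic_le_one _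
      _ = n := by simp

theorem emp_mono (M : SIRGModel d Ω) (n : ℕ) {x y : ℝ} (hxy : x ≤ y) (ω : Ω) :
    (∑ i : Fin n, indic (M.Wt n i ω ≤ x)) / (n : ℝ) ≤
    (∑ i : Fin n, indic (M.Wt n i ω ≤ y)) / (n : ℝ) := by
  refine div_le_div_of_nonneg_right (Finset.sum_le_sum fun i _ => ?_) (by positivity)
  by_cases h : M.Wt n i ω ≤ x
  · rw [indic_of h, indic_of (h.trans hxy)]
  · rw [indic_not h]; exact indic_nonneg _

theorem nuM_rect_tendsto (M : SIRGModel d Ω) (A : SIRGWeakAssumptions M) (ι : Type) [Fintype ι]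
    [DecidableEq ι] (s t : ι → ℝ) (hst : ∀ a, s a ≤ t a) (hs : ∀ a, A.μW {s a} = 0)
    (ht : ∀ a, A.μW {t a} = 0) :
    Tendsto (fun n => (nuM M ι n).real (Set.univ.pi fun a => Set.Ioc (s a) (t a))) atTop
      (𝓝 ((Measure.pi fun _ : ι => A.μW).real (Set.univ.pi fun a => Set.Ioc (s a) (t a)))) := by
  have := A.probμW
  simp_rw [nuM_rect M ι _ s t hst]
  set F : ℝ → ℝ := fun x => (A.μW (Set.Iic x)).toReal with hF
  set E : ℕ → ℝ → Ω → ℝ := fun n x ω => (∑ i : Fin n, indic (M.Wt n i ω ≤ x)) / (n : ℝ) with hE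
  have hFb : ∀ x, 0 ≤ F x ∧ F x ≤ 1 := fun x =>
    ⟨ENNReal.toReal_nonneg, measureReal_le_one⟩
  have hFm : ∀ {x y}, x ≤ y → F x ≤ F y := fun {x y} hxy =>
    measureReal_mono (Set.Iic_subset_Iic.2 hxy)
  have hlim : (Measure.pi fun _ : ι => A.μW).real (Set.univ.pi fun a => Set.Ioc (s a) (t a))
      = ∏ a, (F (t a) - F (s a)) := by
    rw [measureReal_def, Measure.pi_pi, ENNReal.toReal_prod]
    refine Finset.prod_congr rfl fun a _ => ?_
    have h1 : Set.Ioc (s a) (t a) = Set.Iic (t a) \ Set.Iic (s a) := by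
      ext x; simp [and_comm]
    rw [h1, measure_sdiff (Set.Iic_subset_Iic.2 (hst a)) measurableSet_Iic.nullMeasurableSet
      (measure_ne_top _ _), ENNReal.toReal_sub_of_le (measure_mono (Set.Iic_subset_Iic.2 (hst a)))
      (measure_ne_top _ _)]
  rw [hlim]
  have hL1 : ∀ x, A.μW {x} = 0 → Tendsto (fun n => ∫ ω, |E n x ω - F x| ∂M.P) atTop (𝓝 0) := by
    intro x hx
    refine l1_of_tim M.P (fun n => E n x) (F x) (fun n => emp_meas M n x) (fun n ω => ?_)
      (A.weights_conv x hx)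
    have h1 := emp_bd M n x ω
    have h2 := hFb x
    rw [abs_le]
    constructor <;> linarith
  have hi : ∀ n x, Integrable (fun ω => |E n x ω - F x|) M.P := by
    intro n x
    refine Integrable.of_bound (((emp_meas M n x).sub measurable_const).abs).aestronglyMeasurable 1
      (Eventually.of_forall fun ω => ?_)
    rw [norm_abs_eq_norm, Real.norm_eq_abs]
    have h1 := emp_bd M n x ω
    have h2 := hFb x
    rw [abs_le]
    constructor <;> linarith
  rw [tendsto_iff_norm_sub_tendsto_zero]
  have hsum : Tendsto (fun n => ∑ a, (∫ ω, |E n (t a) ω - F (t a)| ∂M.P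
      + ∫ ω, |E n (s a) ω - F (s a)| ∂M.P)) atTop (𝓝 0) := by
    have := tendsto_finsetSum (Finset.univ : Finset ι)
      (fun a _ => (hL1 (t a) (ht a)).add (hL1 (s a) (hs a)))
    simpa using this
  refine squeeze_zero (fun n => norm_nonneg _) (fun n => ?_) hsum
  have hDb : ∀ ω a, 0 ≤ E n (t a) ω - E n (s a) ω ∧ E n (t a) ω - E n (s a) ω ≤ 1 := by
    intro ω a
    have h1 := emp_bd M n (t a) ω
    have h2 := emp_bd M n (s a) ω
    have h3 := emp_mono M n (hst a) ω
    simp only [hE]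
    constructor <;> linarith
  have hFd : ∀ a, 0 ≤ F (t a) - F (s a) ∧ F (t a) - F (s a) ≤ 1 := by
    intro a
    have h1 := hFb (t a)
    have h2 := hFb (s a)
    have h3 := hFm (hst a)
    constructor <;> linarith
  have hpi : Integrable (fun ω => ∏ a, (E n (t a) ω - E n (s a) ω)) M.P := by
    refine Integrable.of_bound (C := 1) (Measurable.aestronglyMeasurable ?_)
      (Eventually.of_forall fun ω => ?_)
    · exact Finset.measurable_prod _ fun a _ => (emp_meas M n (t a)).sub (emp_meas M n (s a))
    · rw [Real.norm_eq_abs, abs_of_nonneg (Finset.prod_nonneg fun a _ => (hDb ω a).1)]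
      exact Finset.prod_le_one (fun a _ => (hDb ω a).1) fun a _ => (hDb ω a).2
  have hpi2 : Integrable (fun ω => ∏ a, (E n (t a) ω - E n (s a) ω) - ∏ a, (F (t a) - F (s a)))
      M.P := hpi.sub (integrable_const _)
  calc ‖∫ ω, ∏ a, (E n (t a) ω - E n (s a) ω) ∂M.P - ∏ a, (F (t a) - F (s a))‖
      = |∫ ω, (∏ a, (E n (t a) ω - E n (s a) ω) - ∏ a, (F (t a) - F (s a))) ∂M.P| := by
        rw [integral_sub hpi (integrable_const _)]
        simp
    _ ≤ ∫ ω, |∏ a, (E n (t a) ω - E n (s a) ω) - ∏ a, (F (t a) - F (s a))| ∂M.P :=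
        abs_integral_le_integral_abs
    _ ≤ ∫ ω, ∑ a, (|E n (t a) ω - F (t a)| + |E n (s a) ω - F (s a)|) ∂M.P := by
        refine integral_mono hpi2.abs
          (integrable_finsetSum _ fun a _ => (hi n (t a)).add (hi n (s a))) fun ω => ?_
        refine (abs_prod_sub_le _ _ _ (fun a => hDb ω a) hFd).trans ?_
        refine Finset.sum_le_sum fun a _ => ?_
        have : E n (t a) ω - E n (s a) ω - (F (t a) - F (s a)) =
          (E n (t a) ω - F (t a)) - (E n (s a) ω - F (s a)) := by ring
        rw [this]
        exact abs_sub _ _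
    _ = _ := by
        refine (integral_finsetSum _ fun a _ => (hi n (t a)).add (hi n (s a))).trans ?_
        refine Finset.sum_congr rfl fun a _ => ?_
        exact integral_add (hi n (t a)) (hi n (s a))

theorem dense_cont (μ : Measure ℝ) [IsProbabilityMeasure μ] {a b : ℝ} (hab : a < b) :
    ∃ x ∈ Set.Ioo a b, μ {x} = 0 := by
  have hc : {x : ℝ | 0 < μ {x}}.Countable := by
    have := Measure.countable_meas_level_set_pos (μ := μ) (g := (id : ℝ → ℝ)) measurable_id
    simpa using this
  obtain ⟨x, hx, hx2⟩ := (hc.dense_compl ℝ).exists_between hab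
  exact ⟨x, hx2, by simpa using hx⟩

open Classical in
/-- The annealed weight law as a probability measure. -/
def nuP (M : SIRGModel d Ω) (ι : Type) [Fintype ι] [DecidableEq ι] (n : ℕ) :
    ProbabilityMeasure (ι → ℝ) :=
  if hn : n ≠ 0 then ⟨nuM M ι n, nuM_prob M ι n hn⟩ else
    ⟨Measure.dirac 0, inferInstance⟩

theorem nuP_coe (M : SIRGModel d Ω) (ι : Type) [Fintype ι] [DecidableEq ι] (n : ℕ) (hn : n ≠ 0) :
    (nuP M ι n : Measure (ι → ℝ)) = nuM M ι n := by
  simp [nuP, hn]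

/-- limiting law -/
def muP {M : SIRGModel d Ω} (A : SIRGWeakAssumptions M) (ι : Type) [Fintype ι] :
    ProbabilityMeasure (ι → ℝ) :=
  ⟨Measure.pi fun _ : ι => A.μW, by have := A.probμW; infer_instance⟩

theorem nuP_tendsto (M : SIRGModel d Ω) (A : SIRGWeakAssumptions M) (ι : Type) [Fintype ι]
    [DecidableEq ι] : Tendsto (nuP M ι) atTop (𝓝 (muP A ι)) := by
  have := A.probμW
  let S : Set (Set (ι → ℝ)) := {u | ∃ s t : ι → ℝ, u = (Set.univ.pi fun a => Set.Ioc (s a) (t a)) ∧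
    (∀ a, s a ≤ t a) ∧ (∀ a, A.μW {s a} = 0) ∧ (∀ a, A.μW {t a} = 0)}
  have hS : IsPiSystem S := by
    rintro - ⟨s, t, rfl, hst, hs, ht⟩ - ⟨s', t', rfl, hst', hs', ht'⟩ ⟨x, hx⟩
    refine ⟨fun a => max (s a) (s' a), fun a => min (t a) (t' a), ?_, ?_, ?_, ?_⟩
    · rw [← Set.pi_inter_distrib]
      simp only [Set.Ioc_inter_Ioc]
    · intro a
      have h1 := hx.1 a (Set.mem_univ a)
      have h2 := hx.2 a (Set.mem_univ a)
      have h3 : max (s a) (s' a) < x a := max_lt h1.1 h2.1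
      have h4 : x a ≤ min (t a) (t' a) := le_min h1.2 h2.2
      exact (h3.trans_le h4).le
    · intro a
      rcases max_choice (s a) (s' a) with h | h <;> simp only [h, hs, hs']
    · intro a
      rcases min_choice (t a) (t' a) with h | h <;> simp only [h, ht, ht']
  apply hS.tendsto_probabilityMeasure_of_tendsto_of_mem
  · rintro - ⟨s, t, rfl, -⟩
    exact MeasurableSet.univ_pi fun a => measurableSet_Ioc
  · intro u hu x hx
    obtain ⟨ε, hε, hb⟩ := Metric.isOpen_iff.1 hu x hx
    have h1 : ∀ a, ∃ y ∈ Set.Ioo (x a - ε / 2) (x a), A.μW {y} = 0 := fun a =>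
      dense_cont _ (by linarith)
    have h2 : ∀ a, ∃ y ∈ Set.Ioo (x a) (x a + ε / 2), A.μW {y} = 0 := fun a =>
      dense_cont _ (by linarith)
    choose s hs hs0 using h1
    choose t ht ht0 using h2
    refine ⟨_, ⟨s, t, rfl, fun a => ((hs a).2.trans (ht a).1).le, hs0, ht0⟩, ?_, ?_⟩
    · exact set_pi_mem_nhds Set.finite_univ fun a _ => Ioc_mem_nhds (hs a).2 (ht a).1
    · intro y hy
      apply hb
      rw [Metric.mem_ball]
      refine (dist_pi_le_iff (half_pos hε).le).2 (fun a => ?_) |>.trans_lt (half_lt_self hε)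
      have h3 := hy a (Set.mem_univ a)
      have h4 := hs a
      have h5 := ht a
      rw [Real.dist_eq, abs_le]
      constructor <;> linarith [h3.1, h3.2, h4.1, h5.2]
  · rintro - ⟨s, t, rfl, hst, hs, ht⟩
    rw [← NNReal.tendsto_coe]
    refine (nuM_rect_tendsto M A ι s t hst hs ht).congr' ?_
    filter_upwards [eventually_ne_atTop 0] with n hn
    rw [← nuP_coe M ι n hn]
    rfl

theorem desc_ratio (K : ℕ) :
    Tendsto (fun n : ℕ => (n.descFactorial K : ℝ) / (n : ℝ) ^ K) atTop (𝓝 1) := by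
  induction K with
  | zero => simp
  | succ K ih =>
    have h1 : Tendsto (fun n : ℕ => ((n - K : ℕ) : ℝ) / n) atTop (𝓝 1) := by
      have h2 : Tendsto (fun n : ℕ => 1 - (K : ℝ) / n) atTop (𝓝 (1 - 0)) :=
        tendsto_const_nhds.sub (tendsto_const_div_atTop_nhds_zero_nat _)
      rw [sub_zero] at h2
      refine h2.congr' ?_
      filter_upwards [eventually_ge_atTop (K + 1)] with n hn
      have : (n : ℝ) ≠ 0 := by
        have : n ≠ 0 := by omega
        exact_mod_cast this
      rw [Nat.cast_sub (by omega)]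
      field_simp
    have := h1.mul ih
    rw [one_mul] at this
    refine this.congr fun n => ?_
    rw [Nat.descFactorial_succ, pow_succ, Nat.cast_mul, div_mul_div_comm, mul_comm (n : ℝ)]

open Classical in
theorem noninj_ratio (ι : Type) [Fintype ι] :
    Tendsto (fun n : ℕ => ((n : ℝ≥0∞) ^ Fintype.card ι)⁻¹ *
      (((Finset.univ : Finset (ι → Fin n)).filter fun v => ¬ Function.Injective v).card : ℝ≥0∞))
      atTop (𝓝 0) := by
  have h1 : Tendsto (fun n : ℕ => ENNReal.ofReal (1 - (n.descFactorial (Fintype.card ι) : ℝ) /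
      (n : ℝ) ^ (Fintype.card ι))) atTop (𝓝 0) := by
    have := ENNReal.tendsto_ofReal
      ((tendsto_const_nhds (x := (1 : ℝ))).sub (desc_ratio (Fintype.card ι)))
    simpa using this
  refine h1.congr' ?_
  filter_upwards [eventually_ne_atTop 0] with n hn
  have hc1 : ((Finset.univ : Finset (ι → Fin n)).filter fun v => Function.Injective v).card
      = n.descFactorial (Fintype.card ι) := by
    have h2 := Fintype.card_embedding_eq (α := ι) (β := Fin n)
    rw [Fintype.card_fin] at h2
    rw [← h2, ← Fintype.card_subtype]
    exact Fintype.card_congr (Equiv.subtypeInjectiveEquivEmbedding ι (Fin n))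
  have hc2 := Finset.card_filter_add_card_filter_not (s := (Finset.univ : Finset (ι → Fin n)))
    (fun v => Function.Injective v)
  rw [hc1, Finset.card_univ, Fintype.card_fun, Fintype.card_fin] at hc2
  set c := ((Finset.univ : Finset (ι → Fin n)).filter fun v => ¬ Function.Injective v).card
  have hn' : (0 : ℝ) < (n : ℝ) ^ (Fintype.card ι) := by positivity
  have h3 : (1 - (n.descFactorial (Fintype.card ι) : ℝ) / (n : ℝ) ^ (Fintype.card ι))
      = ((n : ℝ) ^ Fintype.card ι)⁻¹ * c := by
    have h4 : (n.descFactorial (Fintype.card ι) : ℝ) + c = (n : ℝ) ^ (Fintype.card ι) := by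
      exact_mod_cast hc2
    field_simp
    linarith
  rw [h3, ENNReal.ofReal_mul (by positivity), ENNReal.ofReal_inv_of_pos hn',
    ENNReal.ofReal_pow (by positivity), ENNReal.ofReal_natCast, ENNReal.ofReal_natCast]

open Classical in
theorem wsum_tendsto (M : SIRGModel d Ω) (A : SIRGWeakAssumptions M) (ι : Type) [Fintype ι]
    (G : ℕ → (ι → ℝ) → ℝ≥0∞) (G0 : (ι → ℝ) → ℝ≥0∞) (C : ℝ≥0)
    (hG : ∀ n, Measurable (G n)) (hC : ∀ n w, G n w ≤ C)
    (hconv : ∀ w (ws : ℕ → ι → ℝ), Tendsto ws atTop (𝓝 w) →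
      Tendsto (fun n => G n (ws n)) atTop (𝓝 (G0 w))) :
    Tendsto (fun n : ℕ => ((n : ℝ≥0∞) ^ Fintype.card ι)⁻¹ *
      ∑ v ∈ (Finset.univ : Finset (ι → Fin n)).filter (fun v => Function.Injective v),
        ∫⁻ ω, G n (fun a => M.Wt n (v a) ω) ∂M.P) atTop
      (𝓝 (∫⁻ w, G0 w ∂(Measure.pi fun _ : ι => A.μW))) := by
  have hpr := A.probμW
  have hC0 : ∀ w, G0 w ≤ C := fun w =>
    le_of_tendsto (hconv w (fun _ => w) tendsto_const_nhds) (Eventually.of_forall fun n => hC n w)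
  have hfin : ∀ n w, G n w ≠ ∞ := fun n w => ne_top_of_le_ne_top ENNReal.coe_ne_top (hC n w)
  have hfin0 : ∀ w, G0 w ≠ ∞ := fun w => ne_top_of_le_ne_top ENNReal.coe_ne_top (hC0 w)
  have hG0 : Measurable G0 := measurable_of_tendsto_metrizable hG (by
    rw [tendsto_pi_nhds]
    intro w
    exact hconv w (fun _ => w) tendsto_const_nhds)
  have key := ext_cmt (nuP M ι) (muP A ι) (nuP_tendsto M A ι) (fun n w => (G n w).toReal)
    (fun w => (G0 w).toReal) C (fun n => (hG n).ennreal_toReal)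
    (fun n w => by
      rw [abs_of_nonneg ENNReal.toReal_nonneg]
      exact ENNReal.toReal_mono ENNReal.coe_ne_top (hC n w))
    (fun w ws hw => (ENNReal.tendsto_toReal (hfin0 w)).comp (hconv w ws hw))
  have key2 := ENNReal.tendsto_ofReal key
  have e0 : ENNReal.ofReal (∫ w, (G0 w).toReal ∂(muP A ι : Measure (ι → ℝ)))
      = ∫⁻ w, G0 w ∂(Measure.pi fun _ : ι => A.μW) := by
    rw [integral_toReal hG0.aemeasurable (Eventually.of_forall fun w => (hfin0 w).lt_top),
      ENNReal.ofReal_toReal]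
    · rfl
    · refine ne_top_of_le_ne_top ?_ (lintegral_mono hC0)
      simp
  rw [e0] at key2
  have key3 : Tendsto (fun n => ∫⁻ w, G n w ∂(nuM M ι n)) atTop
      (𝓝 (∫⁻ w, G0 w ∂(Measure.pi fun _ : ι => A.μW))) := by
    refine key2.congr' ?_
    filter_upwards [eventually_ne_atTop 0] with n hn
    rw [integral_toReal (hG n).aemeasurable (Eventually.of_forall fun w => (hfin n w).lt_top),
      ENNReal.ofReal_toReal, nuP_coe M ι n hn]
    refine ne_top_of_le_ne_top ?_ (lintegral_mono (hC n))
    simp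
  have hfull : ∀ n, ∫⁻ w, G n w ∂(nuM M ι n) = ((n : ℝ≥0∞) ^ Fintype.card ι)⁻¹ *
      ∑ v : ι → Fin n, ∫⁻ ω, G n (fun a => M.Wt n (v a) ω) ∂M.P := by
    intro n
    rw [nuM, lintegral_smul_measure, lintegral_finsetSum_measure, smul_eq_mul]
    congr 1
    refine Finset.sum_congr rfl fun v _ => ?_
    rw [lintegral_map (hG n) (nuM_meas M v)]
  have hsplit : ∀ n : ℕ, ∑ v : ι → Fin n, ∫⁻ ω, G n (fun a => M.Wt n (v a) ω) ∂M.P =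
      ∑ v ∈ (Finset.univ : Finset (ι → Fin n)).filter (fun v => Function.Injective v),
        ∫⁻ ω, G n (fun a => M.Wt n (v a) ω) ∂M.P +
      ∑ v ∈ (Finset.univ : Finset (ι → Fin n)).filter (fun v => ¬ Function.Injective v),
        ∫⁻ ω, G n (fun a => M.Wt n (v a) ω) ∂M.P := fun n =>
    (Finset.sum_filter_add_sum_filter_not _ _ _).symm
  have hle : ∀ (n : ℕ) (v : ι → Fin n), ∫⁻ ω, G n (fun a => M.Wt n (v a) ω) ∂M.P ≤ C := by
    intro n v
    refine (lintegral_mono fun ω => hC n _).trans ?_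
    simp
  have hnon : Tendsto (fun n : ℕ => ((n : ℝ≥0∞) ^ Fintype.card ι)⁻¹ *
      ∑ v ∈ (Finset.univ : Finset (ι → Fin n)).filter (fun v => ¬ Function.Injective v),
        ∫⁻ ω, G n (fun a => M.Wt n (v a) ω) ∂M.P) atTop (𝓝 0) := by
    have h1 := ENNReal.Tendsto.mul_const (noninj_ratio ι) (b := (C : ℝ≥0∞))
      (Or.inr ENNReal.coe_ne_top)
    rw [zero_mul] at h1
    refine tendsto_of_tendsto_of_tendsto_of_le_of_le tendsto_const_nhds h1 (fun n => bot_le)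
      fun n => ?_
    dsimp only
    rw [mul_assoc]
    gcongr
    refine (Finset.sum_le_card_nsmul _ _ _ fun v _ => hle n v).trans ?_
    rw [nsmul_eq_mul]
  have hlimfin : ∫⁻ w, G0 w ∂(Measure.pi fun _ : ι => A.μW) ≠ ∞ := by
    refine ne_top_of_le_ne_top ?_ (lintegral_mono hC0)
    simp
  have hsub := ENNReal.Tendsto.sub key3 hnon (Or.inl hlimfin)
  rw [tsub_zero] at hsub
  refine hsub.congr' ?_
  filter_upwards [eventually_ne_atTop 0] with n hn
  rw [hfull, hsplit, mul_add, ENNReal.add_sub_cancel_right]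
  refine ENNReal.mul_ne_top (by simp [hn]) ?_
  exact ENNReal.sum_ne_top.2 fun v _ => ne_top_of_le_ne_top ENNReal.coe_ne_top (hle n v)

/-- ordered pairs of vertices -/
abbrev Prs (l : ℕ) : Type := {p : Fin (l + 1) × Fin (l + 1) // p.1 < p.2}

theorem meas_B {l : ℕ} (B : (Prs l → Prop) → Prop) {α : Type*} [MeasurableSpace α]
    (f g : Prs l → α → ℝ) (hf : ∀ p, Measurable (f p)) (hg : ∀ p, Measurable (g p)) :
    MeasurableSet {x | B (fun p => f p x ≤ g p x)} := by
  have h1 : Measurable (fun x => (fun p => f p x ≤ g p x : Prs l → Prop)) := by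
    refine measurable_pi_lambda _ fun p => ?_
    exact measurableSet_setOfPred.1 (measurableSet_le (hf p) (hg p))
  exact h1 (MeasurableSet.of_discrete (s := {s | B s}))

instance unif01_prob : IsProbabilityMeasure unif01 := ⟨by simp [unif01]⟩

def Qf {l : ℕ} (B : (Prs l → Prop) → Prop) (t : Prs l → ℝ) : ℝ≥0∞ :=
  (Measure.pi fun _ : Prs l => unif01) {u | B (fun p => u p ≤ t p)}

theorem Qf_le {l : ℕ} (B : (Prs l → Prop) → Prop) (t : Prs l → ℝ) : Qf B t ≤ 1 := prob_le_one

theorem Qf_meas {l : ℕ} (B : (Prs l → Prop) → Prop) : Measurable (Qf B) := by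
  have h := meas_B B (α := (Prs l → ℝ) × (Prs l → ℝ)) (fun p x => x.2 p) (fun p x => x.1 p)
    (fun p => by fun_prop) (fun p => by fun_prop)
  exact measurable_measure_prodMk_left h

theorem Qf_tendsto {l : ℕ} (B : (Prs l → Prop) → Prop) (t : Prs l → ℝ) (ts : ℕ → Prs l → ℝ)
    (h : Tendsto ts atTop (𝓝 t)) : Tendsto (fun n => Qf B (ts n)) atTop (𝓝 (Qf B t)) := by
  have e : ∀ t, Qf B t = ∫⁻ u, {u : Prs l → ℝ | B (fun p => u p ≤ t p)}.indicator 1 u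
      ∂(Measure.pi fun _ : Prs l => unif01) := by
    intro t
    rw [lintegral_indicator_one, Qf]
    exact meas_B B (fun p (x : Prs l → ℝ) => x p) (fun p x => t p) (fun p => by fun_prop) (fun p => by fun_prop)
  simp only [e]
  refine tendsto_lintegral_of_dominated_convergence (fun _ => 1) (fun n => ?_) (fun n => ?_)
    (by simp) ?_
  · exact measurable_one.indicator (meas_B B (fun p (x : Prs l → ℝ) => x p) (fun p x => ts n p)
      (fun p => by fun_prop) (fun p => by fun_prop))
  · exact Eventually.of_forall fun u => Set.indicator_le_self' (by simp) u
  · have hne : ∀ᵐ u ∂(Measure.pi fun _ : Prs l => unif01), ∀ p, u p ≠ t p := by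
      rw [ae_all_iff]
      intro p
      have h1 : ∀ᵐ x ∂unif01, x ≠ t p := by
        have : NullSingletonClass unif01 := by unfold unif01; infer_instance
        exact Measure.ae_ne unif01 (t p)
      exact (Measure.quasiMeasurePreserving_eval (fun _ : Prs l => unif01) p).ae h1
    filter_upwards [hne] with u hu
    refine tendsto_const_nhds.congr' ?_
    have : ∀ᶠ n in atTop, ∀ p, (u p ≤ ts n p ↔ u p ≤ t p) := by
      rw [eventually_all]
      intro p
      have hp := (tendsto_pi_nhds.1 h) p
      rcases lt_or_gt_of_ne (hu p) with h1 | h1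
      · filter_upwards [hp.eventually (lt_mem_nhds h1)] with n hn
        exact ⟨fun _ => h1.le, fun _ => hn.le⟩
      · filter_upwards [hp.eventually (gt_mem_nhds h1)] with n hn
        exact ⟨fun h => absurd h (not_le.2 hn), fun h => absurd h (not_le.2 h1)⟩
    filter_upwards [this] with n hn
    have : (fun p => u p ≤ ts n p) = (fun p => u p ≤ t p) := by
      funext p; exact propext (hn p)
    have h2 : B (fun p => u p ≤ ts n p) ↔ B (fun p => u p ≤ t p) := by rw [this]
    by_cases h3 : B (fun p => u p ≤ t p)
    · rw [Set.indicator_of_mem (by exact h3), Set.indicator_of_mem (by exact h2.2 h3)]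
    · rw [Set.indicator_of_notMem (by exact h3),
        Set.indicator_of_notMem (by exact fun h => h3 (h2.1 h))]

theorem meas_and {α : Type*} [MeasurableSpace α] {p q : α → Prop} (hp : MeasurableSet {a | p a})
    (hq : MeasurableSet {a | q a}) : MeasurableSet {a | p a ∧ q a} := hp.inter hq

theorem meas_all {α ι : Type*} [Countable ι] [MeasurableSpace α] {p : ι → α → Prop}
    (hp : ∀ i, MeasurableSet {a | p i a}) : MeasurableSet {a | ∀ i, p i a} := by
  rw [Set.ofPred_forall]; exact MeasurableSet.iInter hp

theorem meas_imp {α : Type*} [MeasurableSpace α] {q : Prop} {p : α → Prop}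
    (hp : MeasurableSet {a | p a}) : MeasurableSet {a | q → p a} := by
  by_cases h : q <;> simp [h, hp]

theorem upart {l m : ℕ} (B : (Prs l → Prop) → Prop) {J : Type*} [Fintype J]
    (σ : Fin m × Prs l → J) (hσ : Function.Injective σ) (t : Fin m → Prs l → ℝ) :
    (Measure.pi fun _ : J => unif01) {u | ∀ c, B (fun p => u (σ (c, p)) ≤ t c p)}
      = ∏ c, Qf B (t c) := by
  have hm : ∀ c, MeasurableSet {u : Prs l → ℝ | B (fun p => u p ≤ t c p)} := fun c =>
    meas_B B (fun p (x : Prs l → ℝ) => x p) (fun p x => t c p) (fun p => by fun_prop)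
      (fun p => by fun_prop)
  have hm2 : MeasurableSet {u : Fin m × Prs l → ℝ | ∀ c, B (fun p => u (c, p) ≤ t c p)} := by
    rw [Set.ofPred_forall]
    exact MeasurableSet.iInter fun c => meas_B B (fun p (x : Fin m × Prs l → ℝ) => x (c, p))
      (fun p x => t c p) (fun p => by fun_prop) (fun p => by fun_prop)
  have h1 := (mp_reindex unif01 σ hσ).measure_preimage hm2.nullMeasurableSet
  have h2 := (mp_curry (A := Fin m) (B := Prs l) unif01).measure_preimage hm2.nullMeasurableSet
  have h3 : (fun y : Fin m → Prs l → ℝ => fun p : Fin m × Prs l => y p.1 p.2) ⁻¹'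
      {u : Fin m × Prs l → ℝ | ∀ c, B (fun p => u (c, p) ≤ t c p)}
      = Set.univ.pi fun c => {u : Prs l → ℝ | B (fun p => u p ≤ t c p)} := by
    ext u; simp
  rw [h3, Measure.pi_pi] at h2
  exact h1.trans h2.symm

def tt {l : ℕ} (κ : ℝ → ℝ → ℝ → ℝ) (y : Fin (l + 1) → Euc d) (w : Fin (l + 1) → ℝ) : Prs l → ℝ :=
  fun p => κ (dist (y p.1.1) (y p.1.2)) (w p.1.1) (w p.1.2)

theorem tt_meas {l : ℕ} {κ : ℝ → ℝ → ℝ → ℝ}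
    (hκ : Measurable fun p : ℝ × ℝ × ℝ => κ p.1 p.2.1 p.2.2) {α : Type*} [MeasurableSpace α]
    {y : α → Fin (l + 1) → Euc d} {w : α → Fin (l + 1) → ℝ} (hy : Measurable y) (hw : Measurable w) :
    Measurable fun a => tt κ (y a) (w a) := by
  refine measurable_pi_lambda _ fun p => ?_
  have : Measurable fun a => (dist (y a p.1.1) (y a p.1.2), w a p.1.1, w a p.1.2) := by fun_prop
  exact hκ.comp this

def EvA (M : SIRGModel d Ω) (n : ℕ) (r : ℝ) {l : ℕ} (B : (Prs l → Prop) → Prop)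
    (v : Fin (l + 1) → Fin n) (ω : Ω) : Prop :=
  (∀ k : Fin l, dist (M.Y n (v k.succ) ω) (M.Y n (v 0) ω) < r) ∧
  (∀ j, j ∉ Set.range v → r ≤ dist (M.Y n j ω) (M.Y n (v 0) ω)) ∧
  B (fun p => M.U n (min (v p.1.1) (v p.1.2)) (max (v p.1.1) (v p.1.2)) ω ≤
    tt (M.κn n) (fun k => M.Y n (v k) ω) (fun k => M.Wt n (v k) ω) p)

theorem EvA_meas (M : SIRGModel d Ω) (n : ℕ) (r : ℝ) {l : ℕ} (B : (Prs l → Prop) → Prop)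
    (v : Fin (l + 1) → Fin n) : MeasurableSet {ω | EvA M n r B v ω} := by
  have hY := M.Y_meas n
  have hW := M.Wt_meas n
  have hU := M.U_meas n
  unfold EvA
  refine meas_and ?_ (meas_and ?_ ?_)
  · exact meas_all fun k => measurableSet_lt (by fun_prop) (by fun_prop)
  · exact meas_all fun k => meas_imp <| measurableSet_le (by fun_prop) (by fun_prop)
  · refine meas_B B (fun p ω => M.U n (min (v p.1.1) (v p.1.2)) (max (v p.1.1) (v p.1.2)) ω)
      (fun p ω => tt (M.κn n) (fun k => M.Y n (v k) ω) (fun k => M.Wt n (v k) ω) p)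
      (fun p => hU _ _) (fun p => ?_)
    have h1 : Measurable (fun ω => tt (M.κn n) (fun k => M.Y n (v k) ω) (fun k => M.Wt n (v k) ω)) :=
      tt_meas (M.κn_meas n) (measurable_pi_lambda _ fun k => hY _)
        (measurable_pi_lambda _ fun k => hW _)
    exact measurable_pi_iff.1 h1 p

/-- geometric condition for `m` clusters -/
def D1 {m l : ℕ} (r : ℝ) (y : Fin m × Fin (l + 1) → Euc d) : Prop :=
  (∀ c (k : Fin l), dist (y (c, k.succ)) (y (c, 0)) < r) ∧
  (∀ c c' k, c ≠ c' → r ≤ dist (y (c', k)) (y (c, 0)))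

theorem D1_meas {m l : ℕ} (r : ℝ) : MeasurableSet {y : Fin m × Fin (l + 1) → Euc d | D1 r y} := by
  unfold D1
  refine meas_and ?_ ?_
  · exact meas_all fun c => meas_all fun k => measurableSet_lt (by fun_prop) (by fun_prop)
  · exact meas_all fun c => meas_all fun c' => meas_all fun k => meas_imp <|
      measurableSet_le (by fun_prop) (by fun_prop)

def Fm (d : ℕ) {m l : ℕ} (κ : ℝ → ℝ → ℝ → ℝ) (n : ℕ) (r : ℝ) (B : (Prs l → Prop) → Prop)
    (w : Fin m × Fin (l + 1) → ℝ) : ℝ≥0∞ :=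
  ∫⁻ y : Fin m × Fin (l + 1) → Euc d,
    {y : Fin m × Fin (l + 1) → Euc d | D1 r y}.indicator 1 y *
      (∏ c, Qf B (tt κ (fun k => y (c, k)) (fun k => w (c, k)))) *
      unifBox d n {x | ∀ c : Fin m, r ≤ dist x (y (c, 0))} ^ (n - m * (l + 1))
    ∂(Measure.pi fun _ => unifBox d n)


theorem vol_box (hd : 1 ≤ d) (n : ℕ) : volume (boxIn d n) = n := by
  have h1 : boxIn d n = (WithLp.ofLp) ⁻¹' (Set.univ.pi fun _ : Fin d =>
      Set.Icc (-((n : ℝ) ^ ((1 : ℝ) / d) / 2)) ((n : ℝ) ^ ((1 : ℝ) / d) / 2)) := by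
    ext x
    simp [boxIn, abs_le, forall_and, Pi.le_def]
  rw [h1, (PiLp.volume_preserving_ofLp (Fin d)).measure_preimage
    (MeasurableSet.univ_pi fun _ => measurableSet_Icc).nullMeasurableSet]
  rw [volume_pi, Measure.pi_pi]
  simp only [Real.volume_Icc, Finset.prod_const, Finset.card_univ, Fintype.card_fin]
  rw [← ENNReal.ofReal_pow (by ring_nf; positivity)]
  have : ((n : ℝ) ^ ((1 : ℝ) / d) / 2 - -((n : ℝ) ^ ((1 : ℝ) / d) / 2)) ^ d = n := by
    have h2 : ((n : ℝ) ^ ((1 : ℝ) / d) / 2 - -((n : ℝ) ^ ((1 : ℝ) / d) / 2))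
      = (n : ℝ) ^ ((1 : ℝ) / d) := by ring
    rw [h2, ← Real.rpow_natCast, ← Real.rpow_mul (by positivity)]
    have : (d : ℝ) ≠ 0 := by
      have : d ≠ 0 := by omega
      exact_mod_cast this
    field_simp
    simp
  rw [this, ENNReal.ofReal_natCast]

theorem box_closed (d n : ℕ) : IsClosed (boxIn d n) := by
  have : boxIn d n = ⋂ i, {x : Euc d | |x i| ≤ ((n : ℝ) ^ ((1 : ℝ) / d)) / 2} := by
    ext x; simp [boxIn]
  rw [this]
  refine isClosed_iInter fun i => isClosed_le (by fun_prop) continuous_const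

theorem box_meas (d n : ℕ) : MeasurableSet (boxIn d n) := (box_closed d n).measurableSet

theorem unifBox_prob (hd : 1 ≤ d) {n : ℕ} (hn : n ≠ 0) : IsProbabilityMeasure (unifBox d n) := by
  constructor
  simp only [unifBox, Measure.smul_apply, Measure.restrict_apply_univ, vol_box hd, smul_eq_mul]
  exact ENNReal.inv_mul_cancel (by simpa using hn) (by simp)

/-- sorted pair map -/
def sg {m l n : ℕ} (v : Fin m × Fin (l + 1) → Fin n) (hv : Function.Injective v)
    (a : Fin m × Prs l) : {p : Fin n × Fin n // p.1 < p.2} :=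
  ⟨(min (v (a.1, a.2.1.1)) (v (a.1, a.2.1.2)), max (v (a.1, a.2.1.1)) (v (a.1, a.2.1.2))), by
    have h : v (a.1, a.2.1.1) ≠ v (a.1, a.2.1.2) := fun h => by
      have := hv h
      simp only [Prod.mk.injEq, true_and] at this
      exact (ne_of_lt a.2.2) this
    exact min_lt_max.2 h⟩

theorem sg_inj {m l n : ℕ} (v : Fin m × Fin (l + 1) → Fin n) (hv : Function.Injective v) :
    Function.Injective (sg v hv) := by
  rintro ⟨c, ⟨⟨i, j⟩, hij⟩⟩ ⟨c', ⟨⟨i', j'⟩, hij'⟩⟩ h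
  simp only [sg, Subtype.mk.injEq, Prod.mk.injEq] at h
  obtain ⟨h1, h2⟩ := h
  dsimp only at hij hij'
  have key : (v (c, i) = v (c', i') ∧ v (c, j) = v (c', j')) ∨
      (v (c, i) = v (c', j') ∧ v (c, j) = v (c', i')) := by
    rcases le_total (v (c, i)) (v (c, j)) with h3 | h3 <;>
    rcases le_total (v (c', i')) (v (c', j')) with h4 | h4 <;>
    simp only [min_eq_left h3, min_eq_right h3, max_eq_left h3, max_eq_right h3,
      min_eq_left h4, min_eq_right h4, max_eq_left h4, max_eq_right h4] at h1 h2 <;> tauto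
  rcases key with ⟨h3, h4⟩ | ⟨h3, h4⟩
  · have h3 := hv h3
    have h4 := hv h4
    simp only [Prod.mk.injEq] at h3 h4
    obtain ⟨rfl, rfl⟩ := h3
    obtain ⟨-, rfl⟩ := h4
    rfl
  · have h3 := hv h3
    have h4 := hv h4
    simp only [Prod.mk.injEq] at h3 h4
    obtain ⟨rfl, rfl⟩ := h3
    obtain ⟨-, rfl⟩ := h4
    exact absurd hij (not_lt.2 hij'.le)

theorem D1_split {m l n : ℕ} (r : ℝ) (v : Fin m × Fin (l + 1) → Fin n) (hv : Function.Injective v)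
    (y : Fin n → Euc d) :
    ((∀ c, (∀ k : Fin l, dist (y (v (c, k.succ))) (y (v (c, 0))) < r) ∧
      (∀ j, j ∉ Set.range (fun k => v (c, k)) → r ≤ dist (y j) (y (v (c, 0)))))) ↔
    (D1 r (fun a => y (v a)) ∧
      ∀ j : {j // j ∉ Set.range v}, ∀ c, r ≤ dist (y j) (y (v (c, 0)))) := by
  constructor
  · intro h
    refine ⟨⟨fun c => (h c).1, fun c c' k hcc => (h c).2 _ ?_⟩, fun j c => (h c).2 _ ?_⟩
    · rintro ⟨k', hk'⟩
      have := hv hk'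
      simp only [Prod.mk.injEq] at this
      exact hcc this.1
    · rintro ⟨k', hk'⟩
      exact j.2 ⟨_, hk'⟩
  · rintro ⟨⟨h1, h2⟩, h3⟩ c
    refine ⟨h1 c, fun j hj => ?_⟩
    by_cases hj' : j ∈ Set.range v
    · obtain ⟨⟨c', k⟩, rfl⟩ := hj'
      refine h2 c c' k fun hcc => hj ?_
      exact ⟨k, by simp [hcc]⟩
    · exact h3 ⟨j, hj'⟩ c

theorem Fint_meas {m l : ℕ} {κ : ℝ → ℝ → ℝ → ℝ}
    (hκ : Measurable fun p : ℝ × ℝ × ℝ => κ p.1 p.2.1 p.2.2) (r : ℝ) (B : (Prs l → Prop) → Prop)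
    {α : Type*} [MeasurableSpace α] {y : α → Fin m × Fin (l + 1) → Euc d}
    {w : α → Fin m × Fin (l + 1) → ℝ} (hy : Measurable y) (hw : Measurable w) :
    Measurable fun a => {y : Fin m × Fin (l + 1) → Euc d | D1 r y}.indicator (1 : (Fin m × Fin (l + 1) → Euc d) → ℝ≥0∞) (y a) *
      (∏ c, Qf B (tt κ (fun k => y a (c, k)) (fun k => w a (c, k)))) := by
  refine ((measurable_one.indicator (D1_meas r)).comp hy).mul ?_
  refine Finset.measurable_prod _ fun c _ => (Qf_meas B).comp (tt_meas hκ ?_ ?_) <;> fun_prop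

theorem meas_far {m l : ℕ} (r : ℝ) : MeasurableSet {x : (Fin m × Fin (l + 1) → Euc d) × Euc d |
      ∀ c : Fin m, r ≤ dist x.2 (x.1 (c, 0))} :=
  meas_all fun c => measurableSet_le (by fun_prop) (by fun_prop)

theorem Fm_meas (hd : 1 ≤ d) {m l : ℕ} {κ : ℝ → ℝ → ℝ → ℝ}
    (hκ : Measurable fun p : ℝ × ℝ × ℝ => κ p.1 p.2.1 p.2.2) {n : ℕ} (hn : n ≠ 0) (r : ℝ)
    (B : (Prs l → Prop) → Prop) :
    Measurable (fun w : Fin m × Fin (l + 1) → ℝ => Fm d κ n r B w) := by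
  have hub := unifBox_prob hd hn
  unfold Fm
  refine Measurable.lintegral_prod_right' (f := fun q : (Fin m × Fin (l + 1) → ℝ) ×
    (Fin m × Fin (l + 1) → Euc d) =>
     {y : Fin m × Fin (l + 1) → Euc d | D1 r y}.indicator 1 q.2 *
      (∏ c, Qf B (tt κ (fun k => q.2 (c, k)) (fun k => q.1 (c, k)))) *
      unifBox d n {x | ∀ c : Fin m, r ≤ dist x (q.2 (c, 0))} ^ (n - m * (l + 1))) ?_
  refine (Fint_meas hκ r B measurable_snd measurable_fst).mul ?_
  exact ((measurable_measure_prodMk_left (meas_far r)).comp measurable_snd).pow_const _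

def Dset {m l n : ℕ} (r : ℝ) (v : Fin m × Fin (l + 1) → Fin n) : Set (Fin n → Euc d) :=
  {y | D1 r (fun a => y (v a)) ∧
      ∀ j : {j // j ∉ Set.range v}, ∀ c, r ≤ dist (y j) (y (v (c, 0)))}

open Classical in
theorem ypart (hd : 1 ≤ d) {m l n : ℕ} {κ : ℝ → ℝ → ℝ → ℝ}
    (hκ : Measurable fun p : ℝ × ℝ × ℝ => κ p.1 p.2.1 p.2.2) (hn : n ≠ 0) (r : ℝ)
    (B : (Prs l → Prop) → Prop) (v : Fin m × Fin (l + 1) → Fin n) (hv : Function.Injective v)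
    (w : Fin n → ℝ) :
    ∫⁻ y : Fin n → Euc d, (Dset r v).indicator 1 y *
      ∏ c, Qf B (tt κ (fun k => y (v (c, k))) (fun k => w (v (c, k))))
      ∂(Measure.pi fun _ => unifBox d n) = Fm d κ n r B (fun a => w (v a)) := by
  have hub := unifBox_prob hd hn
  let Φ : (Fin m × Fin (l + 1) → Euc d) → ℝ≥0∞ := fun y =>
    {y : Fin m × Fin (l + 1) → Euc d | D1 r y}.indicator 1 y *
      (∏ c, Qf B (tt κ (fun k => y (c, k)) (fun k => w (v (c, k)))))
  have hΦ : Measurable Φ := by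
    exact Fint_meas hκ r B (y := fun y => y) (w := fun _ a => w (v a)) measurable_id measurable_const
  let Bs : Set ((Fin m × Fin (l + 1) → Euc d) × Euc d) := {x | ∀ c : Fin m, r ≤ dist x.2 (x.1 (c, 0))}
  have hBs : MeasurableSet Bs := meas_far r
  have h := lint_split (unifBox d n) v hv Φ hΦ Bs hBs
  have hcard : Fintype.card (Fin n) - Fintype.card (Fin m × Fin (l + 1)) = n - m * (l + 1) := by simp
  rw [hcard] at h
  refine Eq.trans ?_ h
  refine lintegral_congr fun y => ?_
  simp only [Φ]
  rw [mul_right_comm]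
  congr 1
  by_cases h1 : D1 r (fun a => y (v a))
  · rw [Set.indicator_of_mem (show (fun a => y (v a)) ∈ {y | D1 r y} from h1), Pi.one_apply, one_mul]
    by_cases h2 : ∀ j : {j // j ∉ Set.range v}, ∀ c, r ≤ dist (y j) (y (v (c, 0)))
    · rw [Set.indicator_of_mem (show y ∈ Dset r v from ⟨h1, h2⟩)]
      symm
      refine Finset.prod_eq_one fun j _ => ?_
      rw [Set.indicator_of_mem]
      · rfl
      · exact h2 j
    · rw [Set.indicator_of_notMem (show y ∉ Dset r v from fun h => h2 h.2)]
      push Not at h2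
      obtain ⟨j, c, hj⟩ := h2
      symm
      refine Finset.prod_eq_zero (@Finset.mem_univ _ (_) j) ?_
      rw [Set.indicator_of_notMem]
      exact fun h => absurd (h c) (not_le.2 hj)
  · rw [Set.indicator_of_notMem (show (fun a => y (v a)) ∉ {y | D1 r y} from h1), zero_mul,
      Set.indicator_of_notMem (show y ∉ Dset r v from fun h => h1 h.1)]

theorem moment (hd : 1 ≤ d) (M : SIRGModel d Ω) {n m l : ℕ} (hn : n ≠ 0) (r : ℝ)
    (B : (Prs l → Prop) → Prop) (v : Fin m × Fin (l + 1) → Fin n) (hv : Function.Injective v) :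
    M.P {ω | ∀ c, EvA M n r B (fun k => v (c, k)) ω} =
      ∫⁻ ω, Fm d (M.κn n) n r B (fun a => M.Wt n (v a) ω) ∂M.P := by
  classical
  have hub := unifBox_prob hd hn
  let X : Ω → (Fin n → Euc d) × (Fin n → ℝ) × ({p : Fin n × Fin n // p.1 < p.2} → ℝ) := fun ω =>
        ((fun i => M.Y n i ω), (fun i => M.Wt n i ω),
          (fun p : {p : Fin n × Fin n // p.1 < p.2} => M.U n p.1.1 p.1.2 ω))
  have hX : Measurable X := by
    have hY := M.Y_meas n
    have hW := M.Wt_meas n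
    have hU := M.U_meas n
    exact (measurable_pi_lambda _ hY).prodMk ((measurable_pi_lambda _ hW).prodMk
      (measurable_pi_lambda _ fun p => hU _ _))
  let Wm := fun ω i => M.Wt n i ω
  have hWm : Measurable Wm := measurable_pi_lambda _ (M.Wt_meas n)
  have hWp : IsProbabilityMeasure (M.P.map Wm) := Measure.isProbabilityMeasure_map hWm.aemeasurable
  let D : Set (Fin n → Euc d) := Dset r v
  have hD : MeasurableSet D := by
    refine meas_and ?_ ?_
    · have : Measurable (fun (y : Fin n → Euc d) a => y (v a)) := by fun_prop
      exact this (D1_meas r)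
    · exact meas_all fun j => meas_all fun c => measurableSet_le (by fun_prop) (by fun_prop)
  let S : Set ((Fin n → Euc d) × (Fin n → ℝ) × ({p : Fin n × Fin n // p.1 < p.2} → ℝ)) :=
    {x | x.1 ∈ D ∧ ∀ c, B (fun p => x.2.2 (sg v hv (c, p)) ≤
      tt (M.κn n) (fun k => x.1 (v (c, k))) (fun k => x.2.1 (v (c, k))) p)}
  have hS : MeasurableSet S := by
    refine meas_and (measurable_fst hD) (meas_all fun c => ?_)
    refine meas_B B (fun p (x : (Fin n → Euc d) × (Fin n → ℝ) × ({p : Fin n × Fin n // p.1 < p.2} → ℝ))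
       => x.2.2 (sg v hv (c, p))) (fun p x =>
      tt (M.κn n) (fun k => x.1 (v (c, k))) (fun k => x.2.1 (v (c, k))) p) (fun p => by fun_prop) ?_
    refine measurable_pi_iff.1 (tt_meas (M.κn_meas n) ?_ ?_) <;> fun_prop
  have e1 : {ω | ∀ c, EvA M n r B (fun k => v (c, k)) ω} = X ⁻¹' S := by
    ext ω
    have hs := D1_split r v hv (fun i => M.Y n i ω)
    simp only [Set.mem_ofPred_eq, Set.mem_preimage, S, D, Dset, ← hs, EvA, X, sg]
    constructor
    · intro h; exact ⟨fun c => ⟨(h c).1, (h c).2.1⟩, fun c => (h c).2.2⟩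
    · intro h c; exact ⟨(h.1 c).1, (h.1 c).2, h.2 c⟩
  rw [e1, ← Measure.map_apply hX hS, M.joint_law n, Measure.prod_apply hS]
  have e2 : ∀ y : Fin n → Euc d, ((M.P.map Wm).prod
      (Measure.pi fun _ : {p : Fin n × Fin n // p.1 < p.2} => unif01)) (Prod.mk y ⁻¹' S)
      = ∫⁻ w, D.indicator 1 y * ∏ c, Qf B (tt (M.κn n) (fun k => y (v (c, k))) (fun k => w (v (c, k))))
        ∂(M.P.map Wm) := by
    intro y
    rw [Measure.prod_apply (measurable_prodMk_left hS)]
    refine lintegral_congr fun w => ?_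
    by_cases hy : y ∈ D
    · rw [Set.indicator_of_mem hy, Pi.one_apply, one_mul, ← upart B (sg v hv) (sg_inj v hv)]
      congr 1
      ext u
      simp [S, hy]
    · rw [Set.indicator_of_notMem hy, zero_mul]
      convert measure_empty (μ := Measure.pi fun _ : {p : Fin n × Fin n // p.1 < p.2} => unif01)
      ext u
      simp [S, hy]
  rw [lintegral_congr e2, lintegral_lintegral_swap]
  swap
  · refine Measurable.aemeasurable ?_
    refine ((measurable_one.indicator hD).comp measurable_fst).mul ?_
    refine Finset.measurable_prod _ fun c _ => (Qf_meas B).comp (tt_meas (M.κn_meas n) ?_ ?_) <;>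
      fun_prop
  have e3 : ∀ w : Fin n → ℝ, ∫⁻ y : Fin n → Euc d, D.indicator 1 y *
      ∏ c, Qf B (tt (M.κn n) (fun k => y (v (c, k))) (fun k => w (v (c, k))))
      ∂(Measure.pi fun _ => unifBox d n) = Fm d (M.κn n) n r B (fun a => w (v a)) :=
    fun w => ypart hd (M.κn_meas n) hn r B v hv w
  rw [lintegral_congr e3, lintegral_map _ hWm]
  have hr : Measurable (fun (w : Fin n → ℝ) (a : Fin m × Fin (l + 1)) => w (v a)) := by fun_prop
  have hF : Measurable (fun w : Fin m × Fin (l + 1) → ℝ => Fm d (M.κn n) n r B w) :=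
    Fm_meas hd (M.κn_meas n) hn r B
  have h3 := Measurable.comp hF hr
  simp only [Function.comp_def] at h3
  exact h3

theorem ae_norm (hd : 1 ≤ d) {q : ℝ → Prop} (hq : ∀ᵐ t ∂(volume : Measure ℝ), q t) :
    ∀ᵐ x : Euc d, q ‖x‖ := by
  have : Nonempty (Fin d) := ⟨⟨0, by omega⟩⟩
  have hnt : Nontrivial (Euc d) := by infer_instance
  set N : Set ℝ := toMeasurable volume {t | ¬ q t} with hN
  have hN0 : volume N = 0 := by rw [hN, measure_toMeasurable]; exact hq
  have hNm : MeasurableSet N := measurableSet_toMeasurable _ _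
  set f : ℝ → ℝ := N.indicator 1 with hf
  have hf0 : f =ᵐ[volume] 0 := indicator_meas_zero hN0
  have hz : (fun y : ℝ => y ^ (Module.finrank ℝ (Euc d) - 1) • f y) =ᵐ[volume.restrict (Set.Ioi 0)] 0 := by
    filter_upwards [ae_restrict_of_ae hf0] with y hy
    simp [hy]
  have h1 : Integrable (fun x : Euc d => f ‖x‖) volume := by
    rw [integrable_fun_norm_addHaar]
    exact (integrable_zero _ _ _).congr hz.symm
  have h2 : ∫ x : Euc d, f ‖x‖ = 0 := by
    rw [integral_fun_norm_addHaar, integral_congr_ae hz]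
    simp
  rw [integral_eq_zero_iff_of_nonneg (fun x => Set.indicator_nonneg (by simp) _) h1] at h2
  filter_upwards [h2] with x hx
  by_contra hc
  have : ‖x‖ ∈ N := subset_toMeasurable _ _ hc
  simp [this] at hx

theorem ae_lin {ι : Type*} [Fintype ι] (L : (ι → Euc d) →ₗ[ℝ] Euc d) (hL : Function.Surjective L)
    {q : Euc d → Prop} (hq : ∀ᵐ x : Euc d, q x) :
    ∀ᵐ z ∂(Measure.pi fun _ : ι => (volume : Measure (Euc d))), q (L z) := by
  set N : Set (Euc d) := toMeasurable volume {t | ¬ q t} with hN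
  have hN0 : volume N = 0 := by rw [hN, measure_toMeasurable]; exact hq
  have hNm : MeasurableSet N := measurableSet_toMeasurable _ _
  have h1 : ∀ᵐ x : Euc d, x ∈ Nᶜ := measure_eq_zero_iff_ae_notMem.1 hN0
  have h2 := (ae_comp_linearMap_mem_iff L (volume : Measure (ι → Euc d)) volume hL hNm.compl).2 h1
  filter_upwards [h2] with z hz
  by_contra hc
  exact hz (subset_toMeasurable _ _ hc)

/-- all pairwise distances (within each cluster) avoid a null set and are positive -/
theorem ae_pairs (hd : 1 ≤ d) {m l : ℕ} (c : Fin m) (p : Prs l) {q : ℝ → Prop}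
    (hq : ∀ᵐ t ∂(volume : Measure ℝ), 0 < t → q t) :
    ∀ᵐ z ∂(Measure.pi fun _ : Fin m × Fin l => (volume : Measure (Euc d))),
      q (dist (withZero (fun k => z (c, k)) p.1.1) (withZero (fun k => z (c, k)) p.1.2)) := by
  have : Nonempty (Fin d) := ⟨⟨0, by omega⟩⟩
  have hnt : Nontrivial (Euc d) := by infer_instance
  obtain ⟨⟨a, b⟩, hab⟩ := p
  dsimp only at hab ⊢
  have h1 : ∀ᵐ x : Euc d, q ‖x‖ := by
    filter_upwards [ae_norm hd hq, Measure.ae_ne volume (0 : Euc d)] with x hx hx0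
    exact hx (norm_pos_iff.2 hx0)
  obtain ⟨k, rfl⟩ : ∃ k : Fin l, b = k.succ := Fin.exists_succ_eq.2 (Fin.ne_zero_of_lt hab) |>.imp fun _ h => h.symm
  let W : Fin (l + 1) → (Fin m × Fin l → Euc d) →ₗ[ℝ] Euc d :=
    Fin.cases 0 (fun k => LinearMap.proj (c, k))
  have hW : ∀ i z, W i z = withZero (fun k => z (c, k)) i := by
    intro i z
    refine Fin.cases ?_ (fun k => ?_) i <;> simp [W, withZero]
  have hs : Function.Surjective (W a - W k.succ) := by
    intro e
    refine ⟨Pi.single (c, k) (-e), ?_⟩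
    rw [LinearMap.sub_apply, hW, hW]
    have h1 : withZero (fun k' => (Pi.single (c, k) (-e) : Fin m × Fin l → Euc d) (c, k')) a = 0 := by
      refine Fin.cases (motive := fun a => a < k.succ → withZero (fun k' => (Pi.single (c, k) (-e) : Fin m × Fin l → Euc d) (c, k')) a = 0) ?_ (fun k' h => ?_) a hab
      · simp [withZero]
      · have : k' ≠ k := by rintro rfl; exact absurd h (lt_irrefl _)
        simp [withZero, this]
    rw [h1]
    simp [withZero]
  filter_upwards [ae_lin _ hs h1] with z hz
  rw [LinearMap.sub_apply, hW, hW] at hz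
  rw [dist_eq_norm]
  exact hz

/-- scaling factor -/
def sc (d n : ℕ) : ℝ := (n : ℝ) ^ ((1 : ℝ) / d)

theorem sc_pos (d : ℕ) {n : ℕ} (hn : n ≠ 0) : 0 < sc d n := by
  unfold sc; positivity

theorem sc_pow (hd : 1 ≤ d) (n : ℕ) : sc d n ^ d = n := by
  unfold sc
  rw [← Real.rpow_natCast, ← Real.rpow_mul (by positivity)]
  have : (d : ℝ) ≠ 0 := by
    have : d ≠ 0 := by omega
    exact_mod_cast this
  field_simp
  simp

theorem mem_box {n : ℕ} {x : Euc d} : x ∈ boxIn d n ↔ ∀ i, |x i| ≤ sc d n / 2 := Iff.rfl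

theorem unifBox_map (hd : 1 ≤ d) {n : ℕ} (hn : n ≠ 0) :
    MeasurePreserving (fun x : Euc d => sc d n • x) (unifBox d 1) (unifBox d n) := by
  have hm : Measurable (fun x : Euc d => sc d n • x) := by fun_prop
  have hs := sc_pos d hn
  refine ⟨hm, ?_⟩
  have hpre : (fun x : Euc d => sc d n • x) ⁻¹' boxIn d n = boxIn d 1 := by
    ext x
    simp only [Set.mem_preimage, mem_box, PiLp.smul_apply, smul_eq_mul, abs_mul, abs_of_pos hs]
    refine forall_congr' fun i => ?_
    have : sc d 1 = 1 := by simp [sc]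
    rw [this]
    constructor <;> intro h
    · refine le_of_mul_le_mul_left ?_ hs
      linarith
    · have := mul_le_mul_of_nonneg_left h hs.le
      linarith
  unfold unifBox
  rw [Measure.map_smul, ← hpre, ← Measure.restrict_map hm (box_meas d n),
    Measure.map_addHaar_smul _ hs.ne', finrank_euclideanSpace_fin, sc_pow hd,
    Measure.restrict_smul, smul_smul]
  congr 1
  rw [abs_of_nonneg (by positivity), ENNReal.ofReal_inv_of_pos (by positivity)]
  simp

def jn {m l : ℕ} (x : Fin m → Euc d) (z : Fin m × Fin l → Euc d) : Fin m × Fin (l + 1) → Euc d :=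
  fun a => Fin.cases (x a.1) (fun k => x a.1 + z (a.1, k)) a.2

theorem jn_zero {m l : ℕ} (x : Fin m → Euc d) (z : Fin m × Fin l → Euc d) (c : Fin m) :
    jn x z (c, 0) = x c := rfl
theorem jn_succ {m l : ℕ} (x : Fin m → Euc d) (z : Fin m × Fin l → Euc d) (c : Fin m) (k : Fin l) :
    jn x z (c, k.succ) = x c + z (c, k) := rfl

theorem jn_meas {m l : ℕ} : Measurable (fun p : (Fin m → Euc d) × (Fin m × Fin l → Euc d) =>
    jn p.1 p.2) := by
  refine measurable_pi_lambda _ fun ⟨c, k⟩ => ?_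
  refine Fin.cases ?_ (fun k => ?_) k
  · simp only [jn_zero]; fun_prop
  · simp only [jn_succ]; fun_prop

def eqv (m l : ℕ) : Fin m ⊕ (Fin m × Fin l) ≃ Fin m × Fin (l + 1) where
  toFun := Sum.elim (fun c => (c, 0)) (fun a => (a.1, a.2.succ))
  invFun := fun a => Fin.cases (Sum.inl a.1) (fun k => Sum.inr (a.1, k)) a.2
  left_inv := by rintro (c | ⟨c, k⟩) <;> simp
  right_inv := by
    rintro ⟨c, k⟩
    refine Fin.cases ?_ (fun k => ?_) k <;> simp

theorem eqv_join {m l : ℕ} (x : Fin m → Euc d) (z : Fin m × Fin l → Euc d) :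
    (fun j => Sum.elim x (fun a => x a.1 + z a) ((eqv m l).symm j)) = jn x z := by
  funext ⟨c, k⟩
  refine Fin.cases ?_ (fun k => ?_) k
  · rfl
  · rfl

theorem cov (hd : 1 ≤ d) {n m l : ℕ} (hn : n ≠ 0) (f : (Fin m × Fin (l + 1) → Euc d) → ℝ≥0∞)
    (hf : Measurable f) :
    (n : ℝ≥0∞) ^ (m * l) * ∫⁻ y, f y ∂(Measure.pi fun _ => unifBox d n) =
      ∫⁻ x : Fin m → Euc d, ∫⁻ z : Fin m × Fin l → Euc d,
        {z : Fin m × Fin l → Euc d | ∀ a, sc d n • x a.1 + z a ∈ boxIn d n}.indicator 1 z *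
          f (jn (fun c => sc d n • x c) z) ∂(Measure.pi fun _ => volume)
        ∂(Measure.pi fun _ => unifBox d 1) := by
  have hub := unifBox_prob hd hn
  have hub1 := unifBox_prob hd (n := 1) one_ne_zero
  have h := mp_sum (unifBox d n) (eqv m l)
  have hbm : MeasurableSet (Set.univ.pi fun _ : Fin m × Fin l => boxIn d n) :=
    MeasurableSet.univ_pi fun _ => box_meas d n
  have hc : Measurable (fun p : (Fin m → Euc d) × (Fin m × Fin l → Euc d) =>
      f (fun j => Sum.elim p.1 p.2 ((eqv m l).symm j))) := hf.comp h.measurable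
  rw [← h.map_eq, lintegral_map hf h.measurable, lintegral_prod _ hc.aemeasurable]
  have h2 : MeasurePreserving (fun (x : Fin m → Euc d) c => sc d n • x c)
      (Measure.pi fun _ => unifBox d 1) (Measure.pi fun _ => unifBox d n) :=
    measurePreserving_pi _ _ fun _ => unifBox_map hd hn
  have hI := hc.lintegral_prod_right'
    (ν := Measure.pi fun _ : Fin m × Fin l => unifBox d n)
  rw [← h2.map_eq, lintegral_map hI h2.measurable, ← lintegral_const_mul' _ _ (by simp)]
  refine lintegral_congr fun x => ?_
  set x' : Fin m → Euc d := fun c => sc d n • x c with hx'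
  have e1 : (Measure.pi fun _ : Fin m × Fin l => unifBox d n) =
      ((n : ℝ≥0∞) ^ (m * l))⁻¹ • (Measure.pi fun _ : Fin m × Fin l =>
        (volume : Measure (Euc d))).restrict (Set.univ.pi fun _ => boxIn d n) := by
    unfold unifBox
    rw [pi_smul_meas _ _ (by simpa using hn), Measure.restrict_pi_pi]
    simp [ENNReal.inv_pow]
  rw [e1, lintegral_smul_measure, smul_eq_mul, ← mul_assoc, ENNReal.mul_inv_cancel (by simp [hn])
    (by simp), one_mul, ← lintegral_indicator hbm]
  rw [← lintegral_add_left_eq_self (μ := Measure.pi fun _ : Fin m × Fin l =>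
        (volume : Measure (Euc d))) _ (fun a => x' a.1)]
  refine lintegral_congr fun z => ?_
  have e2 : (fun j => Sum.elim x' ((fun a : Fin m × Fin l => x' a.1) + z) ((eqv m l).symm j))
    = jn x' z := eqv_join x' z
  by_cases hz : ∀ a : Fin m × Fin l, x' a.1 + z a ∈ boxIn d n
  · rw [Set.indicator_of_mem (by simpa using hz), Set.indicator_of_mem (by exact hz), Pi.one_apply,
      one_mul]
    rw [e2]
  · rw [Set.indicator_of_notMem (by simpa using hz), Set.indicator_of_notMem (by exact hz), zero_mul]

theorem jn_eq {m l : ℕ} (x : Fin m → Euc d) (z : Fin m × Fin l → Euc d) (c : Fin m) (k : Fin (l + 1)) :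
    jn x z (c, k) = x c + withZero (fun k => z (c, k)) k := by
  refine Fin.cases ?_ (fun k => ?_) k
  · simp [jn_zero, withZero]
  · simp [jn_succ, withZero]

theorem tt_jn {m l : ℕ} (κ : ℝ → ℝ → ℝ → ℝ) (x : Fin m → Euc d) (z : Fin m × Fin l → Euc d)
    (c : Fin m) (w : Fin (l + 1) → ℝ) :
    tt κ (fun k => jn x z (c, k)) w = tt κ (withZero (fun k => z (c, k))) w := by
  funext p
  simp only [tt, jn_eq, dist_add_left]

theorem D1_jn {m l : ℕ} (r : ℝ) (x : Fin m → Euc d) (z : Fin m × Fin l → Euc d)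
    (h : D1 r (jn x z)) : ∀ a, z a ∈ Metric.ball (0 : Euc d) r := by
  rintro ⟨c, k⟩
  have := h.1 c k
  rw [jn_succ, jn_zero] at this
  simpa [dist_eq_norm] using this

theorem sc_tendsto (hd : 1 ≤ d) : Tendsto (fun n => sc d n) atTop atTop := by
  unfold sc
  exact (tendsto_rpow_atTop (by positivity)).comp tendsto_natCast_atTop_atTop

/-- good limiting positions -/
def Good {m : ℕ} (x : Fin m → Euc d) : Prop :=
  (∀ c i, |x c i| < 1 / 2) ∧ ∀ c c', c ≠ c' → x c ≠ x c'

theorem good_box (hd : 1 ≤ d) {m : ℕ} {x : Fin m → Euc d} (hx : Good x) (R : ℝ) :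
    ∀ᶠ n in atTop, ∀ c u, ‖u‖ ≤ R → sc d n • x c + u ∈ boxIn d n := by
  have h1 : ∀ᶠ n in atTop, ∀ c i, R ≤ (1 / 2 - |x c i|) * sc d n := by
    rw [eventually_all]; intro c
    rw [eventually_all]; intro i
    have := (sc_tendsto hd).const_mul_atTop (sub_pos.2 (hx.1 c i))
    exact this.eventually_ge_atTop R
  filter_upwards [h1, eventually_ne_atTop 0] with n hn h0 c u hu
  rw [mem_box]
  intro i
  have h2 : |u i| ≤ R := (PiLp.norm_apply_le u i).trans hu
  have h3 := hn c i
  have h4 := sc_pos d h0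
  calc |(sc d n • x c + u) i| ≤ |sc d n * x c i| + |u i| := by
        simpa using abs_add_le (sc d n * x c i) (u i)
    _ ≤ sc d n * |x c i| + R := by rw [abs_mul, abs_of_pos h4]; gcongr
    _ ≤ sc d n / 2 := by nlinarith

theorem good_sep (hd : 1 ≤ d) {m : ℕ} {x : Fin m → Euc d} (hx : Good x) (R : ℝ) :
    ∀ᶠ n in atTop, ∀ c c', c ≠ c' → R ≤ dist (sc d n • x c) (sc d n • x c') := by
  rw [eventually_all]; intro c
  rw [eventually_all]; intro c'
  by_cases h : c = c'
  · simp [h]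
  have h1 := (sc_tendsto hd).atTop_mul_const (dist_pos.2 (hx.2 c c' h))
  filter_upwards [h1.eventually_ge_atTop R, eventually_ne_atTop 0] with n hn h0 _
  rw [dist_smul₀, Real.norm_of_nonneg (sc_pos d h0).le]
  exact hn

theorem good_vol (hd : 1 ≤ d) {m : ℕ} {x : Fin m → Euc d} (hx : Good x) (r : ℝ) :
    ∀ᶠ n in atTop, unifBox d n {y | ∀ c : Fin m, r ≤ dist y (sc d n • x c)} =
      1 - (n : ℝ≥0∞)⁻¹ * (m * volume (Metric.ball (0 : Euc d) r)) := by
  filter_upwards [good_box hd hx r, good_sep hd hx (r + r), eventually_ne_atTop 0] with n h1 h2 h0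
  have hub := unifBox_prob hd h0
  have e1 : {y | ∀ c : Fin m, r ≤ dist y (sc d n • x c)} =
      (⋃ c, Metric.ball (sc d n • x c) r)ᶜ := by
    ext y; simp
  have hm : MeasurableSet (⋃ c, Metric.ball (sc d n • x c) r) :=
    MeasurableSet.iUnion fun c => measurableSet_ball
  rw [e1, prob_compl_eq_one_sub hm]
  congr 1
  have e2 : (⋃ c, Metric.ball (sc d n • x c) r) ∩ boxIn d n = ⋃ c, Metric.ball (sc d n • x c) r := by
    rw [Set.inter_eq_left]
    refine Set.iUnion_subset fun c y hy => ?_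
    have := h1 c (y - sc d n • x c) (by rw [← dist_eq_norm]; exact (Metric.mem_ball.1 hy).le)
    simpa using this
  rw [unifBox, Measure.smul_apply, Measure.restrict_apply hm, e2, smul_eq_mul,
    measure_iUnion (fun c c' h => Metric.ball_disjoint_ball (h2 c c' h)) fun c => measurableSet_ball]
  simp only [tsum_fintype]
  congr 1
  rw [Finset.sum_congr rfl fun c _ => show volume (Metric.ball (sc d n • x c) r) =
    volume (Metric.ball (0 : Euc d) r) from Measure.addHaar_ball_center _ _ _]
  simp

theorem pow_lim (a : ℝ≥0∞) (ha : a ≠ ∞) (K : ℕ) :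
    Tendsto (fun n : ℕ => (1 - (n : ℝ≥0∞)⁻¹ * a) ^ (n - K)) atTop
      (𝓝 (ENNReal.ofReal (Real.exp (-a.toReal)))) := by
  set b := a.toReal with hb
  have hb0 : 0 ≤ b := ENNReal.toReal_nonneg
  have h1 : Tendsto (fun n : ℕ => (1 + (-b) / n) ^ n) atTop (𝓝 (Real.exp (-b))) :=
    Real.tendsto_one_add_div_pow_exp (-b)
  have h2 : Tendsto (fun n : ℕ => (1 + (-b) / (n : ℝ))) atTop (𝓝 (1 + 0)) :=
    tendsto_const_nhds.add (tendsto_const_div_atTop_nhds_zero_nat _)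
  rw [add_zero] at h2
  have h3 := h1.div (h2.pow K) (by simp)
  rw [one_pow, div_one] at h3
  refine (ENNReal.tendsto_ofReal h3).congr' ?_
  filter_upwards [h2.eventually (lt_mem_nhds one_pos), eventually_ge_atTop (K + 1)] with n hn hK
  have hn0 : (n : ℝ) ≠ 0 := by
    have : n ≠ 0 := by omega
    exact_mod_cast this
  simp only [Pi.div_apply, Pi.pow_apply]
  rw [div_eq_mul_inv ((1 + -b / (n:ℝ)) ^ n), ← pow_sub₀ _ hn.ne' (by omega), ENNReal.ofReal_pow hn.le]
  congr 1
  rw [neg_div, ← sub_eq_add_neg, ENNReal.ofReal_sub _ (by positivity), ENNReal.ofReal_one,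
    div_eq_inv_mul, ENNReal.ofReal_mul (by positivity), ENNReal.ofReal_inv_of_pos (by positivity),
    ENNReal.ofReal_natCast, hb, ENNReal.ofReal_toReal ha]

theorem ae_good (hd : 1 ≤ d) (m : ℕ) :
    ∀ᵐ x ∂(Measure.pi fun _ : Fin m => unifBox d 1), Good x := by
  have hub := unifBox_prob hd (n := 1) one_ne_zero
  have : Nonempty (Fin d) := ⟨⟨0, by omega⟩⟩
  have hnt : Nontrivial (Euc d) := by infer_instance
  have hac : (Measure.pi fun _ : Fin m => unifBox d 1) ≪
      (Measure.pi fun _ : Fin m => (volume : Measure (Euc d))) := by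
    have e : (unifBox d 1) = (1 : ℝ≥0∞) • volume.restrict (boxIn d 1) := by simp [unifBox]
    rw [e, pi_smul_meas _ _ (by simp), one_pow, one_smul, ← Measure.restrict_pi_pi]
    exact Measure.restrict_le_self.absolutelyContinuous
  refine Eventually.and ?_ ?_
  · rw [ae_all_iff]; intro c
    rw [ae_all_iff]; intro i
    have h1 : ∀ᵐ x ∂(unifBox d 1), |x i| < 1 / 2 := by
      have h2 : ∀ a : ℝ, ∀ᵐ x : Euc d, x i ≠ a := by
        intro a
        have h3 := (Measure.quasiMeasurePreserving_eval (fun _ : Fin d => (volume : Measure ℝ)) i).ae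
          (Measure.ae_ne volume a)
        exact (PiLp.volume_preserving_ofLp (Fin d)).quasiMeasurePreserving.ae h3
      have e : (unifBox d 1) = volume.restrict (boxIn d 1) := by simp [unifBox]
      rw [e]
      filter_upwards [ae_restrict_of_ae (h2 (1 / 2)), ae_restrict_of_ae (h2 (-(1 / 2))),
        ae_restrict_mem (box_meas d 1)] with x h4 h5 h6
      have h7 := h6 i
      simp only [Nat.cast_one, Real.one_rpow] at h7
      rcases lt_or_eq_of_le h7 with h | h
      · exact h
      · rcases eq_or_eq_neg_of_abs_eq h with h | h
        · exact absurd h h4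
        · exact absurd h h5
    exact (Measure.quasiMeasurePreserving_eval (fun _ : Fin m => unifBox d 1) c).ae h1
  · rw [ae_all_iff]; intro c
    rw [ae_all_iff]; intro c'
    by_cases h : c = c'
    · simp [h]
    let L : (Fin m → Euc d) →ₗ[ℝ] Euc d := LinearMap.proj (R := ℝ) (φ := fun _ : Fin m => Euc d) c -
      LinearMap.proj (R := ℝ) (φ := fun _ : Fin m => Euc d) c'
    have hL : Function.Surjective L := by
      intro e
      refine ⟨Pi.single c e, ?_⟩
      have : c' ≠ c := fun h' => h h'.symm
      simp [L, this]
    have := hac.ae_le (ae_lin L hL (Measure.ae_ne volume (0 : Euc d)))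
    filter_upwards [this] with x hx _ he
    apply hx
    simp [L, he]

def Gint (d : ℕ) {m l : ℕ} (κ : ℝ → ℝ → ℝ → ℝ) (n : ℕ) (r : ℝ) (B : (Prs l → Prop) → Prop)
    (w : Fin m × Fin (l + 1) → ℝ) (y : Fin m × Fin (l + 1) → Euc d) : ℝ≥0∞ :=
    {y : Fin m × Fin (l + 1) → Euc d | D1 r y}.indicator 1 y *
      (∏ c, Qf B (tt κ (fun k => y (c, k)) (fun k => w (c, k)))) *
      unifBox d n {x | ∀ c : Fin m, r ≤ dist x (y (c, 0))} ^ (n - m * (l + 1))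

theorem Gint_meas (hd : 1 ≤ d) {m l : ℕ} {κ : ℝ → ℝ → ℝ → ℝ}
    (hκ : Measurable fun p : ℝ × ℝ × ℝ => κ p.1 p.2.1 p.2.2) {n : ℕ} (hn : n ≠ 0) (r : ℝ)
    (B : (Prs l → Prop) → Prop) (w : Fin m × Fin (l + 1) → ℝ) :
    Measurable (Gint d κ n r B w) := by
  have hub := unifBox_prob hd hn
  unfold Gint
  refine (Fint_meas hκ r B measurable_id measurable_const).mul ?_
  exact Measurable.pow_const (measurable_measure_prodMk_left (meas_far r)) _

/-- the set of `z` in the product of balls -/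
def inB (d : ℕ) {m l : ℕ} (r : ℝ) : Set (Fin m × Fin l → Euc d) :=
  {z | ∀ a, z a ∈ Metric.ball (0 : Euc d) r}

theorem inB_meas {m l : ℕ} (r : ℝ) : MeasurableSet (inB d r : Set (Fin m × Fin l → Euc d)) := by
  unfold inB
  exact meas_all fun a => (measurable_pi_apply a) measurableSet_ball

theorem inB_vol {m l : ℕ} (r : ℝ) : (Measure.pi fun _ : Fin m × Fin l => (volume : Measure (Euc d)))
    (inB d r) = volume (Metric.ball (0 : Euc d) r) ^ (m * l) := by
  have : (inB d r : Set (Fin m × Fin l → Euc d)) = Set.univ.pi fun _ => Metric.ball 0 r := by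
    ext z; simp [inB]
  rw [this, Measure.pi_pi]
  simp

def Kf (d : ℕ) {m l : ℕ} (κ : ℝ → ℝ → ℝ → ℝ) (n : ℕ) (r : ℝ) (B : (Prs l → Prop) → Prop)
    (w : Fin m × Fin (l + 1) → ℝ) (q : (Fin m → Euc d) × (Fin m × Fin l → Euc d)) : ℝ≥0∞ :=
  {z : Fin m × Fin l → Euc d | ∀ a, sc d n • q.1 a.1 + z a ∈ boxIn d n}.indicator 1 q.2 *
          Gint d κ n r B w (jn (fun c => sc d n • q.1 c) q.2)

theorem Kf_meas (hd : 1 ≤ d) {m l : ℕ} {κ : ℝ → ℝ → ℝ → ℝ}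
    (hκ : Measurable fun p : ℝ × ℝ × ℝ => κ p.1 p.2.1 p.2.2) {n : ℕ} (hn : n ≠ 0) (r : ℝ)
    (B : (Prs l → Prop) → Prop) (w : Fin m × Fin (l + 1) → ℝ) :
    Measurable (Kf d κ n r B w) := by
  unfold Kf
  refine Measurable.mul ?_ ?_
  · have : MeasurableSet {q : (Fin m → Euc d) × (Fin m × Fin l → Euc d) |
        ∀ a, sc d n • q.1 a.1 + q.2 a ∈ boxIn d n} := by
      refine meas_all fun a => ?_
      have : Measurable fun q : (Fin m → Euc d) × (Fin m × Fin l → Euc d) =>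
        sc d n • q.1 a.1 + q.2 a := by fun_prop
      exact this (box_meas d n)
    have h5 : Measurable (Set.indicator {q : (Fin m → Euc d) × (Fin m × Fin l → Euc d) |
        ∀ a, sc d n • q.1 a.1 + q.2 a ∈ boxIn d n}
        (1 : (Fin m → Euc d) × (Fin m × Fin l → Euc d) → ℝ≥0∞)) := measurable_one.indicator this
    exact h5
  · have h1 : Measurable fun q : (Fin m → Euc d) × (Fin m × Fin l → Euc d) =>
      ((fun c => sc d n • q.1 c), q.2) := by fun_prop
    have h2 := Measurable.comp jn_meas h1
    have h3 := Measurable.comp (Gint_meas hd hκ hn r B w) h2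
    simp only [Function.comp_def] at h3
    exact h3

theorem Gint_le (hd : 1 ≤ d) {m l : ℕ} (κ : ℝ → ℝ → ℝ → ℝ)
    {n : ℕ} (hn : n ≠ 0) (r : ℝ)
    (B : (Prs l → Prop) → Prop) (w : Fin m × Fin (l + 1) → ℝ) (y) :
    Gint d κ n r B w y ≤ {y : Fin m × Fin (l + 1) → Euc d | D1 r y}.indicator 1 y := by
  have hub := unifBox_prob hd hn
  unfold Gint
  refine (mul_le_of_le_one_right' (pow_le_one' prob_le_one _)).trans ?_
  exact mul_le_of_le_one_right' (Finset.prod_le_one' fun c _ => Qf_le B _)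

theorem Kf_le (hd : 1 ≤ d) {m l : ℕ} (κ : ℝ → ℝ → ℝ → ℝ)
    {n : ℕ} (hn : n ≠ 0) (r : ℝ)
    (B : (Prs l → Prop) → Prop) (w : Fin m × Fin (l + 1) → ℝ)
    (q : (Fin m → Euc d) × (Fin m × Fin l → Euc d)) :
    Kf d κ n r B w q ≤ (inB d r).indicator 1 q.2 := by
  unfold Kf
  have h1 : ({z : Fin m × Fin l → Euc d | ∀ a, sc d n • q.1 a.1 + z a ∈ boxIn d n}.indicator 1 q.2 : ℝ≥0∞) ≤ 1 :=
    Set.indicator_le_self' (by simp) _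
  refine (mul_le_of_le_one_left' h1).trans ((Gint_le hd κ hn r B w _).trans ?_)
  by_cases hD : D1 r (jn (fun c => sc d n • q.1 c) q.2)
  · rw [Set.indicator_of_mem (show q.2 ∈ inB d r from D1_jn r _ _ hD)]
    exact Set.indicator_le_self' (by simp) _
  · rw [Set.indicator_of_notMem (by exact hD)]; simp

theorem Fm_eq (hd : 1 ≤ d) {m l : ℕ} {κ : ℝ → ℝ → ℝ → ℝ}
    (hκ : Measurable fun p : ℝ × ℝ × ℝ => κ p.1 p.2.1 p.2.2) {n : ℕ} (hn : n ≠ 0) (r : ℝ)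
    (B : (Prs l → Prop) → Prop) (w : Fin m × Fin (l + 1) → ℝ) :
    (n : ℝ≥0∞) ^ (m * l) * Fm d κ n r B w = ∫⁻ q, Kf d κ n r B w q
      ∂((Measure.pi fun _ : Fin m => unifBox d 1).prod
        (Measure.pi fun _ : Fin m × Fin l => (volume : Measure (Euc d)))) := by
  have hub1 := unifBox_prob hd (n := 1) one_ne_zero
  rw [lintegral_prod _ (Kf_meas hd hκ hn r B w).aemeasurable]
  exact cov hd hn _ (Gint_meas hd hκ hn r B w)

theorem lint_inB (hd : 1 ≤ d) (m l : ℕ) (r : ℝ) (C : ℝ≥0∞) :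
    ∫⁻ q, (inB d r).indicator (1 : (Fin m × Fin l → Euc d) → ℝ≥0∞) q.2
      ∂((Measure.pi fun _ : Fin m => unifBox d 1).prod
        (Measure.pi fun _ : Fin m × Fin l => (volume : Measure (Euc d)))) =
      volume (Metric.ball (0 : Euc d) r) ^ (m * l) := by
  have hub1 := unifBox_prob hd (n := 1) one_ne_zero
  have hm : Measurable ((inB d r).indicator (1 : (Fin m × Fin l → Euc d) → ℝ≥0∞)) :=
    measurable_one.indicator (inB_meas r)
  have hm2 : Measurable fun q : (Fin m → Euc d) × (Fin m × Fin l → Euc d) =>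
    (inB d r).indicator (1 : (Fin m × Fin l → Euc d) → ℝ≥0∞) q.2 := hm.comp measurable_snd
  rw [lintegral_prod _ hm2.aemeasurable]
  simp [lintegral_indicator_one (inB_meas r), inB_vol]

theorem Fm_bound (hd : 1 ≤ d) {m l : ℕ} {κ : ℝ → ℝ → ℝ → ℝ}
    (hκ : Measurable fun p : ℝ × ℝ × ℝ => κ p.1 p.2.1 p.2.2) {n : ℕ} (hn : n ≠ 0) (r : ℝ)
    (B : (Prs l → Prop) → Prop) (w : Fin m × Fin (l + 1) → ℝ) :
    (n : ℝ≥0∞) ^ (m * l) * Fm d κ n r B w ≤ volume (Metric.ball (0 : Euc d) r) ^ (m * l) := by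
  rw [Fm_eq hd hκ hn, ← lint_inB hd m l r 0]
  exact lintegral_mono fun q => Kf_le hd κ hn r B w q

def Glim (d : ℕ) {m l : ℕ} (κ : ℝ → ℝ → ℝ → ℝ) (r : ℝ) (B : (Prs l → Prop) → Prop)
    (w : Fin m × Fin (l + 1) → ℝ) (z : Fin m × Fin l → Euc d) : ℝ≥0∞ :=
  (inB d r).indicator 1 z *
    (∏ c, Qf B (tt κ (withZero (fun k => z (c, k))) (fun k => w (c, k)))) *
    ENNReal.ofReal (Real.exp (-(m * volume (Metric.ball (0 : Euc d) r)).toReal))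

theorem Kf_lim (hd : 1 ≤ d) {m l : ℕ} (M : SIRGModel d Ω) (A : SIRGWeakAssumptions M) (r : ℝ)
    (hr : 0 < r) (B : (Prs l → Prop) → Prop) (w : Fin m × Fin (l + 1) → ℝ) (ws : ℕ → Fin m × Fin (l + 1) → ℝ)
    (hw : Tendsto ws atTop (𝓝 w)) :
    ∀ᵐ q ∂((Measure.pi fun _ : Fin m => unifBox d 1).prod
        (Measure.pi fun _ : Fin m × Fin l => (volume : Measure (Euc d)))),
      Tendsto (fun n => Kf d (M.κn n) n r B (ws n) q) atTop (𝓝 (Glim d A.κ r B w q.2)) := by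
  have hub1 := unifBox_prob hd (n := 1) one_ne_zero
  have h1 : ∀ᵐ q ∂((Measure.pi fun _ : Fin m => unifBox d 1).prod
        (Measure.pi fun _ : Fin m × Fin l => (volume : Measure (Euc d)))), Good q.1 :=
    Measure.quasiMeasurePreserving_fst.ae (ae_good hd m)
  have h2 : ∀ᵐ q ∂((Measure.pi fun _ : Fin m => unifBox d 1).prod
        (Measure.pi fun _ : Fin m × Fin l => (volume : Measure (Euc d)))), ∀ c (p : Prs l),
        Tendsto (fun n => M.κn n (dist (withZero (fun k => q.2 (c, k)) p.1.1) (withZero (fun k => q.2 (c, k)) p.1.2))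
          (ws n (c, p.1.1)) (ws n (c, p.1.2))) atTop
          (𝓝 (A.κ (dist (withZero (fun k => q.2 (c, k)) p.1.1) (withZero (fun k => q.2 (c, k)) p.1.2))
          (w (c, p.1.1)) (w (c, p.1.2)))) := by
    refine Measure.quasiMeasurePreserving_snd.ae (p := fun z : Fin m × Fin l → Euc d => ∀ c (p : Prs l),
        Tendsto (fun n => M.κn n (dist (withZero (fun k => z (c, k)) p.1.1) (withZero (fun k => z (c, k)) p.1.2))
          (ws n (c, p.1.1)) (ws n (c, p.1.2))) atTop
          (𝓝 (A.κ (dist (withZero (fun k => z (c, k)) p.1.1) (withZero (fun k => z (c, k)) p.1.2))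
          (w (c, p.1.1)) (w (c, p.1.2))))) ?_
    rw [ae_all_iff]; intro c
    rw [ae_all_iff]; intro p
    rw [tendsto_pi_nhds] at hw
    exact ae_pairs hd c p (A.κ_conv _ _ _ _ (hw (c, p.1.1)) (hw (c, p.1.2)))
  filter_upwards [h1, h2] with q hg hκ
  by_cases hz : q.2 ∈ inB d r
  swap
  · have e0 : Glim d A.κ r B w q.2 = 0 := by simp [Glim, Set.indicator_of_notMem hz]
    rw [e0]
    refine tendsto_const_nhds.congr' ?_
    filter_upwards [eventually_ne_atTop 0] with n hn
    have := Kf_le hd (M.κn n) hn r B (ws n) q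
    rw [Set.indicator_of_notMem hz] at this
    exact (le_antisymm this (by simp)).symm
  have hlim : Tendsto (fun n => (1 : ℝ≥0∞) *
      (∏ c, Qf B (tt (M.κn n) (withZero (fun k => q.2 (c, k))) (fun k => ws n (c, k)))) *
      (1 - (n : ℝ≥0∞)⁻¹ * (m * volume (Metric.ball (0 : Euc d) r))) ^ (n - m * (l + 1))) atTop
      (𝓝 (Glim d A.κ r B w q.2)) := by
    unfold Glim
    rw [Set.indicator_of_mem hz]
    have hfin : (m : ℝ≥0∞) * volume (Metric.ball (0 : Euc d) r) ≠ ∞ :=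
      ENNReal.mul_ne_top (by simp) measure_ball_lt_top.ne
    have hQ : ∀ c, Tendsto (fun n => Qf B (tt (M.κn n) (withZero (fun k => q.2 (c, k))) (fun k => ws n (c, k))))
        atTop (𝓝 (Qf B (tt A.κ (withZero (fun k => q.2 (c, k))) (fun k => w (c, k))))) := fun c =>
      Qf_tendsto B _ _ (tendsto_pi_nhds.2 fun p => hκ c p)
    have hP := ENNReal.tendsto_finsetProd_of_ne_top (Finset.univ) (fun c _ => hQ c)
      (fun c _ => ((Qf_le B _).trans_lt ENNReal.one_lt_top).ne)
    have hP1 : (∏ c, Qf B (tt A.κ (withZero (fun k => q.2 (c, k))) (fun k => w (c, k)))) ≠ ∞ :=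
      ((Finset.prod_le_one' fun c _ => Qf_le B _).trans_lt ENNReal.one_lt_top).ne
    simp only [one_mul, Pi.one_apply]
    exact ENNReal.Tendsto.mul hP (Or.inr (by simp)) (pow_lim _ hfin _) (Or.inr hP1)
  refine hlim.congr' ?_
  filter_upwards [good_box hd hg r, good_sep hd hg (r + r), good_vol hd hg r] with n g1 g2 g3
  unfold Kf Gint
  rw [Set.indicator_of_mem, Set.indicator_of_mem]
  · simp only [Pi.one_apply, one_mul, tt_jn, jn_zero, g3]
  · refine ⟨fun c k => ?_, fun c c' k hcc => ?_⟩
    · rw [jn_succ, jn_zero]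
      have := hz (c, k)
      simpa [dist_eq_norm] using this
    · have hk : ‖withZero (fun k => q.2 (c', k)) k‖ ≤ r := by
        refine Fin.cases ?_ (fun k => ?_) k
        · simpa [withZero] using hr.le
        · have := hz (c', k)
          simp only [Metric.mem_ball, dist_zero_right] at this
          simpa [withZero] using this.le
      rw [jn_eq, jn_zero]
      have h3 := g2 c' c hcc.symm
      have h4 := dist_triangle (sc d n • q.1 c') (sc d n • q.1 c' + withZero (fun k => q.2 (c', k)) k) (sc d n • q.1 c)
      rw [dist_self_add_right] at h4
      linarith
  · intro a
    refine g1 _ _ ?_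
    have := hz a
    simp only [Metric.mem_ball, dist_zero_right] at this
    exact this.le

theorem Fm_lim (hd : 1 ≤ d) {m l : ℕ} (M : SIRGModel d Ω) (A : SIRGWeakAssumptions M) (r : ℝ)
    (hr : 0 < r) (B : (Prs l → Prop) → Prop) (w : Fin m × Fin (l + 1) → ℝ) (ws : ℕ → Fin m × Fin (l + 1) → ℝ)
    (hw : Tendsto ws atTop (𝓝 w)) :
    Tendsto (fun n : ℕ => if n = 0 then 0 else (n : ℝ≥0∞) ^ (m * l) * Fm d (M.κn n) n r B (ws n)) atTop
      (𝓝 (∫⁻ z, Glim d A.κ r B w z ∂(Measure.pi fun _ : Fin m × Fin l => (volume : Measure (Euc d))))) := by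
  have hub1 := unifBox_prob hd (n := 1) one_ne_zero
  have hm : Measurable (Glim d A.κ r B w) := by
    unfold Glim
    refine Measurable.mul (Measurable.mul (measurable_one.indicator (inB_meas r)) ?_) measurable_const
    refine Finset.measurable_prod _ fun c _ => (Qf_meas B).comp (tt_meas A.κ_meas ?_ measurable_const)
    refine measurable_pi_lambda _ fun k => ?_
    refine Fin.cases ?_ (fun k => ?_) k
    · simp [withZero]
    · simp only [withZero, Fin.cases_succ]; fun_prop
  have e : ∫⁻ z, Glim d A.κ r B w z ∂(Measure.pi fun _ : Fin m × Fin l => (volume : Measure (Euc d))) =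
    ∫⁻ q, Glim d A.κ r B w q.2 ∂((Measure.pi fun _ : Fin m => unifBox d 1).prod
        (Measure.pi fun _ : Fin m × Fin l => (volume : Measure (Euc d)))) := by
    have hm2 : Measurable fun q : (Fin m → Euc d) × (Fin m × Fin l → Euc d) =>
      Glim d A.κ r B w q.2 := hm.comp measurable_snd
    rw [lintegral_prod _ hm2.aemeasurable]
    simp
  rw [e]
  have key := tendsto_lintegral_filter_of_dominated_convergence
    (μ := (Measure.pi fun _ : Fin m => unifBox d 1).prod
        (Measure.pi fun _ : Fin m × Fin l => (volume : Measure (Euc d)))) (l := atTop)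
    (F := fun n q => Kf d (M.κn n) n r B (ws n) q) (f := fun q => Glim d A.κ r B w q.2)
    (fun q => (inB d r).indicator 1 q.2) ?_ ?_ ?_ (Kf_lim hd M A r hr B w ws hw)
  · refine key.congr' ?_
    filter_upwards [eventually_ne_atTop 0] with n hn
    rw [if_neg hn, Fm_eq hd (M.κn_meas n) hn]
  · filter_upwards [eventually_ne_atTop 0] with n hn
    exact (Kf_meas hd (M.κn_meas n) hn r B _)
  · filter_upwards [eventually_ne_atTop 0] with n hn
    exact Eventually.of_forall fun q => Kf_le hd _ hn r B _ q
  · rw [lint_inB hd m l r 0]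
    exact ENNReal.pow_ne_top measure_ball_lt_top.ne

def inB1 (d l : ℕ) (r : ℝ) : Set (Fin l → Euc d) := {z | ∀ k, z k ∈ Metric.ball (0 : Euc d) r}

theorem inB1_meas (l : ℕ) (r : ℝ) : MeasurableSet (inB1 d l r) := by
  unfold inB1
  exact meas_all fun a => (measurable_pi_apply a) measurableSet_ball

def f1 (d : ℕ) {l : ℕ} (κ : ℝ → ℝ → ℝ → ℝ) (r : ℝ) (B : (Prs l → Prop) → Prop)
    (w : Fin (l + 1) → ℝ) (z : Fin l → Euc d) : ℝ≥0∞ :=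
  (inB1 d l r).indicator 1 z * Qf B (tt κ (withZero z) w) *
    ENNReal.ofReal (Real.exp (-(volume (Metric.ball (0 : Euc d) r)).toReal))

theorem withZero_meas (l : ℕ) : Measurable (fun z : Fin l → Euc d => withZero z) := by
  refine measurable_pi_lambda _ fun k => ?_
  refine Fin.cases ?_ (fun k => ?_) k
  · simp [withZero]
  · simp only [withZero, Fin.cases_succ]; fun_prop

theorem f1_meas2 {l : ℕ} {κ : ℝ → ℝ → ℝ → ℝ}
    (hκ : Measurable fun p : ℝ × ℝ × ℝ => κ p.1 p.2.1 p.2.2) (r : ℝ) (B : (Prs l → Prop) → Prop) :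
    Measurable fun q : (Fin (l + 1) → ℝ) × (Fin l → Euc d) => f1 d κ r B q.1 q.2 := by
  unfold f1
  refine Measurable.mul (Measurable.mul ?_ ?_) measurable_const
  · have hm : Measurable ((inB1 d l r).indicator (1 : (Fin l → Euc d) → ℝ≥0∞)) :=
      measurable_one.indicator (inB1_meas l r)
    exact hm.comp measurable_snd
  · have h1 : Measurable fun q : (Fin (l + 1) → ℝ) × (Fin l → Euc d) => withZero q.2 :=
      (withZero_meas l).comp measurable_snd
    exact (Qf_meas B).comp (tt_meas hκ h1 measurable_fst)

theorem f1_meas {l : ℕ} {κ : ℝ → ℝ → ℝ → ℝ}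
    (hκ : Measurable fun p : ℝ × ℝ × ℝ => κ p.1 p.2.1 p.2.2) (r : ℝ) (B : (Prs l → Prop) → Prop)
    (w : Fin (l + 1) → ℝ) : Measurable (f1 d κ r B w) := by
  have h1 : Measurable fun z : Fin l → Euc d => (w, z) := measurable_prodMk_left
  have h3 := Measurable.comp (f1_meas2 (d := d) hκ r B) h1
  simp only [Function.comp_def] at h3
  exact h3

theorem Glim_prod {m l : ℕ} (κ : ℝ → ℝ → ℝ → ℝ) (r : ℝ) (B : (Prs l → Prop) → Prop)
    (w : Fin m × Fin (l + 1) → ℝ) (z : Fin m × Fin l → Euc d) :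
    Glim d κ r B w z = ∏ c, f1 d κ r B (fun k => w (c, k)) (fun k => z (c, k)) := by
  unfold Glim f1
  rw [Finset.prod_mul_distrib, Finset.prod_mul_distrib]
  congr 1
  · congr 1
    by_cases hz : z ∈ inB d r
    · rw [Set.indicator_of_mem hz, Finset.prod_congr rfl fun c _ => Set.indicator_of_mem (s := inB1 d l r) (fun k => hz (c, k)) _]
      simp
    · rw [Set.indicator_of_notMem hz]
      have : ∃ c, (fun k => z (c, k)) ∉ inB1 d l r := by
        by_contra hc
        push Not at hc
        exact hz fun a => hc a.1 a.2
      obtain ⟨c, hc⟩ := this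
      exact (Finset.prod_eq_zero (Finset.mem_univ c) (Set.indicator_of_notMem hc _)).symm
  · rw [Finset.prod_const, Finset.card_univ, Fintype.card_fin, ← ENNReal.ofReal_pow (Real.exp_pos _).le,
      ← Real.exp_nat_mul]
    congr 2
    rw [ENNReal.toReal_mul]
    simp

def Q1 (d : ℕ) {l : ℕ} (κ : ℝ → ℝ → ℝ → ℝ) (μW : Measure ℝ) (r : ℝ) (B : (Prs l → Prop) → Prop) : ℝ≥0∞ :=
  ∫⁻ w, ∫⁻ z, f1 d κ r B w z ∂(Measure.pi fun _ : Fin l => (volume : Measure (Euc d)))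
    ∂(Measure.pi fun _ : Fin (l + 1) => μW)

theorem Glim_int {m l : ℕ} {κ : ℝ → ℝ → ℝ → ℝ}
    (hκ : Measurable fun p : ℝ × ℝ × ℝ => κ p.1 p.2.1 p.2.2)
    (μW : Measure ℝ) [IsProbabilityMeasure μW] (r : ℝ) (B : (Prs l → Prop) → Prop) :
    ∫⁻ w, ∫⁻ z, Glim d κ r B w z ∂(Measure.pi fun _ : Fin m × Fin l => (volume : Measure (Euc d)))
      ∂(Measure.pi fun _ : Fin m × Fin (l + 1) => μW) = Q1 d κ μW r B ^ m := by
  have hg : Measurable fun w => ∫⁻ z, f1 d κ r B w z ∂(Measure.pi fun _ : Fin l => (volume : Measure (Euc d))) :=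
    Measurable.lintegral_prod_right' (f1_meas2 hκ r B)
  have h1 : ∀ w : Fin m × Fin (l + 1) → ℝ,
      ∫⁻ z, Glim d κ r B w z ∂(Measure.pi fun _ : Fin m × Fin l => (volume : Measure (Euc d))) =
      ∏ c, ∫⁻ z, f1 d κ r B (fun k => w (c, k)) z ∂(Measure.pi fun _ : Fin l => (volume : Measure (Euc d))) := by
    intro w
    simp only [Glim_prod]
    have hc := mp_curry (A := Fin m) (B := Fin l) (volume : Measure (Euc d))
    rw [← hc.map_eq, lintegral_map _ hc.measurable]
    · exact lint_pi_prod _ m (fun c => f1 d κ r B (fun k => w (c, k))) fun c => f1_meas hκ r B _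
    · refine Finset.measurable_prod _ fun c _ => (f1_meas hκ r B _).comp ?_
      fun_prop
  simp only [h1]
  have hc := mp_curry (A := Fin m) (B := Fin (l + 1)) μW
  rw [← hc.map_eq, lintegral_map _ hc.measurable]
  · rw [lint_pi_prod _ m (fun c w => ∫⁻ z, f1 d κ r B w z ∂(Measure.pi fun _ : Fin l => (volume : Measure (Euc d)))) fun c => hg]
    simp [Q1]
  · refine Finset.measurable_prod _ fun c _ => hg.comp ?_
    fun_prop

open Classical in
def Sm (M : SIRGModel d Ω) (m : ℕ) {l : ℕ} (r : ℝ) (B : (Prs l → Prop) → Prop) (n : ℕ) : ℝ≥0∞ :=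
  ((n : ℝ≥0∞) ^ m)⁻¹ * ∑ v ∈ (Finset.univ : Finset (Fin m × Fin (l + 1) → Fin n)).filter
    (fun v => Function.Injective v), M.P {ω | ∀ c, EvA M n r B (fun k => v (c, k)) ω}

theorem Sm_tendsto (hd : 1 ≤ d) (M : SIRGModel d Ω) (A : SIRGWeakAssumptions M) (m : ℕ) {l : ℕ} (r : ℝ)
    (hr : 0 < r) (B : (Prs l → Prop) → Prop) :
    Tendsto (Sm M m r B) atTop (𝓝 (Q1 d A.κ A.μW r B ^ m)) := by
  classical
  have hpr := A.probμW
  rw [← Glim_int (m := m) A.κ_meas A.μW r B]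
  have hfin : volume (Metric.ball (0 : Euc d) r) ^ (m * l) ≠ ∞ := ENNReal.pow_ne_top measure_ball_lt_top.ne
  have key := wsum_tendsto M A (Fin m × Fin (l + 1))
    (fun n w => if n = 0 then 0 else (n : ℝ≥0∞) ^ (m * l) * Fm d (M.κn n) n r B w)
    (fun w => ∫⁻ z, Glim d A.κ r B w z ∂(Measure.pi fun _ : Fin m × Fin l => (volume : Measure (Euc d))))
    (volume (Metric.ball (0 : Euc d) r) ^ (m * l)).toNNReal ?_ ?_
    (fun w ws hw => Fm_lim hd M A r hr B w ws hw)
  · refine key.congr' ?_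
    filter_upwards [eventually_ne_atTop 0] with n hn
    simp only [if_neg hn]
    unfold Sm
    have h0 : (n : ℝ≥0∞) ≠ 0 := by simpa using hn
    rw [Finset.sum_congr rfl (g := fun v => (n : ℝ≥0∞) ^ (m * l) *
      M.P {ω | ∀ c, EvA M n r B (fun k => v (c, k)) ω})]
    · rw [← Finset.mul_sum, ← mul_assoc]
      congr 1
      · rw [Fintype.card_prod, Fintype.card_fin, Fintype.card_fin, mul_add, mul_one, pow_add,
          ENNReal.mul_inv (Or.inr (by simp)) (Or.inr (by simp [h0])), mul_comm, ← mul_assoc,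
          ENNReal.mul_inv_cancel (by simp [h0]) (by simp), one_mul]
      · refine Finset.sum_congr ?_ fun _ _ => rfl
        ext; simp
    · intro v hv
      rw [moment hd M hn r B v (Finset.mem_filter.1 hv).2, lintegral_const_mul]
      have h3 := Measurable.comp (Fm_meas (m := m) hd (M.κn_meas n) hn r B)
        (measurable_pi_lambda (fun ω a => M.Wt n (v a) ω) fun a => M.Wt_meas n (v a))
      simp only [Function.comp_def] at h3
      exact h3
  · intro n
    by_cases hn : n = 0
    · simp [hn]
    · simp only [if_neg hn]
      exact (Fm_meas hd (M.κn_meas n) hn r B).const_mul _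
  · intro n w
    rw [ENNReal.coe_toNNReal hfin]
    by_cases hn : n = 0
    · simp [hn]
    · simp only [if_neg hn]
      exact Fm_bound hd (M.κn_meas n) hn r B w

def gr {l : ℕ} (s : Prs l → Prop) : SimpleGraph (Fin (l + 1)) :=
  SimpleGraph.fromRel (fun i j => ∃ h : i < j, s ⟨(i, j), h⟩)

def BH {l : ℕ} {V : Type} (H : SimpleGraph V) (h : V) (s : Prs l → Prop) : Prop :=
  RootedIso (gr s) 0 H h

theorem limitGraph_eq {l : ℕ} (κ : ℝ → ℝ → ℝ → ℝ) (z : Fin l → Euc d) (w : Fin (l + 1) → ℝ)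
    (u : Fin (l + 1) → Fin (l + 1) → ℝ) :
    limitGraph d κ l z w u = gr (fun p => u p.1.1 p.1.2 ≤ tt κ (withZero z) w p) := by
  unfold limitGraph gr
  congr 1
  funext i j
  simp [tt]

theorem slice_Qf {l : ℕ} (B : (Prs l → Prop) → Prop) (t : Prs l → ℝ) :
    (Measure.pi fun _ : Fin (l + 1) => Measure.pi fun _ : Fin (l + 1) => unif01)
      {u | B (fun p => u p.1.1 p.1.2 ≤ t p)} = Qf B t := by
  have h1 := mp_curry (A := Fin (l + 1)) (B := Fin (l + 1)) unif01
  have h2 := mp_reindex unif01 (fun p : Prs l => p.1) Subtype.val_injective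
  have h3 := (h2.comp h1).measure_preimage (s := {u | B (fun p => u p ≤ t p)})
    (meas_B B (fun p (x : Prs l → ℝ) => x p) (fun p x => t p) (fun p => by fun_prop) (fun p => by fun_prop)).nullMeasurableSet
  exact h3

theorem unifBall_pi {l : ℕ} {r : ℝ} (hr : 0 < r) (f : (Fin l → Euc d) → ℝ≥0∞) :
    ∫⁻ z, f z ∂(Measure.pi fun _ : Fin l => unifBall d r) =
      ((volume (Metric.ball (0 : Euc d) r))⁻¹) ^ l *
       ∫⁻ z, (inB1 d l r).indicator 1 z * f z ∂(Measure.pi fun _ : Fin l => volume) := by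
  have h0 : volume (Metric.ball (0 : Euc d) r) ≠ 0 := (Metric.measure_ball_pos _ _ hr).ne'
  unfold unifBall
  rw [pi_smul_meas _ _ (by simpa using h0), lintegral_smul_measure, ← Measure.restrict_pi_pi,
    Fintype.card_fin, smul_eq_mul]
  congr 1
  have e : (Set.univ.pi fun _ : Fin l => Metric.ball (0 : Euc d) r) = inB1 d l r := by
    ext z; simp [inB1]
  rw [e, ← lintegral_indicator (inB1_meas l r)]
  refine lintegral_congr fun z => ?_
  by_cases hz : z ∈ inB1 d l r <;> simp [hz]

theorem limit_eq {κ : ℝ → ℝ → ℝ → ℝ}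
    (hκ : Measurable fun p : ℝ × ℝ × ℝ => κ p.1 p.2.1 p.2.2)
    (μW : Measure ℝ) [IsProbabilityMeasure μW] {r : ℝ} (hr : 0 < r) {V : Type} [Fintype V]
    (H : SimpleGraph V) (h : V) {l : ℕ} (hl : Fintype.card V = l + 1) :
    (l.factorial : ℝ≥0∞) * limitNbhdProb d κ μW r H h = Q1 d κ μW r (BH (l := l) H h) := by
  have h0 : volume (Metric.ball (0 : Euc d) r) ≠ 0 := (Metric.measure_ball_pos _ _ hr).ne'
  have hT : volume (Metric.ball (0 : Euc d) r) ≠ ∞ := measure_ball_lt_top.ne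
  have hub : SigmaFinite (unifBall d r) := by
    unfold unifBall
    have hfb : IsFiniteMeasure (volume.restrict (Metric.ball (0 : Euc d) r)) :=
      ⟨by rw [Measure.restrict_apply_univ]; exact measure_ball_lt_top⟩
    have := Measure.smul_finite (volume.restrict (Metric.ball (0 : Euc d) r))
      (c := (volume (Metric.ball (0 : Euc d) r))⁻¹) (by simpa using h0)
    infer_instance
  unfold limitNbhdProb
  rw [tsum_eq_single l]
  swap
  · intro l' hl'
    have : {zwu : (Fin l' → Euc d) × (Fin (l' + 1) → ℝ) × (Fin (l' + 1) → Fin (l' + 1) → ℝ) |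
          RootedIso (limitGraph d κ l' zwu.1 zwu.2.1 zwu.2.2) 0 H h} = ∅ := by
      ext x
      simp only [Set.mem_ofPred_eq, Set.mem_empty_iff_false, iff_false]
      rintro ⟨φ, -⟩
      have := Fintype.card_congr φ.toEquiv
      rw [Fintype.card_fin, hl] at this
      omega
    rw [this]; simp
  have hS : {zwu : (Fin l → Euc d) × (Fin (l + 1) → ℝ) × (Fin (l + 1) → Fin (l + 1) → ℝ) |
          RootedIso (limitGraph d κ l zwu.1 zwu.2.1 zwu.2.2) 0 H h} =
      {zwu | BH H h (fun p : Prs l => zwu.2.2 p.1.1 p.1.2 ≤ tt κ (withZero zwu.1) zwu.2.1 p)} := by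
    ext x
    simp only [Set.mem_ofPred_eq, limitGraph_eq, BH]
  have hm : MeasurableSet {zwu : (Fin l → Euc d) × (Fin (l + 1) → ℝ) × (Fin (l + 1) → Fin (l + 1) → ℝ) |
      BH H h (fun p : Prs l => zwu.2.2 p.1.1 p.1.2 ≤ tt κ (withZero zwu.1) zwu.2.1 p)} := by
    refine meas_B (BH H h) (fun p (x : (Fin l → Euc d) × (Fin (l + 1) → ℝ) × (Fin (l + 1) → Fin (l + 1) → ℝ)) =>
      x.2.2 p.1.1 p.1.2) (fun p x => tt κ (withZero x.1) x.2.1 p) (fun p => by fun_prop) (fun p => ?_)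
    have h1 : Measurable fun x : (Fin l → Euc d) × (Fin (l + 1) → ℝ) × (Fin (l + 1) → Fin (l + 1) → ℝ) =>
      withZero x.1 := (withZero_meas l).comp measurable_fst
    exact measurable_pi_iff.1 (tt_meas hκ h1 (measurable_fst.comp measurable_snd)) p
  rw [hS, Measure.prod_apply hm]
  have e1 : ∀ z : Fin l → Euc d, ((Measure.pi fun _ : Fin (l + 1) => μW).prod
            (Measure.pi fun _ : Fin (l + 1) => Measure.pi fun _ : Fin (l + 1) => unif01))
      (Prod.mk z ⁻¹' {zwu | BH H h (fun p : Prs l => zwu.2.2 p.1.1 p.1.2 ≤ tt κ (withZero zwu.1) zwu.2.1 p)}) =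
      ∫⁻ w, Qf (BH H h) (tt κ (withZero z) w) ∂(Measure.pi fun _ : Fin (l + 1) => μW) := by
    intro z
    rw [Measure.prod_apply (measurable_prodMk_left hm)]
    refine lintegral_congr fun w => ?_
    exact slice_Qf (BH H h) (tt κ (withZero z) w)
  simp only [e1]
  have hq : Measurable fun q : (Fin (l + 1) → ℝ) × (Fin l → Euc d) => Qf (BH H h) (tt κ (withZero q.2) q.1) := by
    have h1 : Measurable fun q : (Fin (l + 1) → ℝ) × (Fin l → Euc d) => withZero q.2 :=
      (withZero_meas l).comp measurable_snd
    exact (Qf_meas _).comp (tt_meas hκ h1 measurable_fst)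
  rw [← lintegral_lintegral_swap hq.aemeasurable]
  simp only [unifBall_pi hr]
  have hi : Measurable ((inB1 d l r).indicator (1 : (Fin l → Euc d) → ℝ≥0∞)) :=
      measurable_one.indicator (inB1_meas l r)
  have hii : Measurable fun q : (Fin (l + 1) → ℝ) × (Fin l → Euc d) =>
    (inB1 d l r).indicator (1 : (Fin l → Euc d) → ℝ≥0∞) q.2 := hi.comp measurable_snd
  have hq2 : Measurable fun q : (Fin (l + 1) → ℝ) × (Fin l → Euc d) => 
      (inB1 d l r).indicator 1 q.2 * Qf (BH H h) (tt κ (withZero q.2) q.1) := hii.mul hq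
  have hq3 : Measurable fun w : Fin (l + 1) → ℝ => ∫⁻ z, (inB1 d l r).indicator 1 z * Qf (BH H h) (tt κ (withZero z) w)
      ∂(Measure.pi fun _ : Fin l => (volume : Measure (Euc d))) :=
    Measurable.lintegral_prod_right' hq2
  have hq4 : ∀ w, Measurable fun z : Fin l → Euc d => (inB1 d l r).indicator 1 z * Qf (BH H h) (tt κ (withZero z) w) := by
    intro w
    have h1 : Measurable fun z : Fin l → Euc d => (w, z) := measurable_prodMk_left
    have h3 := Measurable.comp hq2 h1
    simp only [Function.comp_def] at h3
    exact h3
  rw [lintegral_const_mul _ hq3]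
  unfold Q1 f1
  have e2 : ∀ w, ∫⁻ z, (inB1 d l r).indicator 1 z * Qf (BH H h) (tt κ (withZero z) w) *
      ENNReal.ofReal (Real.exp (-(volume (Metric.ball (0 : Euc d) r)).toReal))
      ∂(Measure.pi fun _ : Fin l => (volume : Measure (Euc d))) =
      (∫⁻ z, (inB1 d l r).indicator 1 z * Qf (BH H h) (tt κ (withZero z) w)
        ∂(Measure.pi fun _ : Fin l => (volume : Measure (Euc d)))) *
      ENNReal.ofReal (Real.exp (-(volume (Metric.ball (0 : Euc d) r)).toReal)) := fun w =>
    lintegral_mul_const _ (hq4 w)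
  simp only [e2]
  rw [lintegral_mul_const _ hq3]
  have e3 : (l.factorial : ℝ≥0∞) * poissonWeight (volume (Metric.ball (0 : Euc d) r)) l *
      ((volume (Metric.ball (0 : Euc d) r))⁻¹) ^ l =
      ENNReal.ofReal (Real.exp (-(volume (Metric.ball (0 : Euc d) r)).toReal)) := by
    unfold poissonWeight
    have hf : (0 : ℝ) < l.factorial := by exact_mod_cast l.factorial_pos
    rw [← ENNReal.ofReal_natCast, ← ENNReal.ofReal_mul hf.le, mul_div_cancel₀ _ hf.ne',
      ENNReal.ofReal_mul (Real.exp_pos _).le, ENNReal.ofReal_pow ENNReal.toReal_nonneg,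
      ENNReal.ofReal_toReal hT, mul_assoc, ← mul_pow, ENNReal.mul_inv_cancel h0 hT, one_pow, mul_one]
  rw [← e3]
  ring

def Erel (M : SIRGModel d Ω) (n : ℕ) (ω : Ω) (x y : Fin n) : Prop :=
  M.U n (min x y) (max x y) ω ≤ M.κn n (dist (M.Y n x ω) (M.Y n y ω)) (M.Wt n x ω) (M.Wt n y ω)

theorem Erel_symm (M : SIRGModel d Ω) (n : ℕ) (ω : Ω) (x y : Fin n) : Erel M n ω x y ↔ Erel M n ω y x := by
  unfold Erel
  rw [min_comm, max_comm, dist_comm, M.κn_symm]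

theorem graph_adj (M : SIRGModel d Ω) (n : ℕ) (ω : Ω) (x y : Fin n) :
    (M.graph n ω).Adj x y ↔ x ≠ y ∧ Erel M n ω x y := by
  unfold SIRGModel.graph
  rw [SimpleGraph.fromRel_adj]
  refine and_congr_right fun hxy => ?_
  rcases lt_or_gt_of_ne hxy with h | h
  · simp [h, h.le, Erel, not_lt_of_gt h]
  · rw [Erel_symm]
    simp [h, h.le, Erel, not_lt_of_gt h]

theorem gr_adj (M : SIRGModel d Ω) (n : ℕ) (ω : Ω) {l : ℕ} (v : Fin (l + 1) → Fin n)
    (a b : Fin (l + 1)) :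
    (gr (fun p => M.U n (min (v p.1.1) (v p.1.2)) (max (v p.1.1) (v p.1.2)) ω ≤
    tt (M.κn n) (fun k => M.Y n (v k) ω) (fun k => M.Wt n (v k) ω) p)).Adj a b ↔
      a ≠ b ∧ Erel M n ω (v a) (v b) := by
  unfold gr
  rw [SimpleGraph.fromRel_adj]
  refine and_congr_right fun hxy => ?_
  rcases lt_or_gt_of_ne hxy with h | h
  · simp [h, Erel, not_lt_of_gt h, tt]
  · rw [Erel_symm]
    simp [h, Erel, not_lt_of_gt h, tt]

theorem transfer (M : SIRGModel d Ω) (n : ℕ) (ω : Ω) {l : ℕ} (v : Fin (l + 1) → Fin n) (r : ℝ)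
    (hr : 0 < r) (hv : Function.Injective v) {V : Type} (H : SimpleGraph V) (h : V)
    (hS : Set.range v = M.euclSet n ω (v 0) r) :
    BH H h (fun p => M.U n (min (v p.1.1) (v p.1.2)) (max (v p.1.1) (v p.1.2)) ω ≤
      tt (M.κn n) (fun k => M.Y n (v k) ω) (fun k => M.Wt n (v k) ω) p) ↔
    M.euclNbhdIso n ω (v 0) r H h := by
  have hi : v 0 ∈ M.euclSet n ω (v 0) r := by rw [← hS]; exact ⟨0, rfl⟩
  have hmem : ∀ k, v k ∈ M.euclSet n ω (v 0) r := fun k => by rw [← hS]; exact ⟨k, rfl⟩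
  let e : Fin (l + 1) ≃ M.euclSet n ω (v 0) r :=
    Equiv.ofBijective (fun k => ⟨v k, hmem k⟩)
      ⟨fun a b hab => hv (congrArg Subtype.val hab), fun ⟨x, hx⟩ => by
        obtain ⟨k, hk⟩ : x ∈ Set.range v := by rw [hS]; exact hx
        exact ⟨k, Subtype.ext hk⟩⟩
  let φ : gr (fun p => M.U n (min (v p.1.1) (v p.1.2)) (max (v p.1.1) (v p.1.2)) ω ≤
      tt (M.κn n) (fun k => M.Y n (v k) ω) (fun k => M.Wt n (v k) ω) p) ≃g M.euclNbhd n ω (v 0) r :=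
    ⟨e, fun {a b} => by
      rw [gr_adj]
      change (M.graph n ω).Adj (v a) (v b) ↔ _
      rw [graph_adj, hv.ne_iff]⟩
  have hφ : φ 0 = ⟨v 0, hi⟩ := rfl
  constructor
  · rintro ⟨ψ, hψ⟩
    refine ⟨hi, φ.symm.trans ψ, ?_⟩
    rw [← hφ]; simp [hψ]
  · rintro ⟨hi', ψ, hψ⟩
    refine ⟨φ.trans ψ, ?_⟩
    simp only [RelIso.trans_apply, hφ, hψ]

theorem EvA_range (M : SIRGModel d Ω) (n : ℕ) (ω : Ω) {l : ℕ} (v : Fin (l + 1) → Fin n) (r : ℝ)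
    (hr : 0 < r) (B : (Prs l → Prop) → Prop) (h : EvA M n r B v ω) :
    Set.range v = M.euclSet n ω (v 0) r := by
  ext x
  constructor
  · rintro ⟨k, rfl⟩
    refine Fin.cases ?_ (fun k => ?_) k
    · simpa [SIRGModel.euclSet] using hr
    · exact h.1 k
  · intro hx
    by_contra hc
    exact absurd (h.2.1 x hc) (not_le.2 hx)

theorem card_T {n l : ℕ} (S : Set (Fin n)) (i : Fin n) (hi : i ∈ S) (hS : S.ncard = l + 1) :
    Nat.card {v : Fin (l + 1) → Fin n // Function.Injective v ∧ v 0 = i ∧ ∀ k : Fin l, v k.succ ∈ S} =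
      l.factorial := by
  classical
  have e : {v : Fin (l + 1) → Fin n // Function.Injective v ∧ v 0 = i ∧ ∀ k : Fin l, v k.succ ∈ S} ≃
      (Fin l ↪ (S \ {i} : Set (Fin n))) :=
    { toFun := fun v => ⟨fun k => ⟨v.1 k.succ, v.2.2.2 k, fun hc => by
          have := v.2.1 (hc.trans v.2.2.1.symm)
          exact Fin.succ_ne_zero _ this⟩, fun a b hab => by
          have := v.2.1 (congrArg Subtype.val hab)
          exact Fin.succ_injective _ this⟩
      invFun := fun f => ⟨Fin.cases i (fun k => (f k).1), by
          intro a b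
          refine Fin.cases ?_ (fun a => ?_) a <;> refine Fin.cases ?_ (fun b => ?_) b
          · simp
          · intro h; simp only [Fin.cases_zero, Fin.cases_succ] at h
            exact absurd h.symm (f b).2.2
          · intro h; simp only [Fin.cases_zero, Fin.cases_succ] at h
            exact absurd h (f a).2.2
          · intro h; simp only [Fin.cases_succ] at h
            rw [f.injective (Subtype.ext h)], rfl, fun k => (f k).2.1⟩
      left_inv := fun v => by
        apply Subtype.ext
        funext k
        refine Fin.cases ?_ (fun k => ?_) k
        · exact v.2.2.1.symm
        · rfl
      right_inv := fun f => by
        ext k; rfl }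
  rw [Nat.card_congr e, Nat.card_eq_fintype_card, Fintype.card_embedding_eq]
  have : Fintype.card (S \ {i} : Set (Fin n)) = l := by
    rw [← Nat.card_eq_fintype_card, Nat.card_coe_set_eq, Set.ncard_sdiff_singleton_of_mem hi, hS]
    omega
  rw [this]
  simp [Nat.descFactorial_self]

open Classical in
theorem comb (M : SIRGModel d Ω) (n : ℕ) (ω : Ω) {l : ℕ} (r : ℝ)
    (hr : 0 < r) {V : Type} [Fintype V] (H : SimpleGraph V) (h : V) (hl : Fintype.card V = l + 1) (i : Fin n) :
    ∑ v ∈ (Finset.univ : Finset (Fin (l + 1) → Fin n)).filter (fun v => Function.Injective v ∧ v 0 = i),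
      indic (EvA M n r (BH H h) v ω) = l.factorial * indic (M.euclNbhdIso n ω i r H h) := by
  by_cases hiso : M.euclNbhdIso n ω i r H h
  · rw [indic_of hiso, mul_one]
    have hiso' := hiso
    obtain ⟨hi, φ, hφ⟩ := hiso'
    have hcard : (M.euclSet n ω i r).ncard = l + 1 := by
      rw [← Nat.card_coe_set_eq, Nat.card_congr φ.toEquiv, Nat.card_eq_fintype_card, hl]
    have key : ∀ v ∈ (Finset.univ : Finset (Fin (l + 1) → Fin n)).filter (fun v => Function.Injective v ∧ v 0 = i),
        indic (EvA M n r (BH H h) v ω) = if (∀ k : Fin l, v k.succ ∈ M.euclSet n ω i r) then 1 else 0 := by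
      intro v hv
      obtain ⟨hvi, rfl⟩ := (Finset.mem_filter.1 hv).2
      unfold indic
      congr 1
      refine propext ⟨fun hE => hE.1, fun hk => ?_⟩
      have hsub : Set.range v ⊆ M.euclSet n ω (v 0) r := by
        rintro _ ⟨k, rfl⟩
        refine Fin.cases hi (fun k => hk k) k
      have hrange : Set.range v = M.euclSet n ω (v 0) r := by
        refine Set.eq_of_subset_of_ncard_le hsub ?_ (Set.toFinite _)
        rw [hcard, ← Set.image_univ, Set.ncard_image_of_injective _ hvi]
        simp [Set.ncard_univ]
      refine ⟨hk, fun j hj => ?_, (transfer M n ω v r hr hvi H h hrange).2 hiso⟩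
      rw [hrange] at hj
      exact not_lt.1 hj
    rw [Finset.sum_congr rfl key, Finset.sum_ite, Finset.sum_const_zero, add_zero, Finset.sum_const,
      nsmul_eq_mul, mul_one, Finset.filter_filter, ← card_T _ i hi hcard, Nat.card_eq_fintype_card,
      Fintype.card_subtype]
    simp only [and_assoc]
  · rw [indic_not hiso, mul_zero]
    refine Finset.sum_eq_zero fun v hv => ?_
    obtain ⟨hvi, rfl⟩ := (Finset.mem_filter.1 hv).2
    rw [indic_not]
    intro hE
    exact hiso ((transfer M n ω v r hr hvi H h (EvA_range M n ω v r hr _ hE)).1 hE.2.2)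

open Classical in
theorem comb_sum (M : SIRGModel d Ω) (n : ℕ) (ω : Ω) {l : ℕ} (r : ℝ)
    (hr : 0 < r) {V : Type} [Fintype V] (H : SimpleGraph V) (h : V) (hl : Fintype.card V = l + 1) :
    ∑ v ∈ (Finset.univ : Finset (Fin (l + 1) → Fin n)).filter (fun v => Function.Injective v),
      indic (EvA M n r (BH H h) v ω) = l.factorial * ∑ i, indic (M.euclNbhdIso n ω i r H h) := by
  rw [Finset.mul_sum, ← Finset.sum_fiberwise _ (fun v : Fin (l + 1) → Fin n => v 0)]
  refine Finset.sum_congr rfl fun i _ => ?_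
  rw [Finset.filter_filter, comb M n ω r hr H h hl]

theorem Y_law (hd : 1 ≤ d) (M : SIRGModel d Ω) {n : ℕ} (hn : n ≠ 0) :
    Measure.map (fun ω i => M.Y n i ω) M.P = Measure.pi fun _ : Fin n => unifBox d n := by
  have hub := unifBox_prob hd hn
  have hY : Measurable fun ω i => M.Y n i ω := measurable_pi_lambda _ fun i => M.Y_meas n i
  have hW : Measurable fun ω i => M.Wt n i ω := measurable_pi_lambda _ fun i => M.Wt_meas n i
  have hU : Measurable fun ω (p : {p : Fin n × Fin n // p.1 < p.2}) => M.U n p.1.1 p.1.2 ω :=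
    measurable_pi_lambda _ fun p => M.U_meas n _ _
  have hp := Measure.isProbabilityMeasure_map (μ := M.P) hW.aemeasurable
  have h := congrArg (Measure.map Prod.fst) (M.joint_law n)
  rw [Measure.map_map measurable_fst (hY.prodMk (hW.prodMk hU))] at h
  rw [Measure.map_fst_prod] at h
  simpa [Function.comp_def] using h

theorem pair_bound (hd : 1 ≤ d) (M : SIRGModel d Ω) {n : ℕ} (hn : n ≠ 0) (R : ℝ) {i j : Fin n} (hij : i ≠ j) :
    M.P {ω | dist (M.Y n i ω) (M.Y n j ω) < R} ≤ (n : ℝ≥0∞)⁻¹ * volume (Metric.ball (0 : Euc d) R) := by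
  have hub := unifBox_prob hd hn
  have hY : Measurable fun ω i => M.Y n i ω := measurable_pi_lambda _ fun i => M.Y_meas n i
  have h1 : MeasurePreserving (fun ω i => M.Y n i ω) M.P (Measure.pi fun _ : Fin n => unifBox d n) :=
    ⟨hY, Y_law hd M hn⟩
  have hinj : Function.Injective ![i, j] := by
    intro a b
    fin_cases a <;> fin_cases b <;> simp [hij, hij.symm]
  have h2 := mp_reindex (unifBox d n) ![i, j] hinj
  have h3 := measurePreserving_finTwoArrow (unifBox d n)
  have h4 := (h3.comp h2).comp h1
  have hm : MeasurableSet {q : Euc d × Euc d | dist q.1 q.2 < R} :=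
    measurableSet_lt (by fun_prop) (by fun_prop)
  have h5 := h4.measure_preimage hm.nullMeasurableSet
  have e : (((MeasurableEquiv.finTwoArrow : (Fin 2 → Euc d) ≃ᵐ _) ∘ fun y a => y (![i, j] a)) ∘ fun ω i => M.Y n i ω) ⁻¹'
    {q : Euc d × Euc d | dist q.1 q.2 < R} = {ω | dist (M.Y n i ω) (M.Y n j ω) < R} := by
    ext ω; simp [MeasurableEquiv.finTwoArrow]
  rw [e] at h5
  rw [h5, Measure.prod_apply hm]
  calc _ ≤ ∫⁻ x, (n : ℝ≥0∞)⁻¹ * volume (Metric.ball (0 : Euc d) R) ∂(unifBox d n) := by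
        refine lintegral_mono fun x => ?_
        have : Prod.mk x ⁻¹' {q : Euc d × Euc d | dist q.1 q.2 < R} = Metric.ball x R := by
          ext y; simp [dist_comm]
        rw [this, unifBox, Measure.smul_apply, smul_eq_mul, ← Measure.addHaar_ball_center volume x R]
        gcongr
        exact Measure.restrict_le_self
    _ = _ := by simp

/-- the joint sum -/
def sumInj (M : SIRGModel d Ω) (m : ℕ) {l : ℕ} (r : ℝ) (B : (Prs l → Prop) → Prop) (n : ℕ) (ω : Ω) : ℝ :=
  ∑ u : Fin m × Fin (l + 1) → Fin n, indic (Function.Injective u) *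
    indic (∀ c, EvA M n r B (fun k => u (c, k)) ω)

theorem EvAll_meas (M : SIRGModel d Ω) {m l : ℕ} (r : ℝ) (B : (Prs l → Prop) → Prop) (n : ℕ)
    (u : Fin m × Fin (l + 1) → Fin n) :
    MeasurableSet {ω | ∀ c, EvA M n r B (fun k => u (c, k)) ω} :=
  meas_all fun c => EvA_meas M n r B _

theorem indic_integrable {p : Ω → Prop} (P : Measure Ω) [IsProbabilityMeasure P]
    (h : MeasurableSet {a | p a}) : Integrable (fun a => indic (p a)) P :=
  Integrable.of_bound (indic_meas h).aestronglyMeasurable 1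
    (Eventually.of_forall fun a => by
      rw [Real.norm_of_nonneg (indic_nonneg _)]; exact indic_le_one _)

theorem sumInj_integrable (M : SIRGModel d Ω) (m : ℕ) {l : ℕ} (r : ℝ) (B : (Prs l → Prop) → Prop) (n : ℕ) :
    Integrable (sumInj M m r B n) M.P := by
  unfold sumInj
  exact integrable_finsetSum _ fun u _ => (indic_integrable M.P (EvAll_meas M r B n u)).const_mul _

theorem sumInj_int (M : SIRGModel d Ω) (m : ℕ) {l : ℕ} (r : ℝ) (B : (Prs l → Prop) → Prop) (n : ℕ) :
    ((n : ℝ) ^ m)⁻¹ * ∫ ω, sumInj M m r B n ω ∂M.P = (Sm M m r B n).toReal := by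
  classical
  unfold sumInj Sm
  rw [integral_finsetSum _ fun u _ => (indic_integrable M.P (EvAll_meas M r B n u)).const_mul _,
    ENNReal.toReal_mul, ENNReal.toReal_sum (fun v _ => measure_ne_top _ _)]
  congr 1
  · simp
  · rw [Finset.sum_filter]
    refine Finset.sum_congr rfl fun u _ => ?_
    rw [integral_const_mul, indic_integral _ (EvAll_meas M r B n u)]
    by_cases hu : Function.Injective u <;> simp [indic, hu, Measure.real]

theorem sumInj_one (M : SIRGModel d Ω) {l : ℕ} (r : ℝ)
    (hr : 0 < r) {V : Type} [Fintype V] (H : SimpleGraph V) (h : V) (hl : Fintype.card V = l + 1)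
    (n : ℕ) (ω : Ω) :
    sumInj M 1 (l := l) r (BH H h) n ω = l.factorial * ∑ i, indic (M.euclNbhdIso n ω i r H h) := by
  classical
  rw [← comb_sum M n ω r hr H h hl, Finset.sum_filter]
  unfold sumInj
  let e : (Fin (l + 1) → Fin n) ≃ (Fin 1 × Fin (l + 1) → Fin n) :=
    Equiv.arrowCongr (Equiv.uniqueProd (Fin (l + 1)) (Fin 1)).symm (Equiv.refl _)
  rw [← e.sum_comp]
  refine Finset.sum_congr rfl fun v _ => ?_
  have h1 : Function.Injective (e v) ↔ Function.Injective v := by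
    constructor
    · intro hv a b hab
      have := @hv (0, a) (0, b) hab
      exact congrArg Prod.snd this
    · rintro hv ⟨c, a⟩ ⟨c', b⟩ hab
      exact Prod.ext (Subsingleton.elim _ _) (hv hab)
  have h2 : (∀ c, EvA M n r (BH H h) (fun k => e v (c, k)) ω) ↔ EvA M n r (BH H h) v ω := by
    constructor
    · intro hh; exact hh 0
    · intro hh c; exact hh
  rw [propext h1, propext h2]
  by_cases hu : Function.Injective v <;> simp [indic, hu]

theorem sumInj_two (M : SIRGModel d Ω) {l : ℕ} (r : ℝ)
    (B : (Prs l → Prop) → Prop) (n : ℕ) (ω : Ω) :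
    sumInj M 2 (l := l) r B n ω = ∑ v : Fin (l + 1) → Fin n, ∑ v' : Fin (l + 1) → Fin n,
      indic (Function.Injective (fun a : Fin 2 × Fin (l + 1) => ![v, v'] a.1 a.2)) *
        indic (EvA M n r B v ω ∧ EvA M n r B v' ω) := by
  unfold sumInj
  rw [← Fintype.sum_prod_type']
  let e : (Fin (l + 1) → Fin n) × (Fin (l + 1) → Fin n) ≃ (Fin 2 × Fin (l + 1) → Fin n) :=
    (finTwoArrowEquiv _).symm.trans (Equiv.curry _ _ _).symm
  rw [← e.sum_comp]
  refine Finset.sum_congr rfl fun v _ => ?_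
  have h2 : (∀ c, EvA M n r B (fun k => e v (c, k)) ω) ↔ EvA M n r B v.1 ω ∧ EvA M n r B v.2 ω := by
    rw [Fin.forall_fin_two]; rfl
  rw [propext h2]; rfl

open Classical in
theorem pair_le (M : SIRGModel d Ω) (n : ℕ) (ω : Ω) {l : ℕ} (r : ℝ)
    (hr : 0 < r) {V : Type} [Fintype V] (H : SimpleGraph V) (h : V) (hl : Fintype.card V = l + 1) :
    (l.factorial : ℝ) ^ 2 * (∑ i, indic (M.euclNbhdIso n ω i r H h)) ^ 2 ≤
      (l.factorial : ℝ) ^ 2 * (∑ i, ∑ j, indic (dist (M.Y n i ω) (M.Y n j ω) < r + r)) +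
        sumInj M 2 (l := l) r (BH H h) n ω := by
  obtain ⟨K, hK⟩ : ∃ K : ℝ, K = (l.factorial : ℝ) := ⟨_, rfl⟩
  rw [← hK]
  have step : ∀ i j, K ^ 2 * (indic (M.euclNbhdIso n ω i r H h) * indic (M.euclNbhdIso n ω j r H h)) ≤
      K ^ 2 * indic (dist (M.Y n i ω) (M.Y n j ω) < r + r) +
      ∑ v : Fin (l + 1) → Fin n with v 0 = i, ∑ v' : Fin (l + 1) → Fin n with v' 0 = j,
        indic (Function.Injective (fun a : Fin 2 × Fin (l + 1) => ![v, v'] a.1 a.2)) *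
        indic (EvA M n r (BH H h) v ω ∧ EvA M n r (BH H h) v' ω) := by
    intro i j
    by_cases hd : dist (M.Y n i ω) (M.Y n j ω) < r + r
    · rw [indic_of hd, mul_one]
      have h1 : K ^ 2 * (indic (M.euclNbhdIso n ω i r H h) * indic (M.euclNbhdIso n ω j r H h)) ≤ K ^ 2 * 1 := by
        gcongr
        exact mul_le_one₀ (indic_le_one _) (indic_nonneg _) (indic_le_one _)
      have h2 : (0 : ℝ) ≤ ∑ v : Fin (l + 1) → Fin n with v 0 = i, ∑ v' : Fin (l + 1) → Fin n with v' 0 = j,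
        indic (Function.Injective (fun a : Fin 2 × Fin (l + 1) => ![v, v'] a.1 a.2)) *
        indic (EvA M n r (BH H h) v ω ∧ EvA M n r (BH H h) v' ω) :=
        Finset.sum_nonneg fun v _ => Finset.sum_nonneg fun v' _ => mul_nonneg (indic_nonneg _) (indic_nonneg _)
      linarith
    · rw [indic_not hd, mul_zero, zero_add]
      have e1 : K ^ 2 * (indic (M.euclNbhdIso n ω i r H h) * indic (M.euclNbhdIso n ω j r H h)) =
        (K * indic (M.euclNbhdIso n ω i r H h)) * (K * indic (M.euclNbhdIso n ω j r H h)) := by ring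
      rw [e1, hK, ← comb M n ω r hr H h hl i, ← comb M n ω r hr H h hl j, Finset.sum_mul_sum]
      have hsub : ∀ i, (Finset.univ : Finset (Fin (l + 1) → Fin n)).filter (fun v => Function.Injective v ∧ v 0 = i) ⊆
        (Finset.univ : Finset (Fin (l + 1) → Fin n)).filter (fun v => v 0 = i) := fun i v hv => by
          simp only [Finset.mem_filter, Finset.mem_univ, true_and] at hv ⊢
          exact hv.2
      refine (Finset.sum_le_sum fun v hv => Finset.sum_le_sum fun v' hv' => ?_).trans
        ((Finset.sum_le_sum fun v hv => Finset.sum_le_sum_of_subset_of_nonneg (hsub j) fun _ _ _ => ?_).trans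
        (Finset.sum_le_sum_of_subset_of_nonneg (hsub i) fun _ _ _ => ?_))
      · obtain ⟨hvi, hv0⟩ := (Finset.mem_filter.1 hv).2
        obtain ⟨hvi', hv0'⟩ := (Finset.mem_filter.1 hv').2
        by_cases hE : EvA M n r (BH H h) v ω
        swap
        · rw [indic_not hE, zero_mul]; exact mul_nonneg (indic_nonneg _) (indic_nonneg _)
        by_cases hE' : EvA M n r (BH H h) v' ω
        swap
        · rw [indic_not hE', mul_zero]; exact mul_nonneg (indic_nonneg _) (indic_nonneg _)
        rw [indic_of hE, indic_of hE', indic_of (And.intro hE hE'), indic_of, mul_one]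
        have hne : ∀ k k', v k ≠ v' k' := by
          intro k k' hkk
          have m1 : v k ∈ M.euclSet n ω (v 0) r := by
            rw [← EvA_range M n ω v r hr _ hE]; exact ⟨k, rfl⟩
          have m2 : v' k' ∈ M.euclSet n ω (v' 0) r := by
            rw [← EvA_range M n ω v' r hr _ hE']; exact ⟨k', rfl⟩
          rw [← hkk, hv0'] at m2
          rw [hv0] at m1
          apply hd
          have := dist_triangle_left (M.Y n i ω) (M.Y n j ω) (M.Y n (v k) ω)
          have m1' : dist (M.Y n (v k) ω) (M.Y n i ω) < r := m1
          have m2' : dist (M.Y n (v k) ω) (M.Y n j ω) < r := m2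
          linarith
        rintro ⟨c, k⟩ ⟨c', k'⟩ hcc
        fin_cases c <;> fin_cases c' <;> simp at hcc
        · rw [hvi hcc]
        · exact absurd hcc (hne _ _)
        · exact absurd hcc.symm (hne _ _)
        · rw [hvi' hcc]
      · exact mul_nonneg (indic_nonneg _) (indic_nonneg _)
      · exact Finset.sum_nonneg fun _ _ => mul_nonneg (indic_nonneg _) (indic_nonneg _)
  have h3 := Finset.sum_le_sum fun i (_ : i ∈ Finset.univ) => Finset.sum_le_sum fun j (_ : j ∈ Finset.univ) => step i j
  simp only [Finset.sum_add_distrib, ← Finset.mul_sum] at h3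
  have e2 : (∑ i, ∑ j, ∑ v : Fin (l + 1) → Fin n with v 0 = i, ∑ v' : Fin (l + 1) → Fin n with v' 0 = j,
        indic (Function.Injective (fun a : Fin 2 × Fin (l + 1) => ![v, v'] a.1 a.2)) *
        indic (EvA M n r (BH H h) v ω ∧ EvA M n r (BH H h) v' ω)) = sumInj M 2 (l := l) r (BH H h) n ω := by
    rw [sumInj_two, ← Finset.sum_fiberwise _ (fun v : Fin (l + 1) → Fin n => v 0)]
    refine Finset.sum_congr rfl fun i _ => ?_
    rw [Finset.sum_comm]
    refine Finset.sum_congr rfl fun v _ => ?_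
    exact Finset.sum_fiberwise _ (fun v : Fin (l + 1) → Fin n => v 0) _
  rw [e2] at h3
  rw [sq (∑ i, _), Finset.sum_mul_sum]
  simpa only [Finset.mul_sum] using h3

theorem close_meas (M : SIRGModel d Ω) (n : ℕ) (R : ℝ) (i j : Fin n) :
    MeasurableSet {ω | dist (M.Y n i ω) (M.Y n j ω) < R} :=
  measurableSet_lt ((M.Y_meas n i).dist (M.Y_meas n j)) measurable_const

theorem close_int (hd : 1 ≤ d) (M : SIRGModel d Ω) {n : ℕ} (hn : n ≠ 0) (R : ℝ) :
    ((n : ℝ) ^ 2)⁻¹ * ∫ ω, ∑ i, ∑ j, indic (dist (M.Y n i ω) (M.Y n j ω) < R) ∂M.P ≤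
      (1 + (volume (Metric.ball (0 : Euc d) R)).toReal) / n := by
  have hn0 : (0 : ℝ) < n := by exact_mod_cast Nat.pos_of_ne_zero hn
  set lam := (volume (Metric.ball (0 : Euc d) R)).toReal with hlam
  have hl0 : 0 ≤ lam := ENNReal.toReal_nonneg
  rw [integral_finsetSum _ fun i _ => integrable_finsetSum _ fun j _ =>
    indic_integrable M.P (close_meas M n R i j)]
  simp only [integral_finsetSum _ fun j _ => indic_integrable M.P (close_meas M n R _ j),
    indic_integral M.P (close_meas M n R _ _)]
  have hb : ∀ i j : Fin n, M.P.real {ω | dist (M.Y n i ω) (M.Y n j ω) < R} ≤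
      (if i = j then 1 else 0) + (n : ℝ)⁻¹ * lam := by
    intro i j
    have h0 : 0 ≤ (n : ℝ)⁻¹ * lam := by positivity
    by_cases hij : i = j
    · rw [if_pos hij]
      have : M.P.real {ω | dist (M.Y n i ω) (M.Y n j ω) < R} ≤ 1 := measureReal_le_one
      linarith
    · rw [if_neg hij, zero_add]
      have h1 := pair_bound hd M hn R hij
      have h2 := ENNReal.toReal_mono (ENNReal.mul_ne_top (by simpa using hn) measure_ball_lt_top.ne) h1
      rw [ENNReal.toReal_mul, ENNReal.toReal_inv, ENNReal.toReal_natCast] at h2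
      exact h2
  calc _ ≤ ((n : ℝ) ^ 2)⁻¹ * ∑ i : Fin n, ∑ j : Fin n, ((if i = j then (1 : ℝ) else 0) + (n : ℝ)⁻¹ * lam) := by
        gcongr with i _ j _
        exact hb i j
    _ = _ := by
        simp only [Finset.sum_add_distrib, Finset.sum_ite_eq, Finset.mem_univ, if_true, Finset.sum_const,
          Finset.card_univ, Fintype.card_fin, nsmul_eq_mul]
        field_simp

theorem main_tendsto (hd : 1 ≤ d) (M : SIRGModel d Ω) (A : SIRGWeakAssumptions M)
    (r : ℝ) (hr : 0 < r) {V : Type} [Fintype V] (H : SimpleGraph V) (h : V) :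
    TendstoInMeasure M.P (fun n ω => M.empNbhdFreq n r H h ω) atTop
      (fun _ => (limitNbhdProb d A.κ A.μW r H h).toReal) := by
  have hpr := A.probμW
  obtain ⟨l, hl⟩ : ∃ l, Fintype.card V = l + 1 :=
    ⟨Fintype.card V - 1, by have := Fintype.card_pos_iff.2 ⟨h⟩; omega⟩
  set p := (limitNbhdProb d A.κ A.μW r H h).toReal with hp
  obtain ⟨K, hK⟩ : ∃ K : ℝ, K = (l.factorial : ℝ) := ⟨_, rfl⟩
  have hK0 : 0 < K := by rw [hK]; exact_mod_cast l.factorial_pos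
  have hlim := limit_eq (d := d) A.κ_meas A.μW hr H h hl
  have hQ : (Q1 d A.κ A.μW r (BH (l := l) H h)).toReal = K * p := by
    rw [← hlim, ENNReal.toReal_mul, ENNReal.toReal_natCast, hK]
  have hQT : Q1 d A.κ A.μW r (BH (l := l) H h) ≠ ∞ := by
    have hpr1 : ∀ w, ∫⁻ z, f1 d A.κ r (BH (l := l) H h) w z ∂(Measure.pi fun _ : Fin l => (volume : Measure (Euc d))) ≤
        (Measure.pi fun _ : Fin l => (volume : Measure (Euc d))) (inB1 d l r) := by
      intro w
      rw [← lintegral_indicator_one (inB1_meas l r)]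
      refine lintegral_mono fun z => ?_
      unfold f1
      refine (mul_le_of_le_one_right' ?_).trans (mul_le_of_le_one_right' (Qf_le _ _))
      rw [ENNReal.ofReal_le_one, Real.exp_le_one_iff]
      simp
    have hb : (Measure.pi fun _ : Fin l => (volume : Measure (Euc d))) (inB1 d l r) ≠ ∞ := by
      have : inB1 d l r = Set.univ.pi fun _ => Metric.ball 0 r := by
        ext z; simp [inB1]
      rw [this, Measure.pi_pi]
      exact ENNReal.prod_ne_top fun _ _ => measure_ball_lt_top.ne
    refine ne_top_of_le_ne_top hb ?_
    unfold Q1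
    refine (lintegral_mono hpr1).trans ?_
    simp
  have t1 : Tendsto (fun n => (Sm M 1 r (BH (l := l) H h) n).toReal) atTop (𝓝 (K * p)) := by
    have := (ENNReal.tendsto_toReal (ENNReal.pow_ne_top hQT)).comp (Sm_tendsto hd M A 1 r hr (BH (l := l) H h))
    rw [pow_one, hQ] at this
    exact this
  have t2 : Tendsto (fun n => (Sm M 2 r (BH (l := l) H h) n).toReal) atTop (𝓝 ((K * p) ^ 2)) := by
    have := (ENNReal.tendsto_toReal (ENNReal.pow_ne_top hQT)).comp (Sm_tendsto hd M A 2 r hr (BH (l := l) H h))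
    rw [ENNReal.toReal_pow, hQ] at this
    exact this
  -- relation with `sumInj`
  have hC : ∀ n ω, M.empNbhdFreq n r H h ω = K⁻¹ * ((n : ℝ)⁻¹ * sumInj M 1 (l := l) r (BH H h) n ω) := by
    intro n ω
    rw [sumInj_one M r hr H h hl, ← hK, SIRGModel.empNbhdFreq]
    field_simp
  have hCi : ∀ n, Integrable (fun ω => M.empNbhdFreq n r H h ω) M.P := by
    intro n
    simp only [hC]
    exact ((sumInj_integrable M 1 r _ n).const_mul _).const_mul _
  have hC0 : ∀ n ω, 0 ≤ M.empNbhdFreq n r H h ω := fun n ω =>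
    div_nonneg (Finset.sum_nonneg fun i _ => indic_nonneg _) (by positivity)
  have hC1 : ∀ n ω, M.empNbhdFreq n r H h ω ≤ 1 := by
    intro n ω
    refine div_le_one_of_le₀ ?_ (by positivity)
    refine (Finset.sum_le_sum fun i _ => indic_le_one _).trans ?_
    simp
  have hC2i : ∀ n, Integrable (fun ω => M.empNbhdFreq n r H h ω ^ 2) M.P := by
    intro n
    refine Integrable.of_bound ((hCi n).aestronglyMeasurable.pow 2) 1 (Eventually.of_forall fun ω => ?_)
    rw [norm_pow, Real.norm_of_nonneg (hC0 n ω)]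
    exact pow_le_one₀ (hC0 n ω) (hC1 n ω)
  have hE1 : ∀ n, ∫ ω, M.empNbhdFreq n r H h ω ∂M.P = K⁻¹ * (Sm M 1 r (BH (l := l) H h) n).toReal := by
    intro n
    simp only [hC]
    rw [integral_const_mul, integral_const_mul, ← sumInj_int, pow_one]
  have hE2 : ∀ n, n ≠ 0 → ∫ ω, M.empNbhdFreq n r H h ω ^ 2 ∂M.P ≤
      (1 + (volume (Metric.ball (0 : Euc d) (r + r))).toReal) / n +
        (K ^ 2)⁻¹ * (Sm M 2 r (BH (l := l) H h) n).toReal := by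
    intro n hn
    have hn0 : (0 : ℝ) < n := by exact_mod_cast Nat.pos_of_ne_zero hn
    have hci : Integrable (fun ω => ∑ i, ∑ j, indic (dist (M.Y n i ω) (M.Y n j ω) < r + r)) M.P :=
      integrable_finsetSum _ fun i _ => integrable_finsetSum _ fun j _ =>
        indic_integrable M.P (close_meas M n _ i j)
    have hsi := sumInj_integrable M 2 (l := l) r (BH H h) n
    calc ∫ ω, M.empNbhdFreq n r H h ω ^ 2 ∂M.P
        ≤ ∫ ω, (((n : ℝ) ^ 2)⁻¹ * (∑ i, ∑ j, indic (dist (M.Y n i ω) (M.Y n j ω) < r + r)) +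
            (K ^ 2)⁻¹ * (((n : ℝ) ^ 2)⁻¹ * sumInj M 2 (l := l) r (BH H h) n ω)) ∂M.P := by
          refine integral_mono (hC2i n) ((hci.const_mul _).add ((hsi.const_mul _).const_mul _)) fun ω => ?_
          have hple := pair_le M n ω r hr H h hl
          rw [← hK] at hple
          have e : M.empNbhdFreq n r H h ω ^ 2 = ((n : ℝ) ^ 2)⁻¹ * (K ^ 2)⁻¹ *
              (K ^ 2 * (∑ i, indic (M.euclNbhdIso n ω i r H h)) ^ 2) := by
            rw [SIRGModel.empNbhdFreq]; field_simp
          dsimp only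
          rw [e]
          calc _ ≤ ((n : ℝ) ^ 2)⁻¹ * (K ^ 2)⁻¹ * (K ^ 2 * (∑ i, ∑ j, indic (dist (M.Y n i ω) (M.Y n j ω) < r + r)) +
                sumInj M 2 (l := l) r (BH H h) n ω) := by gcongr
            _ = _ := by field_simp
      _ = ((n : ℝ) ^ 2)⁻¹ * ∫ ω, (∑ i, ∑ j, indic (dist (M.Y n i ω) (M.Y n j ω) < r + r)) ∂M.P +
            (K ^ 2)⁻¹ * (((n : ℝ) ^ 2)⁻¹ * ∫ ω, sumInj M 2 (l := l) r (BH H h) n ω ∂M.P) := by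
          rw [integral_add (hci.const_mul _) ((hsi.const_mul _).const_mul _), integral_const_mul,
            integral_const_mul, integral_const_mul]
      _ ≤ _ := by
          rw [sumInj_int]
          gcongr
          exact close_int hd M hn (r + r)
  -- variance bound
  have hvar : Tendsto (fun n : ℕ => (1 + (volume (Metric.ball (0 : Euc d) (r + r))).toReal) / n +
        (K ^ 2)⁻¹ * (Sm M 2 r (BH (l := l) H h) n).toReal -
        2 * p * (K⁻¹ * (Sm M 1 r (BH (l := l) H h) n).toReal) + p ^ 2) atTop (𝓝 0) := by
    have := (((tendsto_const_div_atTop_nhds_zero_nat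
      (1 + (volume (Metric.ball (0 : Euc d) (r + r))).toReal)).add (t2.const_mul (K ^ 2)⁻¹)).sub
      ((t1.const_mul K⁻¹).const_mul (2 * p))).add (tendsto_const_nhds (x := p ^ 2))
    convert this using 2
    field_simp
    ring
  rw [tendstoInMeasure_iff_norm]
  intro ε hε
  have hreal : Tendsto (fun n => M.P.real {ω | ε ≤ ‖M.empNbhdFreq n r H h ω - p‖}) atTop (𝓝 0) := by
    have hv2 := hvar.const_mul (ε ^ 2)⁻¹
    rw [mul_zero] at hv2
    refine tendsto_of_tendsto_of_tendsto_of_le_of_le' tendsto_const_nhds hv2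
      (Eventually.of_forall fun n => measureReal_nonneg) ?_
    filter_upwards [eventually_ne_atTop 0] with n hn
    have hi : Integrable (fun ω => M.empNbhdFreq n r H h ω ^ 2 - 2 * p * M.empNbhdFreq n r H h ω) M.P :=
      (hC2i n).sub ((hCi n).const_mul _)
    have hi2 : Integrable (fun ω => M.empNbhdFreq n r H h ω ^ 2 - 2 * p * M.empNbhdFreq n r H h ω + p ^ 2) M.P :=
      hi.add (integrable_const _)
    have hnn : 0 ≤ᵐ[M.P] (fun ω => M.empNbhdFreq n r H h ω ^ 2 - 2 * p * M.empNbhdFreq n r H h ω + p ^ 2) :=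
      Eventually.of_forall fun ω => by
        have := sq_nonneg (M.empNbhdFreq n r H h ω - p)
        simp only [Pi.zero_apply]
        nlinarith
    have hmk := mul_meas_ge_le_integral_of_nonneg hnn hi2 (ε ^ 2)
    rw [integral_add hi (integrable_const _), integral_sub (hC2i n) ((hCi n).const_mul _),
      integral_const_mul, hE1, integral_const, probReal_univ, one_smul] at hmk
    have hset : {ω | ε ≤ ‖M.empNbhdFreq n r H h ω - p‖} =
        {ω | ε ^ 2 ≤ M.empNbhdFreq n r H h ω ^ 2 - 2 * p * M.empNbhdFreq n r H h ω + p ^ 2} := by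
      ext ω
      simp only [Set.mem_ofPred_eq]
      have e : M.empNbhdFreq n r H h ω ^ 2 - 2 * p * M.empNbhdFreq n r H h ω + p ^ 2 =
        ‖M.empNbhdFreq n r H h ω - p‖ ^ 2 := by
        rw [Real.norm_eq_abs, sq_abs]; ring
      rw [e, sq_le_sq₀ hε.le (norm_nonneg _)]
    rw [hset, le_inv_mul_iff₀ (by positivity)]
    have := hE2 n hn
    linarith
  have := ENNReal.tendsto_ofReal hreal
  rw [ENNReal.ofReal_zero] at this
  refine this.congr fun n => ?_
  exact ofReal_measureReal

/-- Convergence in probability of the empirical Euclidean neighbourhood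
frequencies. Under Assumptions (A1)–(A3), for every `r > 0` and every finite rooted graph
`(H, h)`, `C_{r,n}(H,h) = (1/n) Σ_{i=1}^n 1{F^{𝔾_n}_i(r) ≅ (H,h)}` converges in
probability to the deterministic limit `P(F_r ≅ (H,h))`. -/
theorem stmt3 {d : ℕ} (hd : 1 ≤ d) {Ω : Type} [MeasurableSpace Ω]
    (M : SIRGModel d Ω) (A : SIRGAssumptions M)
    (r : ℝ) (hr : 0 < r) {V : Type} [Fintype V] (H : SimpleGraph V) (h : V) :
    TendstoInMeasure M.P (fun n ω => M.empNbhdFreq n r H h ω) atTop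
      (fun _ => (limitNbhdProb d A.κ A.μW r H h).toReal) := by
  exact main_tendsto hd M A.toSIRGWeakAssumptions r hr H h

end
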